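/- arXiv:1112.3587 — 2 statements merged into one kernel-verified Lean document; each statement's English description precedes it below -/
import Mathlib

section
/- Let X ⊂ ℝ² be a compact, simply connected, locally connected set, let f : X → Y ⊂ ℝ² be a homeomorphism onto its image isotopic to the identity on X, and let C be a connected component of X ∩ Y. If f has no fixed point in C, then f has no recurrent point in C; that is, there is no x ∈ C with fⁿ(x) ∈ C for all n ∈ ℕ and with a strictly increasing sequence (n_k) such that f^{n_k}(x) → x as k → ∞. -/
open Set Filter Topology

noncomputable section

/-- The real plane. -/
abbrev Plane : Type := EuclideanSpace ℝ (Fin 2)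

/-- `f` restricted to `X` is a homeomorphism onto its image `Y`
(for compact `X`, a continuous injection is a homeomorphism onto its image). -/
def IsHomeoOnto (f : Plane → Plane) (X Y : Set Plane) : Prop :=
  ContinuousOn f X ∧ Set.InjOn f X ∧ f '' X = Y

/-- `f : X → f(X)` is isotopic to the identity on `X`: there is a continuous family
of homeomorphisms (continuous injections, `X` being compact in applications)
`h_t : X → h_t(X)`, `t ∈ [0,1]`, with `h_0 = id_X` and `h_1 = f`. -/
def IsotopicToIdOn (f : Plane → Plane) (X : Set Plane) : Prop :=
  ∃ H : ℝ → Plane → Plane,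
    ContinuousOn (fun p : ℝ × Plane => H p.1 p.2) (Set.Icc (0:ℝ) 1 ×ˢ X) ∧
    (∀ x ∈ X, H 0 x = x) ∧
    (∀ x ∈ X, H 1 x = f x) ∧
    (∀ t ∈ Set.Icc (0:ℝ) 1, Set.InjOn (H t) X)

/-- A Jordan domain: a subset of the plane homeomorphic to the closed unit disk. -/
def IsJordanDomain (D : Set Plane) : Prop :=
  Nonempty (↥D ≃ₜ ↥(Metric.closedBall (0:Plane) 1))

/-- A self-homeomorphism of the plane is orientation-preserving iff it is isotopic to
the identity through homeomorphisms of the plane (note that a continuous bijection of the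
plane is automatically a homeomorphism, by invariance of domain). -/
def IsOrientationPreservingPlaneHomeo (F : Plane ≃ₜ Plane) : Prop :=
  ∃ H : ℝ → Plane → Plane,
    Continuous (fun p : ℝ × Plane => H p.1 p.2) ∧
    (∀ x, H 0 x = x) ∧
    (∀ x, H 1 x = F x) ∧
    (∀ t ∈ Set.Icc (0:ℝ) 1, Function.Bijective (H t))

/-- A homeomorphism between planar sets (here: the restriction of `f` to `X`) is
orientation-preserving if it extends to an orientation-preserving homeomorphism of the plane. -/
def OrientationPreservingOn (f : Plane → Plane) (X : Set Plane) : Prop :=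
  ∃ F : Plane ≃ₜ Plane, IsOrientationPreservingPlaneHomeo F ∧ Set.EqOn f (⇑F) X

/-- A Jordan curve: the image of a topological embedding of the circle
(a continuous injection of the compact circle, hence an embedding). -/
def IsJordanCurve (C : Set Plane) : Prop :=
  ∃ γ : Plane → Plane, ContinuousOn γ (Metric.sphere (0:Plane) 1) ∧
    Set.InjOn γ (Metric.sphere (0:Plane) 1) ∧
    γ '' Metric.sphere (0:Plane) 1 = C

section Logarithms

open Complex unitInterval

/-- A nonvanishing continuous function on a simply connected, locally path connected space has a
continuous logarithm. -/
lemma exists_log {A : Type*} [TopologicalSpace A] [SimplyConnectedSpace A]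
    [LocallyPathConnectedSpace A] {u : A → ℂ} (hu : Continuous u) (h0 : ∀ a, u a ≠ 0) :
    ∃ l : A → ℂ, Continuous l ∧ ∀ a, exp (l a) = u a := by
  obtain ⟨a₀⟩ := (inferInstance : PathConnectedSpace A).nonempty
  obtain ⟨F, hF, -⟩ := isCoveringMap_exp.existsUnique_continuousMap_lifts
    (⟨fun a => ⟨u a, h0 a⟩, by fun_prop⟩ : C(A, {z : ℂ // z ≠ 0})) a₀ (log (u a₀))
    (by ext; simp [exp_log (h0 a₀)])
  exact ⟨F, F.continuous, fun a => congrArg Subtype.val (congrFun hF.2 a)⟩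

/-- Two continuous logarithms of the same function on a preconnected set differ by a constant. -/
lemma log_sub_const {A : Type*} [TopologicalSpace A] {S : Set A} (hS : IsPreconnected S)
    {l l' : A → ℂ} (hl : ContinuousOn l S) (hl' : ContinuousOn l' S)
    (h : ∀ a ∈ S, exp (l a) = exp (l' a)) {a b : A} (ha : a ∈ S) (hb : b ∈ S) :
    l a - l' a = l b - l' b :=
  isCoveringMap_exp.constOn_of_comp hS (g := fun a => l a - l' a) (hl.sub hl')
    (fun x hx y hy => by ext; simp [exp_sub, h x hx, h y hy]) ha hb

/-- The variation of a continuous logarithm of `u` along the unit interval. -/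
def dlog (u : I → ℂ) : ℂ :=
  open Classical in
  if h : ∃ l : C(I, ℂ), ∀ t, exp (l t) = u t then h.choose 1 - h.choose 0 else 0

lemma dlog_eq {u l : I → ℂ} (hl : Continuous l) (h : ∀ t, exp (l t) = u t) :
    dlog u = l 1 - l 0 := by
  have hex : ∃ l : C(I, ℂ), ∀ t, exp (l t) = u t := ⟨⟨l, hl⟩, h⟩
  have := log_sub_const (S := univ) isPreconnected_univ hex.choose.continuous.continuousOn
    hl.continuousOn (fun a _ => by rw [hex.choose_spec, h]) (mem_univ 0) (mem_univ 1)
  rw [dlog, dif_pos hex]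
  linear_combination -this

lemma exists_log_square {u : I × I → ℂ} (hu : Continuous u) (h0 : ∀ a, u a ≠ 0) :
    ∃ l : I × I → ℂ, Continuous l ∧ ∀ a, exp (l a) = u a := by
  obtain ⟨l, hl, h⟩ := exists_log (A := ℝ × ℝ)
    (u := fun p => u (projIcc 0 1 zero_le_one p.1, projIcc 0 1 zero_le_one p.2))
    (by fun_prop) (fun p => h0 _)
  exact ⟨fun p => l (p.1, p.2), by fun_prop, fun p => by simp [h]⟩

lemma exists_log_interval {u : I → ℂ} (hu : Continuous u) (h0 : ∀ a, u a ≠ 0) :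
    ∃ l : I → ℂ, Continuous l ∧ ∀ a, exp (l a) = u a := by
  obtain ⟨l, hl, h⟩ := exists_log_square (u := fun p => u p.1) (by fun_prop) (fun p => h0 p.1)
  exact ⟨fun t => l (t, 0), by fun_prop, fun t => h (t, 0)⟩

lemma exp_dlog {u : I → ℂ} (hu : Continuous u) (h0 : ∀ a, u a ≠ 0) :
    exp (dlog u) = u 1 / u 0 := by
  obtain ⟨l, hl, h⟩ := exists_log_interval hu h0
  rw [dlog_eq hl h, exp_sub, h, h]

lemma dlog_mul_exp {u l : I → ℂ} (hu : Continuous u) (h0 : ∀ a, u a ≠ 0) (hl : Continuous l) :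
    dlog (fun t => u t * exp (l t)) = dlog u + (l 1 - l 0) := by
  obtain ⟨k, hk, h⟩ := exists_log_interval hu h0
  rw [dlog_eq hk h, dlog_eq (l := fun t => k t + l t) (by fun_prop) (fun t => by rw [exp_add, h])]
  ring

lemma dlog_neg {u : I → ℂ} (hu : Continuous u) (h0 : ∀ a, u a ≠ 0) :
    dlog (fun t => - u t) = dlog u := by
  have := dlog_mul_exp hu h0 (l := fun _ => Real.pi * Complex.I) (by fun_prop)
  simpa [exp_pi_mul_I] using this

lemma dlog_square {u : I × I → ℂ} (hu : Continuous u) (h0 : ∀ a, u a ≠ 0) :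
    dlog (fun t => u (0, t)) + dlog (fun t => u (t, 1)) =
      dlog (fun t => u (t, 0)) + dlog (fun t => u (1, t)) ∧
    dlog (fun t => u (0, t)) + dlog (fun t => u (t, 1)) = dlog (fun t => u (t, t)) := by
  obtain ⟨l, hl, h⟩ := exists_log_square hu h0
  rw [dlog_eq (l := fun t => l (0, t)) (by fun_prop) (fun t => h _),
    dlog_eq (l := fun t => l (t, 1)) (by fun_prop) (fun t => h _),
    dlog_eq (l := fun t => l (t, 0)) (by fun_prop) (fun t => h _),
    dlog_eq (l := fun t => l (1, t)) (by fun_prop) (fun t => h _),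
    dlog_eq (l := fun t => l (t, t)) (by fun_prop) (fun t => h _)]
  constructor <;> ring

/-- The variation of `log (γ - w)` along `γ`. -/
def wind (γ : I → ℂ) (w : ℂ) : ℂ := dlog fun t => γ t - w

lemma exp_wind {a b : ℂ} (γ : Path a b) {w : ℂ} (hw : w ∉ range γ) :
    exp (wind γ w) = (b - w) / (a - w) := by
  rw [wind, exp_dlog (by fun_prop) (fun t h => hw ⟨t, sub_eq_zero.1 h⟩)]
  simp

lemma wind_trans {a b c : ℂ} (γ : Path a b) (δ : Path b c) {w : ℂ} (hγ : w ∉ range γ)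
    (hδ : w ∉ range δ) : wind (γ.trans δ) w = wind γ w + wind δ w := by
  obtain ⟨l, hl, h⟩ := exists_log_interval (u := fun t => γ t - w) (by fun_prop)
    (fun t h => hγ ⟨t, sub_eq_zero.1 h⟩)
  obtain ⟨k, hk, h'⟩ := exists_log_interval (u := fun t => δ t - w) (by fun_prop)
    (fun t h => hδ ⟨t, sub_eq_zero.1 h⟩)
  let p : Path (l 0) (l 1) := ⟨⟨l, hl⟩, rfl, rfl⟩
  let q : Path (l 1) (k 1 - k 0 + l 1) :=
    ⟨⟨fun t => k t - k 0 + l 1, by fun_prop⟩, by simp, rfl⟩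
  have e1 : exp (k 0) = exp (l 1) := by rw [h, h']; simp
  have key : ∀ t, exp (p.trans q t) = γ.trans δ t - w := by
    intro t
    rw [Path.trans_apply, Path.trans_apply]
    split_ifs
    · exact h _
    · change exp (k _ - k 0 + l 1) = _
      rw [exp_add, exp_sub, ← e1, div_mul_cancel₀ _ (exp_ne_zero _)]
      exact h' _
  rw [wind, dlog_eq (by fun_prop) key, wind, dlog_eq hl h, wind, dlog_eq hk h']
  simp
  ring

lemma wind_refl (a w : ℂ) : wind (Path.refl a) w = 0 := by
  by_cases h : a = w
  · rw [wind, dlog, dif_neg]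
    rintro ⟨l, hl⟩
    exact exp_ne_zero _ ((hl 0).trans (by simp [h]))
  · rw [wind, dlog_eq (l := fun _ => log (a - w)) (by fun_prop)
      (fun t => by simp [exp_log (sub_ne_zero.2 h)])]
    simp

lemma wind_swap {γ : I → ℂ} (hγ : Continuous γ) {w : ℂ} (hw : ∀ t, γ t ≠ w) :
    dlog (fun t => w - γ t) = wind γ w := by
  rw [wind, ← dlog_neg (by fun_prop) (fun t => sub_ne_zero.2 (hw t))]
  simp

/-- The rectangle identity for two disjoint paths. -/
lemma wind_rectangle {a b c d : ℂ} (γ : Path a b) (δ : Path c d)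
    (h : Disjoint (range γ) (range δ)) :
    wind γ c + wind δ b = wind δ a + wind γ d ∧
      exp (wind γ c + wind δ b) = (d - b) / (c - a) := by
  have hne : ∀ s t, γ s ≠ δ t := fun s t e => h.ne_of_mem (mem_range_self s) (mem_range_self t) e
  have hu : Continuous fun p : I × I => δ p.2 - γ p.1 := by fun_prop
  have h0 : ∀ p : I × I, δ p.2 - γ p.1 ≠ 0 := fun p => sub_ne_zero.2 (hne _ _).symm
  have := dlog_square hu h0
  have e1 := wind_swap γ.continuous (fun t => hne t 0)
  have e2 := wind_swap γ.continuous (fun t => hne t 1)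
  simp only [γ.source, δ.source, γ.target, δ.target] at *
  rw [e1, e2] at this
  refine ⟨this.1.symm, ?_⟩
  change exp (wind γ c + dlog fun t => δ t - b) = _
  rw [← this.1, this.2, exp_dlog (by fun_prop) (fun t => h0 (t, t))]
  simp

end Logarithms

section ForwardPaths

open unitInterval

variable {f : ℂ → ℂ} {C : Set ℂ}

/-- A path none of whose points is the image under `f` of the same or a later point. -/
def IsForward (f : ℂ → ℂ) (γ : I → ℂ) : Prop := ∀ s t, s ≤ t → γ s ≠ f (γ t)

/-- The points `a` and `b` are joined in `S` by a forward path. -/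
def ForwardJoined (f : ℂ → ℂ) (S : Set ℂ) (a b : ℂ) : Prop :=
  ∃ γ : Path a b, range γ ⊆ S ∧ IsForward f γ

lemma ForwardJoined.mono {S T : Set ℂ} {a b : ℂ} (h : ForwardJoined f S a b) (hST : S ⊆ T) :
    ForwardJoined f T a b :=
  let ⟨γ, h1, h2⟩ := h
  ⟨γ, h1.trans hST, h2⟩

lemma ForwardJoined.target_mem {S : Set ℂ} {a b : ℂ} (h : ForwardJoined f S a b) : b ∈ S :=
  let ⟨γ, h1, _⟩ := h
  h1 ⟨1, γ.target⟩

lemma ForwardJoined.refl {a : ℂ} (h : f a ≠ a) : ForwardJoined f {a} a a :=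
  ⟨Path.refl a, by simp, fun _ _ _ => by simpa using h.symm⟩

/-- Concatenation of forward paths. -/
lemma ForwardJoined.trans {S T : Set ℂ} {a b c : ℂ}
    (h1 : ForwardJoined f (insert b S) a b) (h2 : ForwardJoined f (insert b T) b c)
    (h : ∀ s ∈ S, ∀ t ∈ T, s ≠ f t) : ForwardJoined f (insert b (S ∪ T)) a c := by
  obtain ⟨γ, hγ, hγ'⟩ := h1
  obtain ⟨δ, hδ, hδ'⟩ := h2
  have key : ∀ s t, γ s ≠ f (δ t) := by
    intro s t
    rcases hγ ⟨s, rfl⟩ with h1 | h1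
    · rw [h1]; simpa using hδ' 0 t t.2.1
    rcases hδ ⟨t, rfl⟩ with h2 | h2
    · rw [h2]; simpa using hγ' s 1 s.2.2
    exact h _ h1 _ h2
  refine ⟨γ.trans δ, ?_, ?_⟩
  · rw [Path.trans_range]
    exact union_subset (hγ.trans (insert_subset_insert subset_union_left))
      (hδ.trans (insert_subset_insert subset_union_right))
  · intro s t hst
    rw [Path.trans_apply, Path.trans_apply]
    split_ifs with h1 h2 h2
    · exact hγ' _ _ (by simpa [Subtype.ext_iff, ← Subtype.coe_le_coe] using hst)
    · exact key _ _
    · exact absurd (le_trans (Subtype.coe_le_coe.2 hst) h2) h1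
    · exact hδ' _ _ (by simpa [Subtype.ext_iff, ← Subtype.coe_le_coe] using hst)

/-- A cycle of `n` pairwise disjoint sets in `C`, each containing a forward path whose end is mapped
by `f` to the beginning of the next one. -/
def HasCycle (f : ℂ → ℂ) (C : Set ℂ) (n : ℕ) : Prop :=
  0 < n ∧ ∃ (e o : ℕ → ℂ) (S : ℕ → Set ℂ), (∀ i < n, S i ⊆ C ∧ ForwardJoined f (S i) (e i) (o i)) ∧
    (∀ i < n, ∀ j < n, i ≠ j → Disjoint (S i) (S j)) ∧
    (∀ i, i + 1 < n → f (o i) = e (i + 1)) ∧ f (o (n - 1)) = e 0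

lemma not_hasCycle_one : ¬ HasCycle f C 1 := by
  rintro ⟨-, e, o, S, h1, -, -, h2⟩
  obtain ⟨γ, -, hγ⟩ := (h1 0 one_pos).2
  exact hγ 0 1 zero_le_one (by simpa using h2.symm)

/-- Two disjoint forward paths exchanged by `f`, the second one being constant. -/
lemma hasCycle_two {S : Set ℂ} {a b : ℂ} (hS : S ⊆ C) (h : ForwardJoined f S a b)
    (hb : f b ∈ C) (hbS : f b ∉ S) (hfix : f (f b) ≠ f b) (hba : f (f b) = a) :
    HasCycle f C 2 := by
  refine ⟨two_pos, fun i => if i = 0 then a else f b, fun i => if i = 0 then b else f b,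
    fun i => if i = 0 then S else {f b}, ?_, ?_, ?_, ?_⟩
  · intro i hi
    interval_cases i
    · exact ⟨hS, h⟩
    · exact ⟨by simpa using hb, by simpa using ForwardJoined.refl hfix⟩
  · intro i hi j hj hij
    interval_cases i <;> interval_cases j <;> simp_all
  · intro i hi
    obtain rfl : i = 0 := by omega
    simp
  · simpa using hba

variable {n : ℕ} {e o : ZMod n → ℂ} {F : ZMod n → Set ℂ}

/-- A cyclic family of pairwise disjoint subsets of `C` with entrances `e` and exits `o`, every
point of which is joined by forward paths with the entrance and the exit. -/
structure GoodFamily (f : ℂ → ℂ) (C : Set ℂ) (e o : ZMod n → ℂ) (F : ZMod n → Set ℂ) : Prop where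
  sub : ∀ i, F i ⊆ C
  entrance_mem : ∀ i, e i ∈ F i
  from_entrance : ∀ i, ∀ y ∈ F i, ForwardJoined f (F i) (e i) y
  to_exit : ∀ i, ∀ y ∈ F i, ForwardJoined f (F i) y (o i)
  disj : ∀ i j, i ≠ j → Disjoint (F i) (F j)
  step : ∀ i, f (o i) = e (i + 1)

lemma add_natCast_ne (i : ZMod n) {s t : ℕ} (hs : s < n) (ht : t < n) (hst : s ≠ t) :
    i + (s : ZMod n) ≠ i + t := by
  intro h
  rw [add_right_inj, ZMod.natCast_eq_natCast_iff', Nat.mod_eq_of_lt hs, Nat.mod_eq_of_lt ht] at h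
  exact hst h

namespace GoodFamily

lemma exit_mem (hF : GoodFamily f C e o F) (i : ZMod n) : o i ∈ F i :=
  (hF.to_exit i _ (hF.entrance_mem i)).target_mem

lemma joined (hF : GoodFamily f C e o F) (i : ZMod n) : ForwardJoined f (F i) (e i) (o i) :=
  hF.to_exit i _ (hF.entrance_mem i)

lemma eq_of_mem (hF : GoodFamily f C e o F) {i j : ZMod n} {x : ℂ} (h1 : x ∈ F i) (h2 : x ∈ F j) :
    i = j := by
  by_contra h
  exact (hF.disj i j h).ne_of_mem h1 h2 rfl

/-- In a shortest cycle `f` does not map `F (j + d)` back to `F j`. -/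
lemma not_mem_back (hF : GoodFamily f C e o F) (hmin : ∀ k < n, ¬ HasCycle f C k) {j : ZMod n}
    {d : ℕ} (hd : 1 ≤ d) (hdn : d + 2 ≤ n) {x : ℂ} (hx : x ∈ F (j + d)) : f x ∉ F j := by
  intro hfx
  refine hmin (d + 1) (by omega) ⟨by omega, fun t => if t = 0 then f x else e (j + t),
    fun t => if t = d then x else o (j + t), fun t => F (j + t), ?_, ?_, ?_, ?_⟩
  · intro i hi
    refine ⟨hF.sub _, ?_⟩
    dsimp only
    split_ifs with h1 h2 h2
    · omega
    · subst h1
      simpa using hF.to_exit j _ hfx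
    · subst h2
      exact hF.from_entrance _ _ hx
    · exact hF.joined _
  · exact fun i hi k hk hik => hF.disj _ _ (add_natCast_ne _ (by omega) (by omega) hik)
  · intro i hi
    dsimp only
    rw [if_neg (by omega), if_neg (by omega), hF.step]
    push_cast
    rw [add_assoc]
  · simp

/-- In a shortest cycle `f ∘ f` does not map `F (j + d)` back to `F j` through `C`. -/
lemma not_mem_back_two (hF : GoodFamily f C e o F) (hmin : ∀ k < n, ¬ HasCycle f C k)
    (hfix : ∀ x ∈ C, f x ≠ x) {j : ZMod n}
    {d : ℕ} (hd : 1 ≤ d) (hdn : d + 3 ≤ n) {x : ℂ} (hx : x ∈ F (j + d)) (hfx : f x ∈ C) :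
    f (f x) ∉ F j := by
  intro hffx
  have hno : ∀ t ≤ d, f x ∉ F (j + t) := by
    intro t ht h
    rcases ht.lt_or_eq with h1 | rfl
    · refine hF.not_mem_back hmin (j := j + t) (d := d - t) (by omega) (by omega) ?_ h
      rwa [add_assoc, ← Nat.cast_add, Nat.add_sub_cancel' ht]
    · exact hF.not_mem_back hmin hd (by omega) h hffx
  refine hmin (d + 2) (by omega) ⟨by omega,
    fun t => if t = 0 then f (f x) else if t = d + 1 then f x else e (j + t),
    fun t => if t = d then x else if t = d + 1 then f x else o (j + t),
    fun t => if t = d + 1 then {f x} else F (j + t), ?_, ?_, ?_, ?_⟩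
  · intro i hi
    dsimp only
    rcases eq_or_ne i (d + 1) with rfl | h1
    · simpa [hfx] using ForwardJoined.refl (hfix _ hfx)
    · rw [if_neg h1, if_neg h1, if_neg h1]
      refine ⟨hF.sub _, ?_⟩
      split_ifs with h1 h2 h2
      · omega
      · subst h1
        simpa using hF.to_exit j _ hffx
      · subst h2
        exact hF.from_entrance _ _ hx
      · exact hF.joined _
  · intro i hi k hk hik
    dsimp only
    split_ifs with h1 h2 h2
    · omega
    · simpa using hno k (by omega)
    · simpa using hno i (by omega)
    · exact hF.disj _ _ (add_natCast_ne _ (by omega) (by omega) hik)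
  · intro i hi
    dsimp only
    rcases eq_or_ne i d with rfl | h1
    · simp
    · rw [if_neg h1, if_neg (by omega), if_neg (by omega), if_neg (by omega), hF.step]
      push_cast
      rw [add_assoc]
  · simp

/-- In a shortest cycle the members `F i` and `F (i + d)` cannot be connected through a point. -/
lemma not_merge (hF : GoodFamily f C e o F) (hmin : ∀ k < n, ¬ HasCycle f C k) {i : ZMod n}
    {d : ℕ} (hd : 1 ≤ d) (hdn : d + 2 ≤ n) {x : ℂ} (hx : x ∈ F i ∪ F (i + d))
    (h1 : ForwardJoined f (insert x (F i)) (e i) x)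
    (h2 : ForwardJoined f (insert x (F (i + d))) x (o (i + d))) : False := by
  have h3 := h1.trans h2 fun s hs t ht hst => hF.not_mem_back hmin hd hdn ht (hst ▸ hs)
  rw [insert_eq_of_mem hx] at h3
  refine hmin (n - d) (by omega) ⟨by omega, fun t => if t = 0 then e i else e (i + d + t),
    fun t => o (i + d + t), fun t => if t = 0 then F i ∪ F (i + d) else F (i + d + t),
    ?_, ?_, ?_, ?_⟩
  · intro t ht
    dsimp only
    split_ifs with h
    · subst h
      exact ⟨union_subset (hF.sub _) (hF.sub _), by simpa using h3⟩
    · exact ⟨hF.sub _, hF.joined _⟩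
  · have key : ∀ t, t ≠ 0 → t < n - d → Disjoint (F i ∪ F (i + d)) (F (i + d + t)) := by
      intro t h1 h2
      rw [disjoint_union_left, add_assoc, ← Nat.cast_add]
      refine ⟨hF.disj _ _ ?_, hF.disj _ _ (add_natCast_ne _ (by omega) (by omega) (by omega))⟩
      simpa using add_natCast_ne i (s := 0) (t := d + t) (by omega) (by omega) (by omega)
    intro s hs t ht hst
    dsimp only
    split_ifs with h1 h2 h2
    · omega
    · exact key t h2 ht
    · exact (key s h1 hs).symm
    · exact hF.disj _ _ (add_natCast_ne _ (by omega) (by omega) hst)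
  · intro t ht
    dsimp only
    rw [if_neg (by omega), hF.step]
    push_cast
    rw [add_assoc _ (t : ZMod n)]
  · simp only [if_true, hF.step]
    congr 1
    have : ((d + (n - d - 1) + 1 : ℕ) : ZMod n) = 0 := by
      rw [show d + (n - d - 1) + 1 = n by omega]; simp
    push_cast at this
    linear_combination this

end GoodFamily

end ForwardPaths

section LinkedHair

open unitInterval

variable {f : ℂ → ℂ} {C : Set ℂ}

lemma convexComb_le_iff_of_le {s t u v : I} (hst : s ≤ t) (huv : u ≤ v) :
    Icc.convexComb s t u ≤ Icc.convexComb s t v := by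
  have h1 : (s : ℝ) ≤ t := hst
  have h2 : (u : ℝ) ≤ v := huv
  change (1 - (u : ℝ)) * s + u * t ≤ (1 - (v : ℝ)) * s + v * t
  nlinarith

lemma convexComb_le_iff_of_ge {s t u v : I} (hst : s ≤ t) (huv : u ≤ v) :
    Icc.convexComb t s v ≤ Icc.convexComb t s u := by
  have h1 : (s : ℝ) ≤ t := hst
  have h2 : (u : ℝ) ≤ v := huv
  change (1 - (v : ℝ)) * t + v * s ≤ (1 - (u : ℝ)) * t + u * s
  nlinarith

lemma isForward_subpath {a b : ℂ} (Γ : Path a b) {s t : I} (hst : s ≤ t)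
    (h : ∀ u v, s ≤ u → u ≤ v → v ≤ t → Γ u ≠ f (Γ v)) : IsForward f (Γ.subpath s t) := by
  intro u v huv
  have key : ∀ w, Icc.convexComb s t w ∈ uIcc s t := fun w => by
    rw [← Path.range_subpathAux]; exact mem_range_self w
  rw [uIcc_of_le hst] at key
  exact h _ _ (key u).1 (convexComb_le_iff_of_le hst huv) (key v).2

lemma isForward_subpath_reverse {a b : ℂ} (Γ : Path a b) {s t : I} (hst : s ≤ t)
    (h : ∀ u v, s ≤ v → v ≤ u → u ≤ t → Γ u ≠ f (Γ v)) : IsForward f (Γ.subpath t s) := by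
  intro u v huv
  have key : ∀ w, Icc.convexComb t s w ∈ uIcc t s := fun w => by
    rw [← Path.range_subpathAux]; exact mem_range_self w
  rw [uIcc_of_ge hst] at key
  exact h _ _ (key v).1 (convexComb_le_iff_of_ge hst huv) (key u).2

/-- A path free of contacts with its image is forward in both directions. -/
lemma isForward_subpath_of_free {a b : ℂ} (Γ : Path a b) {τ s t : I} (hs : s < τ) (ht : t < τ)
    (h : ∀ u < τ, ∀ v < τ, Γ u ≠ f (Γ v)) : IsForward f (Γ.subpath s t) := by
  rcases le_total s t with hst | hst
  · exact isForward_subpath Γ hst fun u v _ h2 h3 =>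
      h _ (h2.trans_lt (h3.trans_lt ht)) _ (h3.trans_lt ht)
  · exact isForward_subpath_reverse Γ hst fun u v _ h2 h3 =>
      h _ (h3.trans_lt hs) _ (h2.trans_lt (h3.trans_lt hs))

/-- The set `G` carries a forward path from `a` to a point `f y` and a forward path from `y` to `b`,
where one of `y`, `f y` is allowed to be outside of `G`. -/
def IsLinked (f : ℂ → ℂ) (C G : Set ℂ) (a b : ℂ) : Prop :=
  ∃ (y : ℂ) (P : Path a (f y)) (H : Path y b), range P ⊆ C ∩ insert (f y) G ∧
    range H ⊆ C ∩ insert y G ∧ IsForward f P ∧ IsForward f H ∧ (f y ∈ G ∨ y ∈ G) ∧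
    ∀ h ∈ range H, ∀ p ∈ range P, f h ∈ C → f (f h) ≠ p

lemma exists_first_contact {a b : ℂ} (Γ : Path a b) (hf : Continuous f) (hΓ : range Γ ⊆ C)
    (hfix : ∀ x ∈ C, f x ≠ x) (hcontact : ∃ u v, Γ u = f (Γ v)) :
    ∃ τ, (∀ u < τ, ∀ v < τ, Γ u ≠ f (Γ v)) ∧
      ∃ t < τ, Γ τ = f (Γ t) ∨ f (Γ τ) = Γ t := by
  have hZ : IsCompact {p : I × I | Γ p.1 = f (Γ p.2)} :=
    (isClosed_eq (by fun_prop) (by fun_prop)).isCompact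
  obtain ⟨u, v, huv⟩ := hcontact
  obtain ⟨⟨s, t⟩, hst, hmin⟩ := hZ.exists_isMinOn ⟨(u, v), huv⟩
    (f := fun p => max p.1 p.2) (by fun_prop)
  refine ⟨max s t, fun u hu v hv h => ?_, ?_⟩
  · have : max s t ≤ max u v := hmin (show (u, v) ∈ {p : I × I | Γ p.1 = f (Γ p.2)} from h)
    exact absurd this (not_le.2 (max_lt hu hv))
  · have hne : s ≠ t := by
      rintro rfl
      exact hfix _ (hΓ ⟨s, rfl⟩) (Eq.symm hst)
    rcases lt_or_gt_of_ne hne with h | h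
    · exact ⟨s, by simpa using h, Or.inr (by rw [max_eq_right h.le]; exact hst.symm)⟩
    · exact ⟨t, by simpa using h, Or.inl (by rw [max_eq_left h.le]; exact hst)⟩

/-- A forward path prolonged inside `C` up to the image of its end is linked before its first
contact with its own image. -/
lemma exists_isLinked {a b : ℂ} (Γ : Path a b) (hf : Continuous f) (hΓ : range Γ ⊆ C)
    (hinj : InjOn f C) (hfix : ∀ x ∈ C, f x ≠ x) (h2 : ¬ HasCycle f C 2) (t₀ : I)
    (hfwd : ∀ u v, u ≤ v → v ≤ t₀ → Γ u ≠ f (Γ v)) (ht₀ : f (Γ t₀) = b) :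
    ∃ τ, (∀ u < τ, ∀ v < τ, Γ u ≠ f (Γ v)) ∧
      IsLinked f C (Γ '' {u | u ≤ t₀ ∨ u < τ}) a (Γ t₀) := by
  obtain ⟨τ, hfree, t, htτ, ht⟩ := exists_first_contact Γ hf hΓ hfix ⟨1, t₀, by simp [ht₀]⟩
  refine ⟨τ, hfree, ?_⟩
  have hC : ∀ u, Γ u ∈ C := fun u => hΓ ⟨u, rfl⟩
  have hsub : ∀ s t, range (Γ.subpath s t) ⊆ C := fun s t => by
    rw [Path.range_subpath]; rintro _ ⟨u, -, rfl⟩; exact hC u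
  -- two points before the first contact
  have hreturn : ∀ u < τ, ∀ v < τ, f (Γ v) ∈ C → f (f (Γ v)) ≠ Γ u := by
    intro u hu v hv hv' heq
    refine h2 (hasCycle_two (hsub u v)
      ⟨Γ.subpath u v, Subset.rfl, isForward_subpath_of_free Γ hu hv hfree⟩ hv' ?_ (hfix _ hv') heq)
    rw [Path.range_subpath]
    rintro ⟨w, hw, hw'⟩
    exact hfree w (hw.2.trans_lt (max_lt hu hv)) v hv hw'
  have hreturn' : Γ τ = f (Γ t) → ∀ v < τ, f (Γ v) ∈ C → f (f (Γ v)) ≠ Γ τ := by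
    intro heq v hv hv' heq'
    exact hfree t htτ v hv (hinj hv' (hC t) (heq'.trans heq)).symm
  rcases le_or_gt τ t₀ with hτ | hτ
  · have hc : Γ τ = f (Γ t) := by
      rcases ht with h | h
      · exact h
      · exact absurd h.symm (hfwd t τ htτ.le hτ)
    have hG : ∀ u ≤ t₀, Γ u ∈ Γ '' {u | u ≤ t₀ ∨ u < τ} := fun u hu => ⟨u, Or.inl hu, rfl⟩
    refine ⟨Γ t, (Γ.subpath 0 τ).cast (by simp) hc.symm, Γ.subpath t t₀, ?_, ?_, ?_, ?_,
      Or.inr (hG t (htτ.le.trans hτ)), ?_⟩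
    · refine subset_inter (by simpa using hsub 0 τ) ?_
      rw [Path.cast_coe, Path.range_subpath_of_le Γ 0 τ τ.2.1]
      rintro _ ⟨u, hu, rfl⟩
      exact Or.inr (hG u (hu.2.trans hτ))
    · refine subset_inter (by simpa using hsub t t₀) ?_
      rw [Path.range_subpath_of_le _ _ _ (htτ.le.trans hτ)]
      rintro _ ⟨u, hu, rfl⟩
      exact Or.inr (hG u hu.2)
    · exact isForward_subpath Γ τ.2.1 fun u v _ h2 h3 => hfwd u v h2 (h3.trans hτ)
    · exact isForward_subpath Γ (htτ.le.trans hτ) fun u v _ h2 h3 => hfwd u v h2 h3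
    · rw [Path.cast_coe, Path.range_subpath_of_le Γ 0 τ τ.2.1,
        Path.range_subpath_of_le _ _ _ (htτ.le.trans hτ)]
      rintro _ ⟨v, hv, rfl⟩ _ ⟨u, hu, rfl⟩ hv' heq
      rcases le_or_gt u v with huv | huv
      · refine h2 (hasCycle_two (hsub u v) ⟨Γ.subpath u v, Subset.rfl, isForward_subpath Γ huv
          fun u' v' _ h2 h3 => hfwd u' v' h2 (h3.trans hv.2)⟩ hv' ?_ (hfix _ hv') heq)
        rw [Path.range_subpath_of_le _ _ _ huv]
        rintro ⟨w, hw, hw'⟩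
        exact hfwd w v hw.2 hv.2 hw'
      · rcases hu.2.lt_or_eq with h | rfl
        · exact hreturn u h v (huv.trans h) hv' heq
        · exact hreturn' hc v huv hv' heq
  have hG : ∀ u < τ, Γ u ∈ Γ '' {u | u ≤ t₀ ∨ u < τ} := fun u hu => ⟨u, Or.inr hu, rfl⟩
  have hnot : ∀ s < τ, ∀ s' < τ, Γ τ = f (Γ s) → f (Γ τ) = Γ s' → False := by
    intro s hs s' hs' h h'
    rw [h] at h'
    exact hreturn s' hs' s hs (h ▸ hC τ) h'
  rcases ht with hc | hc
  · refine ⟨Γ t, (Γ.subpath 0 τ).cast (by simp) hc.symm, Γ.subpath t t₀, ?_, ?_, ?_, ?_,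
      Or.inr (hG t htτ), ?_⟩
    · refine subset_inter (by simpa using hsub 0 τ) ?_
      rw [Path.cast_coe, Path.range_subpath_of_le Γ 0 τ τ.2.1]
      rintro _ ⟨u, hu, rfl⟩
      rcases hu.2.lt_or_eq with h | rfl
      · exact Or.inr (hG u h)
      · exact Or.inl hc
    · refine subset_inter (by simpa using hsub t t₀) ?_
      rw [Path.range_subpath]
      rintro _ ⟨u, hu, rfl⟩
      exact Or.inr (hG u (hu.2.trans_lt (max_lt htτ hτ)))
    · refine isForward_subpath Γ τ.2.1 fun u v _ h2 h3 heq => ?_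
      rcases h3.lt_or_eq with h | rfl
      · exact hfree u (h2.trans_lt h) v h heq
      · rcases h2.lt_or_eq with h | rfl
        · exact hnot t htτ u h hc heq.symm
        · exact hfix _ (hC u) heq.symm
    · exact isForward_subpath_of_free Γ htτ hτ hfree
    · rw [Path.cast_coe, Path.range_subpath_of_le Γ 0 τ τ.2.1, Path.range_subpath]
      rintro _ ⟨v, hv, rfl⟩ _ ⟨u, hu, rfl⟩ hv' heq
      have hvτ := hv.2.trans_lt (max_lt htτ hτ)
      rcases hu.2.lt_or_eq with h | rfl
      · exact hreturn u h v hvτ hv' heq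
      · exact hreturn' hc v hvτ hv' heq
  · refine ⟨Γ τ, (Γ.subpath 0 t).cast (by simp) hc, Γ.subpath τ t₀, ?_, ?_, ?_, ?_,
      Or.inl (hc ▸ hG t htτ), ?_⟩
    · refine subset_inter (by simpa using hsub 0 t) ?_
      rw [Path.cast_coe, Path.range_subpath_of_le Γ 0 t t.2.1]
      rintro _ ⟨u, hu, rfl⟩
      exact Or.inr (hG u (hu.2.trans_lt htτ))
    · refine subset_inter (by simpa using hsub τ t₀) ?_
      rw [Path.range_subpath_of_ge _ _ _ hτ.le]
      rintro _ ⟨u, hu, rfl⟩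
      rcases hu.2.lt_or_eq with h | rfl
      · exact Or.inr (hG u h)
      · exact Or.inl rfl
    · exact isForward_subpath_of_free Γ (t.2.1.trans_lt htτ) htτ hfree
    · refine isForward_subpath_reverse Γ hτ.le fun u v _ h2 h3 heq => ?_
      rcases h3.lt_or_eq with h | rfl
      · exact hfree u h v (h2.trans_lt h) heq
      · rcases h2.lt_or_eq with h | rfl
        · exact hnot v h t htτ heq hc
        · exact hfix _ (hC v) heq.symm
    · rw [Path.cast_coe, Path.range_subpath_of_le Γ 0 t t.2.1,
        Path.range_subpath_of_ge _ _ _ hτ.le]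
      rintro _ ⟨v, hv, rfl⟩ _ ⟨u, hu, rfl⟩ hv' heq
      have huτ := hu.2.trans_lt htτ
      rcases hv.2.lt_or_eq with h | rfl
      · exact hreturn u huτ v h hv' heq
      · rw [hc] at heq
        exact hfree u huτ t htτ heq.symm

end LinkedHair

section LinkedFamily

open unitInterval

variable {f : ℂ → ℂ} {C : Set ℂ}

/-- Every point of `S` is joined by forward paths in `S` with the entrance `a` and the exit `b`. -/
structure IsGoodSet (f : ℂ → ℂ) (S : Set ℂ) (a b : ℂ) : Prop where
  entrance_mem : a ∈ S
  from_entrance : ∀ y ∈ S, ForwardJoined f S a y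
  to_exit : ∀ y ∈ S, ForwardJoined f S y b

lemma isGoodSet_of_isForward {a b : ℂ} (Γ : Path a b) {t₀ : I}
    (hfwd : ∀ u v, u ≤ v → v ≤ t₀ → Γ u ≠ f (Γ v)) : IsGoodSet f (Γ '' {u | u ≤ t₀}) a (Γ t₀) where
  entrance_mem := ⟨0, t₀.2.1, Γ.source⟩
  from_entrance := by
    rintro _ ⟨v, hv, rfl⟩
    refine ⟨(Γ.subpath 0 v).cast Γ.source.symm rfl, ?_,
      isForward_subpath Γ v.2.1 fun u w _ h2 h3 => hfwd u w h2 (h3.trans hv)⟩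
    rw [Path.cast_coe, Path.range_subpath_of_le _ _ _ v.2.1]
    exact image_mono fun u hu => hu.2.trans hv
  to_exit := by
    rintro _ ⟨v, hv, rfl⟩
    refine ⟨Γ.subpath v t₀, ?_, isForward_subpath Γ hv fun u w _ h2 h3 => hfwd u w h2 h3⟩
    rw [Path.range_subpath_of_le _ _ _ hv]
    exact image_mono fun u hu => hu.2

lemma isGoodSet_of_free {a b : ℂ} (Γ : Path a b) {t₀ τ : I} {J : Set I} (hJ : IsLowerSet J)
    (hJτ : ∀ u ∈ J, u < τ) (ht₀ : t₀ ∈ J) (hfree : ∀ u < τ, ∀ v < τ, Γ u ≠ f (Γ v)) :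
    IsGoodSet f (Γ '' J) a (Γ t₀) where
  entrance_mem := ⟨0, hJ t₀.2.1 ht₀, Γ.source⟩
  from_entrance := by
    rintro _ ⟨v, hv, rfl⟩
    refine ⟨(Γ.subpath 0 v).cast Γ.source.symm rfl, ?_,
      isForward_subpath_of_free Γ (hJτ _ (hJ v.2.1 hv)) (hJτ v hv) hfree⟩
    rw [Path.cast_coe, Path.range_subpath_of_le _ _ _ v.2.1]
    exact image_mono fun u hu => hJ hu.2 hv
  to_exit := by
    rintro _ ⟨v, hv, rfl⟩
    refine ⟨Γ.subpath v t₀, ?_, isForward_subpath_of_free Γ (hJτ v hv) (hJτ _ ht₀) hfree⟩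
    rw [Path.range_subpath]
    refine image_mono fun u hu => ?_
    rcases le_total v t₀ with h | h
    · exact hJ (hu.2.trans (sup_le h le_rfl)) ht₀
    · exact hJ (hu.2.trans (sup_le le_rfl h)) hv

lemma isLowerSet_iio (s : I) : IsLowerSet {u : I | u < s} := fun _ _ h1 h2 => lt_of_le_of_lt h1 h2

variable {n : ℕ} {e o : ZMod n → ℂ} {F : ZMod n → Set ℂ}

lemma GoodFamily.update (hF : GoodFamily f C e o F) (m : ZMod n) {S : Set ℂ} (hSC : S ⊆ C)
    (hS : IsGoodSet f S (e m) (o m)) (hd : ∀ l, l ≠ m → Disjoint S (F l)) :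
    GoodFamily f C e o (Function.update F m S) where
  sub i := by
    rcases eq_or_ne i m with rfl | h
    · simpa
    · simpa [h] using hF.sub i
  entrance_mem i := by
    rcases eq_or_ne i m with rfl | h
    · simpa using hS.entrance_mem
    · simpa [h] using hF.entrance_mem i
  from_entrance i := by
    rcases eq_or_ne i m with rfl | h
    · simpa using hS.from_entrance
    · simpa [h] using hF.from_entrance i
  to_exit i := by
    rcases eq_or_ne i m with rfl | h
    · simpa using hS.to_exit
    · simpa [h] using hF.to_exit i
  disj i j hij := by
    rcases eq_or_ne i m with h | h <;> rcases eq_or_ne j m with h' | h'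
    · exact absurd (h.trans h'.symm) hij
    · simpa [h, h'] using hd j h'
    · simpa [h, h'] using (hd i h).symm
    · simpa [h, h'] using hF.disj i j hij
  step := hF.step

lemma exists_eq_add_natCast (hn : 3 ≤ n) {m l : ZMod n} (h : l ≠ m) :
    ∃ d : ℕ, 1 ≤ d ∧ d + 2 ≤ n ∧ (l = m + d ∨ m = l + d) := by
  have : NeZero n := ⟨by omega⟩
  have h1 : (((l - m).val : ℕ) : ZMod n) = l - m := ZMod.natCast_zmod_val _
  have h2 : (l - m).val ≠ 0 := by
    rw [Ne, ZMod.val_eq_zero, sub_eq_zero]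
    exact h
  have h3 := ZMod.val_lt (l - m)
  rcases le_or_gt ((l - m).val + 2) n with h4 | h4
  · exact ⟨(l - m).val, by omega, h4, Or.inl (by rw [h1]; ring)⟩
  · refine ⟨1, le_rfl, by omega, Or.inr ?_⟩
    have h5 : (((l - m).val + 1 : ℕ) : ZMod n) = 0 := by
      rw [show (l - m).val + 1 = n by omega]; simp
    push_cast at h5
    rw [h1] at h5
    push_cast
    linear_combination -h5

/-- A hair free of contacts, growing out of a member of a good family of closed sets, does not meet
the other members. -/
lemma GoodFamily.hair_notMem (hF : GoodFamily f C e o F) (hmin : ∀ k < n, ¬ HasCycle f C k)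
    (hn : 3 ≤ n) (hcl : ∀ l, IsClosed (F l)) {m : ZMod n} {b : ℂ} (Γ : Path (e m) b)
    (hΓ : range Γ ⊆ C) {t₀ τ : I} (ht₀ : Γ t₀ = o m) (hFm : F m = Γ '' {u | u ≤ t₀})
    (hfree : ∀ u < τ, ∀ v < τ, Γ u ≠ f (Γ v)) {l : ZMod n} (hl : l ≠ m) {u : I} (hu : u < τ) :
    Γ u ∉ F l := by
  have : NeZero n := ⟨by omega⟩
  intro hul
  have hZ : IsCompact (⋃ l ∈ {l : ZMod n | l ≠ m}, Γ ⁻¹' F l) :=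
    ((toFinite _).isClosed_biUnion fun l _ => (hcl l).preimage Γ.continuous).isCompact
  obtain ⟨s, hs, hsmin⟩ := hZ.exists_isLeast ⟨u, mem_biUnion hl hul⟩
  have hsu : s ≤ u := hsmin (mem_biUnion hl hul)
  obtain ⟨k, hk, hsk⟩ : ∃ k, k ≠ m ∧ Γ s ∈ F k := by simpa using hs
  have hst : t₀ < s := by
    by_contra h
    exact hk (hF.eq_of_mem hsk (hFm ▸ ⟨s, not_lt.1 h, rfl⟩))
  have hlt : ∀ v, v < s → v < τ := fun v hv => hv.trans (hsu.trans_lt hu)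
  have hgood := hF.update m (S := Γ '' {u | u < s}) ((image_subset_range _ _).trans hΓ)
    (ht₀ ▸ isGoodSet_of_free Γ (isLowerSet_iio s) hlt hst hfree) (by
      intro i hi
      rw [disjoint_left]
      rintro _ ⟨v, hv, rfl⟩ hvi
      exact absurd (hsmin (mem_biUnion (show i ∈ {l | l ≠ m} from hi) hvi)) (not_le.2 hv))
  set F' := Function.update F m (Γ '' {u | u < s}) with hF'
  have hFm' : F' m = Γ '' {u | u < s} := by simp [hF']
  have hFk : Γ s ∈ F' k := by simpa [hF', hk] using hsk
  have hsτ : s < τ := hsu.trans_lt hu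
  have hin : ∀ v, v ≤ s → Γ v ∈ insert (Γ s) (F' m) := by
    intro v hv
    rcases hv.lt_or_eq with h | rfl
    · exact Or.inr (hFm' ▸ ⟨v, h, rfl⟩)
    · exact Or.inl rfl
  have hto : ForwardJoined f (insert (Γ s) (F' m)) (e m) (Γ s) := by
    refine ⟨(Γ.subpath 0 s).cast Γ.source.symm rfl, ?_,
      isForward_subpath_of_free Γ (s.2.1.trans_lt hsτ) hsτ hfree⟩
    rw [Path.cast_coe, Path.range_subpath_of_le _ _ _ s.2.1]
    rintro _ ⟨v, hv, rfl⟩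
    exact hin v hv.2
  have hfrom : ForwardJoined f (insert (Γ s) (F' m)) (Γ s) (o m) := by
    rw [← ht₀]
    refine ⟨Γ.subpath s t₀, ?_, isForward_subpath_of_free Γ hsτ (hst.trans hsτ) hfree⟩
    rw [Path.range_subpath_of_ge _ _ _ hst.le]
    rintro _ ⟨v, hv, rfl⟩
    exact hin v hv.2
  obtain ⟨d, hd, hdn, rfl | rfl⟩ := exists_eq_add_natCast hn hk
  · exact hgood.not_merge hmin hd hdn (Or.inr hFk) hto
      ((hgood.to_exit _ _ hFk).mono (subset_insert _ _))
  · exact hgood.not_merge hmin hd hdn (Or.inl hFk)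
      ((hgood.from_entrance _ _ hFk).mono (subset_insert _ _)) hfrom

/-- A shortest cycle of length at least three gives rise to a good family of linked sets. -/
lemma exists_linked_family (hf : Continuous f) (hinj : InjOn f C) (hfix : ∀ x ∈ C, f x ≠ x)
    (hmin : ∀ k < n, ¬ HasCycle f C k) (hn : 3 ≤ n)
    (hpath : ∀ a ∈ C, ∀ b ∈ C, ∃ γ : Path a b, range γ ⊆ C)
    (γ : ∀ i, Path (e i) (o i)) (hγ : ∀ i, range (γ i) ⊆ C) (hγf : ∀ i, IsForward f (γ i))
    (hγd : ∀ i j, i ≠ j → Disjoint (range (γ i)) (range (γ j)))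
    (hstep : ∀ i, f (o i) = e (i + 1)) :
    ∃ F, GoodFamily f C e o F ∧ ∀ i, IsLinked f C (F i) (e i) (o i) := by
  have he : ∀ i, e i ∈ C := fun i => hγ i ⟨0, (γ i).source⟩
  have ho : ∀ i, o i ∈ C := fun i => hγ i ⟨1, (γ i).target⟩
  choose δ hδ using fun i => hpath _ (ho i) _ (he (i + 1))
  let Γ : ∀ i, Path (e i) (e (i + 1)) := fun i => (γ i).trans (δ i)
  have hΓ : ∀ i, range (Γ i) ⊆ C := fun i => by
    rw [Path.trans_range]; exact union_subset (hγ i) (hδ i)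
  let t₀ : I := ⟨1 / 2, by norm_num, by norm_num⟩
  have hhalf : ∀ i (u : I) (hu : u ≤ t₀), Γ i u =
      γ i ⟨2 * u, by have := u.2.1; constructor <;> linarith [show (u : ℝ) ≤ 1 / 2 from hu]⟩ :=
    fun i u hu => by rw [Path.trans_apply, dif_pos (show (u : ℝ) ≤ 1 / 2 from hu)]
  have hto : ∀ i, Γ i t₀ = o i := fun i => by
    rw [hhalf i t₀ le_rfl]
    convert! (γ i).target using 2
    ext; simp [t₀]
  have hfwd : ∀ i u v, u ≤ v → v ≤ t₀ → Γ i u ≠ f (Γ i v) := by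
    intro i u v huv hv
    rw [hhalf i u (huv.trans hv), hhalf i v hv]
    exact hγf i _ _ (by simpa [← Subtype.coe_le_coe] using huv)
  have himage : ∀ i, Γ i '' {u | u ≤ t₀} ⊆ range (γ i) := by
    rintro i _ ⟨u, hu, rfl⟩
    rw [hhalf i u hu]
    exact mem_range_self _
  have hgood : ∀ i, IsGoodSet f (Γ i '' {u | u ≤ t₀}) (e i) (o i) := fun i => by
    rw [← hto i]; exact isGoodSet_of_isForward (Γ i) (hfwd i)
  have hF : GoodFamily f C e o (fun i => Γ i '' {u | u ≤ t₀}) :=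
    ⟨fun i => (image_subset_range _ _).trans (hΓ i), fun i => (hgood i).entrance_mem,
      fun i => (hgood i).from_entrance, fun i => (hgood i).to_exit,
      fun i j hij => (hγd i j hij).mono (himage i) (himage j), hstep⟩
  have hcl : ∀ u i, IsClosed (Γ i '' {v | v ≤ u}) := fun u i =>
    ((isClosed_Iic (a := u)).isCompact.image (Γ i).continuous).isClosed
  choose τ hfree hlink using fun i => exists_isLinked (Γ i) hf (hΓ i) hinj hfix
    (hmin 2 (by omega)) t₀ (hfwd i) (by rw [hto, hstep])
  have hgood' : ∀ i, IsGoodSet f (Γ i '' {u | u ≤ t₀ ∨ u < τ i}) (e i) (o i) := by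
    intro i
    rcases le_or_gt (τ i) t₀ with h | h
    · have : {u | u ≤ t₀ ∨ u < τ i} = {u | u ≤ t₀} := by
        ext u; exact ⟨fun h' => h'.elim id fun h' => h'.le.trans h, Or.inl⟩
      rw [this]
      exact hgood i
    · have : {u | u ≤ t₀ ∨ u < τ i} = {u | u < τ i} := by
        ext u; exact ⟨fun h' => h'.elim (fun h' => h'.trans_lt h) id, Or.inr⟩
      rw [this, ← hto i]
      exact isGoodSet_of_free (Γ i) (isLowerSet_iio _) (fun _ h => h) h (hfree i)
  have hdisj : ∀ i j, i ≠ j → ∀ u, (u ≤ t₀ ∨ u < τ i) → ∀ v, (v ≤ t₀ ∨ v < τ j) →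
      Γ i u ≠ Γ j v := by
    intro i j hij u hu v hv heq
    rcases le_or_gt u t₀ with hu' | hu' <;> rcases le_or_gt v t₀ with hv' | hv'
    · exact (hF.disj i j hij).ne_of_mem ⟨u, hu', rfl⟩ ⟨v, hv', rfl⟩ heq
    · exact hF.hair_notMem hmin hn (hcl t₀) (Γ j) (hΓ j) (hto j) rfl (hfree j) hij
        (hv.resolve_left (not_le.2 hv')) (heq ▸ ⟨u, hu', rfl⟩)
    · exact hF.hair_notMem hmin hn (hcl t₀) (Γ i) (hΓ i) (hto i) rfl (hfree i) hij.symm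
        (hu.resolve_left (not_le.2 hu')) (heq ▸ ⟨v, hv', rfl⟩)
    · have huτ := hu.resolve_left (not_le.2 hu')
      have h1 := hF.update i (S := Γ i '' {v | v ≤ u}) ((image_subset_range _ _).trans (hΓ i))
        (hto i ▸ isGoodSet_of_free (Γ i) (isLowerSet_Iic u) (fun v hv => lt_of_le_of_lt hv huτ)
          hu'.le (hfree i)) (by
          intro l hl
          rw [disjoint_left]
          rintro _ ⟨w, hw, rfl⟩
          exact hF.hair_notMem hmin hn (hcl t₀) (Γ i) (hΓ i) (hto i) rfl (hfree i) hl
            (lt_of_le_of_lt hw huτ))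
      refine h1.hair_notMem hmin hn ?_ (Γ j) (hΓ j) (hto j) (by simp [hij.symm]) (hfree j) hij
        (hv.resolve_left (not_le.2 hv')) (by
          rw [Function.update_self]; exact ⟨u, le_refl u, heq⟩)
      intro l
      rcases eq_or_ne l i with rfl | hl
      · simpa using hcl u l
      · simpa [hl] using hcl t₀ l
  refine ⟨fun i => Γ i '' {u | u ≤ t₀ ∨ u < τ i},
    ⟨fun i => (image_subset_range _ _).trans (hΓ i), fun i => (hgood' i).entrance_mem,
      fun i => (hgood' i).from_entrance, fun i => (hgood' i).to_exit, ?_, hstep⟩,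
    fun i => by simpa only [hto] using hlink i⟩
  intro i j hij
  rw [disjoint_left]
  rintro _ ⟨u, hu, rfl⟩ ⟨v, hv, heq⟩
  exact hdisj i j hij u hu v hv heq.symm

end LinkedFamily

section Displacement

open Complex unitInterval

/-- The logarithmic data attached to a planar map `f` with inverse `g`: a logarithm `L` of the
difference quotient of `f`, a logarithm `Θ` of the displacement on `C`, and the rectangle
identity for paths in `X` and in `f '' X` which do not meet in `C`. -/
structure DisplacementData (X C : Set ℂ) (f g : ℂ → ℂ) (L : ℂ → ℂ → ℂ) (Θ : ℂ → ℂ) (κ : ℂ) :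
    Prop where
  f_cont : Continuous f
  g_cont : Continuous g
  left_inv : ∀ x ∈ X, g (f x) = x
  sub_X : C ⊆ X
  sub_Y : C ⊆ f '' X
  fix : ∀ x ∈ C, f x ≠ x
  L_symm : ∀ p ∈ X, ∀ q ∈ X, p ≠ q → L p q = L q p
  L_cont : ∀ p ∈ X, ContinuousOn (L p) (X \ {p})
  L_exp : ∀ p ∈ X, ∀ q ∈ X, p ≠ q → (q - p) * exp (L p q) = f q - f p
  Θ_cont : ContinuousOn Θ C
  Θ_exp : ∀ z ∈ C, exp (Θ z) = f z - z
  L_fwd : ∀ p ∈ C, f p ∈ C → L p (f p) = Θ (f p) - Θ p + κ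
  exp_κ : exp κ = 1
  rect : ∀ {a b c d : ℂ} (r : Path a b) (w : Path c d), range r ⊆ X → range w ⊆ f '' X →
    a ∈ C → b ∈ C → c ∈ C → d ∈ C → (∀ z ∈ range r, z ∈ range w → z ∉ C) →
    wind r c + wind w b = wind w a + wind r d

variable {X C : Set ℂ} {f g : ℂ → ℂ} {L : ℂ → ℂ → ℂ} {Θ : ℂ → ℂ} {κ : ℂ}

namespace DisplacementData

lemma injOn (hD : DisplacementData X C f g L Θ κ) : InjOn f X := fun x hx y hy h => by
  rw [← hD.left_inv x hx, h, hD.left_inv y hy]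

lemma wind_map (hD : DisplacementData X C f g L Θ κ) {a b z : ℂ} (γ : Path a b)
    (hγ : range γ ⊆ X) (hz : z ∈ X) (hzγ : z ∉ range γ) :
    wind (γ.map hD.f_cont) (f z) = wind γ z + L z b - L z a := by
  have hne : ∀ t, γ t ≠ z := fun t h => hzγ ⟨t, h⟩
  have h1 : Continuous fun t => L z (γ t) :=
    (hD.L_cont z hz).comp_continuous γ.continuous fun t => ⟨hγ ⟨t, rfl⟩, hne t⟩
  have h2 := dlog_mul_exp (u := fun t => γ t - z) (by fun_prop)
    (fun t => sub_ne_zero.2 (hne t)) h1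
  simp only [γ.source, γ.target] at h2
  rw [wind, wind, add_sub_assoc, ← h2]
  congr 1
  ext t
  rw [hD.L_exp z hz _ (hγ ⟨t, rfl⟩) (hne t).symm]
  rfl

lemma Θ_sub (hD : DisplacementData X C f g L Θ κ) {a b : ℂ} (γ : Path a b)
    (hγ : range γ ⊆ C) (hfwd : IsForward f γ) :
    Θ b - Θ a = wind (γ.map hD.f_cont) a + wind γ (f b) := by
  have hf := hD.f_cont
  have hu : Continuous fun p : I × I => f (γ (max p.1 p.2)) - γ p.1 := by fun_prop
  have h0 : ∀ p : I × I, f (γ (max p.1 p.2)) - γ p.1 ≠ 0 := fun p =>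
    sub_ne_zero.2 (hfwd _ _ (le_max_left _ _)).symm
  have h := (dlog_square hu h0).2
  have e1 := wind_swap γ.continuous (w := f b) (fun t h => by
    have := hfwd t 1 t.2.2
    rw [γ.target] at this
    exact this h)
  have e2 : ∀ t : I, max t 1 = 1 := fun t => max_eq_right t.2.2
  have e3 : ∀ t : I, max 0 t = t := fun t => max_eq_right t.2.1
  simp only [max_self, e2, e3, γ.source, γ.target, e1] at h
  rw [dlog_eq (u := fun t => f (γ t) - γ t) (l := fun t => Θ (γ t))
    (hD.Θ_cont.comp_continuous γ.continuous fun t => hγ ⟨t, rfl⟩)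
    (fun t => hD.Θ_exp _ (hγ ⟨t, rfl⟩))] at h
  simp only [γ.source, γ.target] at h
  rw [← h]
  rfl

lemma Θ_sub_trans (hD : DisplacementData X C f g L Θ κ) {e₀ e z q : ℂ} (T : Path e₀ e)
    (S : Path e q) (hSC : range S ⊆ C) (hS : IsForward f S) (hz : z ∈ C) (hfz : f z = e₀)
    (hT : Θ e - Θ e₀ = wind T z + L z e - L z e₀ + wind T (f e))
    (hTS : Disjoint (range T) (range (S.map hD.f_cont))) (hzT : z ∉ range T)
    (hzS : z ∉ range S) :
    Θ q - Θ e₀ = wind (T.trans S) z + L z q - L z e₀ + wind (T.trans S) (f q) := by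
  have h1 := hD.Θ_sub S hSC hS
  have h2 := (wind_rectangle T (S.map hD.f_cont) hTS).1
  have h3 := hD.wind_map S (hSC.trans hD.sub_X) (hD.sub_X hz) hzS
  rw [hfz] at h3
  have hq : f q ∉ range T := fun h => hTS.ne_of_mem h ⟨1, by simp⟩ rfl
  have hq' : f q ∉ range S := by
    rintro ⟨t, ht⟩
    exact hS t 1 t.2.2 (by simpa using ht)
  rw [wind_trans _ _ hzT hzS, wind_trans _ _ hq hq']
  linear_combination hT + h1 + h2 + h3

/-- The inductive step: prolonging the path `T` by `P` and `f ∘ H`. -/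
lemma Θ_sub_link (hD : DisplacementData X C f g L Θ κ) {e₀ e z y b : ℂ} (T : Path e₀ e)
    (P : Path e (f y)) (H : Path y b) (hTY : range T ⊆ f '' X)
    (hPC : range P ⊆ C) (hP : IsForward f P) (hHC : range H ⊆ C) (hH : IsForward f H)
    (hfb : f b ∈ C) (hz : z ∈ C) (hfz : f z = e₀)
    (hT : Θ e - Θ e₀ = wind T z + L z e - L z e₀ + wind T (f e))
    (hTP : Disjoint (range T) (range (P.map hD.f_cont))) (hzT : z ∉ range T)
    (hzP : z ∉ range P) (hzH : z ∉ range (H.map hD.f_cont))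
    (hA : ∀ h ∈ range H, f h ∈ C → f (f h) ∉ range T ∪ range P) :
    Θ (f b) - Θ e₀ = wind ((T.trans P).trans (H.map hD.f_cont)) z + L z (f b) - L z e₀ +
      wind ((T.trans P).trans (H.map hD.f_cont)) (f (f b)) := by
  have hX := hD.sub_X
  have hyH : y ∈ range H := ⟨0, H.source⟩
  have hbH : b ∈ range H := ⟨1, H.target⟩
  have hyC := hHC hyH
  have hbC := hHC hbH
  have hcC : f y ∈ C := hPC ⟨1, P.target⟩
  have h1 := hD.Θ_sub_trans T P hPC hP hz hfz hT hTP hzT hzP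
  have h2 := hD.L_fwd y hyC hcC
  have h3 := hD.L_fwd b hbC hfb
  have h4 := hD.Θ_sub H hHC hH
  have hfbH : f b ∉ range H := by
    rintro ⟨t, ht⟩
    exact hH t 1 t.2.2 (by simpa using ht)
  have h5 := hD.wind_map H (hHC.trans hX) (hX hfb) hfbH
  set A := T.trans P with hAdef
  have hAr : range A = range T ∪ range P := Path.trans_range _ _
  have hAY : range A ⊆ f '' X := by
    rw [hAr]; exact union_subset hTY (hPC.trans hD.sub_Y)
  have hzA : z ∉ range A := by rw [hAr]; exact fun h => h.elim hzT hzP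
  -- the pullback of `A`
  let R : Path z y := (A.map hD.g_cont).cast (by rw [← hfz, hD.left_inv z (hX hz)])
    (by rw [hD.left_inv y (hX hyC)])
  have hRX : range R ⊆ X := by
    rintro _ ⟨t, rfl⟩
    obtain ⟨x, hx, hx'⟩ := hAY ⟨t, rfl⟩
    change g (A t) ∈ X
    rwa [← hx', hD.left_inv x hx]
  have hfR : ∀ t, f (R t) = A t := by
    intro t
    obtain ⟨x, hx, hx'⟩ := hAY ⟨t, rfl⟩
    change f (g (A t)) = A t
    rw [← hx', hD.left_inv x hx]
  have hmap : (R.map hD.f_cont : I → ℂ) = A := funext hfR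
  have hcR : f y ∉ range R := by
    rintro ⟨t, ht⟩
    exact hA y hyH hcC (hAr ▸ ⟨t, by rw [← hfR, ht]⟩)
  have hbR : f b ∉ range R := by
    rintro ⟨t, ht⟩
    exact hA b hbH hfb (hAr ▸ ⟨t, by rw [← hfR, ht]⟩)
  have h6 := hD.wind_map R hRX (hX hfb) hbR
  have h7 := hD.wind_map R hRX (hX hcC) hcR
  rw [hmap] at h6 h7
  have h8 := hD.rect R (H.map hD.f_cont) hRX
    (by rintro _ ⟨t, rfl⟩; exact ⟨H t, hX (hHC ⟨t, rfl⟩), rfl⟩) hz hyC hcC hfb (by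
      rintro _ ⟨s, rfl⟩ ⟨t, ht⟩ hC
      have ht' : f (H t) = R s := ht
      exact hA (H t) ⟨t, rfl⟩ (ht' ▸ hC) (hAr ▸ ⟨s, by rw [← hfR, ht']⟩))
  have hffA : f (f b) ∉ range A := by rw [hAr]; exact hA b hbH hfb
  have hffH : f (f b) ∉ range (H.map hD.f_cont) := by
    rintro ⟨t, ht⟩
    exact hfbH ⟨t, hD.injOn (hX (hHC ⟨t, rfl⟩)) (hX hfb) ht⟩
  have h9 := hD.L_symm y (hX hyC) (f y) (hX hcC) (hD.fix y hyC).symm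
  have h10 := hD.L_symm b (hX hbC) (f b) (hX hfb) (hD.fix b hbC).symm
  have h11 := hD.L_symm z (hX hz) (f y) (hX hcC) (fun h => hzP ⟨1, by rw [P.target, h]⟩)
  have h12 := hD.L_symm z (hX hz) (f b) (hX hfb) (fun h => hzH ⟨1, by rw [Path.target, h]⟩)
  rw [wind_trans _ _ hzA hzH, wind_trans _ _ hffA hffH]
  linear_combination h1 + h2 - h3 + h4 - h5 - h6 + h7 + h8 - h9 + h10 + h11 - h12

end DisplacementData

end Displacement

section NoCycle

open Complex unitInterval

variable {X C : Set ℂ} {f g : ℂ → ℂ} {L : ℂ → ℂ → ℂ} {Θ : ℂ → ℂ} {κ : ℂ} {n : ℕ}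
  {e o : ZMod n → ℂ} {F : ZMod n → Set ℂ}

namespace GoodFamily

lemma notMem_of_lt (hF : GoodFamily f C e o F) {i m : ℕ} (hi : i < m) (hm : m < n) {x : ℂ}
    (hx : x ∈ F m) : x ∉ F i := fun h => by
  have := hF.eq_of_mem h hx
  rw [ZMod.natCast_eq_natCast_iff', Nat.mod_eq_of_lt hm, Nat.mod_eq_of_lt (hi.trans hm)] at this
  omega

lemma image_notMem_of_lt (hF : GoodFamily f C e o F) (hmin : ∀ k < n, ¬ HasCycle f C k) {i m : ℕ}
    (hi : i < m) (hm : m + 2 ≤ n) {x : ℂ} (hx : x ∈ F m) : f x ∉ F i :=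
  hF.not_mem_back hmin (d := m - i) (by omega) (by omega)
    (by rwa [← Nat.cast_add, Nat.add_sub_cancel' hi.le])

lemma image_notMem_last (hF : GoodFamily f C e o F) (hmin : ∀ k < n, ¬ HasCycle f C k) {i : ℕ}
    (hm : i + 3 ≤ n) {x : ℂ} (hx : x ∈ F i) : f x ∉ F (n - 1 : ℕ) := by
  refine hF.not_mem_back hmin (d := i + 1) (by omega) (by omega) ?_
  have : ((n - 1 : ℕ) : ZMod n) + (i + 1 : ℕ) = i := by
    rw [← Nat.cast_add, show n - 1 + (i + 1) = n + i by omega]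
    simp
  rwa [this]

/-- A point lying in `F m` or in its image, for `m` in the first part of the cycle, is not mapped
into a previous member of the cycle. -/
lemma image_notMem_of_lt_of_mem_or (hF : GoodFamily f C e o F)
    (hmin : ∀ k < n, ¬ HasCycle f C k) (hfix : ∀ x ∈ C, f x ≠ x) {i m : ℕ}
    (hi : i < m) (hm : m + 3 ≤ n) {x : ℂ} (hxC : x ∈ C) (hx : x ∈ F m ∨ ∃ y ∈ F m, f y = x) :
    f x ∉ F i ∧ x ∉ F i := by
  rcases hx with hx | ⟨y, hy, rfl⟩
  · exact ⟨hF.image_notMem_of_lt hmin hi (by omega) hx, hF.notMem_of_lt hi (by omega) hx⟩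
  · refine ⟨hF.not_mem_back_two hmin hfix (d := m - i) (by omega) (by omega)
      (by rwa [← Nat.cast_add, Nat.add_sub_cancel' hi.le]) hxC,
      hF.image_notMem_of_lt hmin hi (by omega) hy⟩

end GoodFamily

namespace DisplacementData

/-- The path `T` from `e 0` to `e m` follows the members of the cycle before `m` and their images;
along it the displacement turns as seen from the last point `z` of the cycle. -/
lemma exists_path (hD : DisplacementData X C f g L Θ κ) (hF : GoodFamily f C e o F)
    (hmin : ∀ k < n, ¬ HasCycle f C k) (hlink : 3 ≤ n → ∀ i, IsLinked f C (F i) (e i) (o i))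
    (m : ℕ) (hm : m + 2 ≤ n) :
    ∃ q, q = e m ∧ ∃ T : Path (e 0) q,
      (∀ p ∈ range T, p = q ∨ ∃ i < m, p ∈ F i ∨ ∃ x ∈ F i, f x = p) ∧
      Θ q - Θ (e 0) = wind T (o (n - 1 : ℕ)) + L (o (n - 1 : ℕ)) q - L (o (n - 1 : ℕ)) (e 0) +
        wind T (f q) := by
  have hz : o (n - 1 : ℕ) ∈ F (n - 1 : ℕ) := hF.exit_mem _
  have hfz : f (o (n - 1 : ℕ)) = e 0 := by
    rw [hF.step]
    congr 1
    rw [← Nat.cast_add_one, show n - 1 + 1 = n by omega]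
    simp
  set z := o (n - 1 : ℕ)
  induction m with
  | zero => exact ⟨e 0, by simp, Path.refl _, by simp, by simp [wind_refl]⟩
  | succ m ih =>
    obtain ⟨_, rfl, T, hTc, hT⟩ := ih (by omega)
    obtain ⟨y, P, H, hP, hH, hPf, hHf, hyG, hA⟩ := hlink (by omega) m
    have hinj := hD.injOn
    have hsub := hF.sub
    have hP' : ∀ p ∈ range P, p ∈ F m ∨ ∃ x ∈ F m, f x = p := by
      intro p hp
      rcases (hP hp).2 with rfl | h
      · exact hyG.imp id fun h => ⟨y, h, rfl⟩
      · exact Or.inl h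
    have hH' : ∀ h ∈ range H, f h ∈ F m ∨ ∃ x ∈ F m, f x = f h := by
      intro p hp
      rcases (hH hp).2 with rfl | h
      · exact hyG.imp id fun h => ⟨p, h, rfl⟩
      · exact Or.inr ⟨p, h, rfl⟩
    have hzm : ¬ (z ∈ F m ∨ ∃ x ∈ F m, f x = z) := by
      rintro (h | ⟨x, hx, h⟩)
      · exact hF.notMem_of_lt (show m < n - 1 by omega) (by omega) hz h
      · exact hF.image_notMem_last hmin (by omega) hx (h ▸ hz)
    have hTimg : ∀ s ∈ C, (s ∈ F m ∨ ∃ x ∈ F m, f x = s) → f s ∈ range T → f s = e m := by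
      intro s hs h1 h2
      rcases hTc _ h2 with h | ⟨i, hi, h | ⟨x, hx, h⟩⟩
      · exact h
      · exact absurd h (hF.image_notMem_of_lt_of_mem_or hmin hD.fix hi (by omega) hs h1).1
      · rw [hinj (hD.sub_X (hsub _ hx)) (hD.sub_X hs) h] at hx
        exact absurd hx (hF.image_notMem_of_lt_of_mem_or hmin hD.fix hi (by omega) hs h1).2
    have hstep : f (o m) = e (m + 1 : ℕ) := by rw [hF.step]; push_cast; rfl
    have hFC : ∀ i, ∀ x ∈ F i, x ∈ C := fun i x hx => hsub i hx
    have key := hD.Θ_sub_link (z := z) T P H ?_ (fun p hp => (hP hp).1) hPf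
      (fun p hp => (hH hp).1) hHf ?_ (hFC _ _ hz) hfz hT ?_ ?_ ?_ ?_ ?_
    · refine ⟨_, hstep, _, ?_, key⟩
      intro p hp
      rw [Path.trans_range, Path.trans_range] at hp
      rcases hp with (hp | hp) | ⟨t, rfl⟩
      · rcases hTc p hp with h | ⟨i, hi, h⟩
        · exact Or.inr ⟨m, by omega, Or.inl (h ▸ hF.entrance_mem _)⟩
        · exact Or.inr ⟨i, by omega, h⟩
      · exact Or.inr ⟨m, by omega, hP' p hp⟩
      · exact Or.inr ⟨m, by omega, hH' _ ⟨t, rfl⟩⟩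
    · intro p hp
      rcases hTc p hp with rfl | ⟨i, hi, h | ⟨x, hx, rfl⟩⟩
      · exact hD.sub_Y (hFC _ _ (hF.entrance_mem _))
      · exact hD.sub_Y (hFC _ _ h)
      · exact ⟨x, hD.sub_X (hFC _ _ hx), rfl⟩
    · rw [hstep]
      exact hFC _ _ (hF.entrance_mem _)
    · rw [disjoint_left]
      rintro p hp ⟨t, rfl⟩
      refine hPf 0 t t.2.1 ?_
      rw [P.source]
      exact (hTimg (P t) (hP ⟨t, rfl⟩).1 (hP' _ ⟨t, rfl⟩) hp).symm
    · intro h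
      rcases hTc _ h with h | ⟨i, hi, h | ⟨x, hx, h⟩⟩
      · exact hzm (Or.inl (h ▸ hF.entrance_mem _))
      · exact hF.notMem_of_lt (show i < n - 1 by omega) (by omega) hz h
      · exact hF.image_notMem_last hmin (by omega) hx (h ▸ hz)
    · exact fun h => hzm (hP' _ h)
    · rintro ⟨t, h⟩
      exact hzm (h ▸ hH' _ ⟨t, rfl⟩)
    · rintro h hh hC (hp | hp)
      · exact hA h hh _ ⟨0, P.source⟩ hC (hTimg _ hC (hH' _ hh) hp)
      · exact hA h hh _ hp hC rfl

lemma false_of_goodFamily (hD : DisplacementData X C f g L Θ κ) (hF : GoodFamily f C e o F)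
    (hmin : ∀ k < n, ¬ HasCycle f C k) (hn : 2 ≤ n)
    (hlink : 3 ≤ n → ∀ i, IsLinked f C (F i) (e i) (o i)) : False := by
  obtain ⟨_, rfl, T, hTc, hT⟩ := hD.exists_path hF hmin hlink (n - 2) (by omega)
  have hz : o (n - 1 : ℕ) ∈ F (n - 1 : ℕ) := hF.exit_mem _
  have hfz : f (o (n - 1 : ℕ)) = e 0 := by
    rw [hF.step]
    congr 1
    rw [← Nat.cast_add_one, show n - 1 + 1 = n by omega]
    simp
  set z := o (n - 1 : ℕ)
  have hw : o (n - 2 : ℕ) ∈ F (n - 2 : ℕ) := hF.exit_mem _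
  have hfw : f (o (n - 2 : ℕ)) = e (n - 1 : ℕ) := by
    rw [hF.step, show n - 1 = n - 2 + 1 by omega]
    push_cast
    rfl
  set w := o (n - 2 : ℕ)
  obtain ⟨S, hS, hSf⟩ : ForwardJoined f (F (n - 2 : ℕ)) (e (n - 2 : ℕ)) w := hF.joined (n - 2 : ℕ)
  obtain ⟨γ, hγ, hγf⟩ : ForwardJoined f (F (n - 1 : ℕ)) (e (n - 1 : ℕ)) z := hF.joined (n - 1 : ℕ)
  have hFC : ∀ i, ∀ x ∈ F i, x ∈ C := fun i x hx => hF.sub i hx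
  have hFX : ∀ i, ∀ x ∈ F i, x ∈ X := fun i x hx => hD.sub_X (hF.sub i hx)
  have hTF : ∀ p ∈ range T, p ∉ F (n - 1 : ℕ) := by
    intro p hp hpF
    rcases hTc p hp with rfl | ⟨i, hi, h | ⟨x, hx, rfl⟩⟩
    · exact hF.notMem_of_lt (show n - 2 < n - 1 by omega) (by omega) hpF (hF.entrance_mem _)
    · exact hF.notMem_of_lt (show i < n - 1 by omega) (by omega) hpF h
    · exact hF.image_notMem_last hmin (by omega) hx hpF
  have hTS : Disjoint (range T) (range (S.map hD.f_cont)) := by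
    rw [disjoint_left]
    rintro _ hp ⟨t, rfl⟩
    have ht := hS ⟨t, rfl⟩
    rcases hTc _ hp with h | ⟨i, hi, h | ⟨x, hx, h⟩⟩
    · exact hSf 0 t t.2.1 (by rw [S.source]; exact h.symm)
    · exact hF.image_notMem_of_lt hmin hi (by omega) ht h
    · rw [hD.injOn (hFX _ _ hx) (hFX _ _ ht) h] at hx
      exact hF.notMem_of_lt hi (by omega) ht hx
  have hSF : ∀ p ∈ range S, p ∉ F (n - 1 : ℕ) := fun p hp h =>
    hF.notMem_of_lt (show n - 2 < n - 1 by omega) (by omega) h (hS hp)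
  have h1 := hD.Θ_sub_trans T S (hS.trans (hF.sub _)) hSf (hFC _ _ hz) hfz hT hTS
    (fun h => hTF _ h hz) (fun h => hSF _ h hz)
  have h2 := hD.Θ_sub γ (hγ.trans (hF.sub _)) hγf
  have hwγ : w ∉ range γ := fun h =>
    hF.notMem_of_lt (show n - 2 < n - 1 by omega) (by omega) (hγ h) hw
  have h3 := hD.wind_map γ (fun p hp => hFX _ _ (hγ hp)) (hFX _ _ hw) hwγ
  have h4 := hD.L_fwd z (hFC _ _ hz) (hfz ▸ hFC _ _ (hF.entrance_mem _))
  have h5 := hD.L_fwd w (hFC _ _ hw) (hfw ▸ hFC _ _ (hF.entrance_mem _))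
  set B := T.trans S
  have hBF : ∀ p ∈ range B, p ∉ F (n - 1 : ℕ) := by
    rw [Path.trans_range]
    exact fun p hp => hp.elim (hTF p) (hSF p)
  obtain ⟨h6, h7⟩ := wind_rectangle B γ
    (disjoint_left.2 fun p hp hp' => hBF p hp (hγ hp'))
  have hzw : z ≠ w := fun h => hBF w ⟨1, B.target⟩ (h ▸ hz)
  have h8 := hD.L_symm z (hFX _ _ hz) w (hFX _ _ hw) hzw
  have h9 := hD.L_exp w (hFX _ _ hw) z (hFX _ _ hz) hzw.symm
  simp only [hfz] at h2 h4
  simp only [hfw] at h1 h3 h5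
  rw [hfz, hfw] at h9
  have he : e 0 ≠ e (n - 1 : ℕ) := fun h =>
    hBF (e 0) ⟨0, B.source⟩ (h ▸ hF.entrance_mem _)
  have h10 : wind B (e (n - 1 : ℕ)) + wind γ w + L w z = κ := by
    linear_combination (-h1 - h2 - h3 + h4 + h5 + h6 - h8) / 2
  have h11 := hD.exp_κ
  rw [← h10, exp_add, h7, div_mul_eq_mul_div, h9, div_eq_one_iff_eq (sub_ne_zero.2 he.symm)] at h11
  exact he (by linear_combination h11 / 2)

/-- A path connected planar set with displacement data carries no cycle of forward paths. -/
theorem not_hasCycle (hD : DisplacementData X C f g L Θ κ)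
    (hpath : ∀ a ∈ C, ∀ b ∈ C, ∃ γ : Path a b, range γ ⊆ C) (n : ℕ) : ¬ HasCycle f C n := by
  induction n using Nat.strong_induction_on with
  | _ n hmin =>
  intro hcyc
  have hcyc' := hcyc
  obtain ⟨hn, e, o, S, hS, hdisj, hstep, hlast⟩ := hcyc
  have hn2 : 2 ≤ n := by
    by_contra h
    obtain rfl : n = 1 := by omega
    exact not_hasCycle_one hcyc'
  have : NeZero n := ⟨by omega⟩
  have hval : ∀ i : ZMod n, i.val < n := fun i => i.val_lt
  choose γ hγ hγf using fun i : ZMod n => (hS i.val (hval i)).2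
  have hγC : ∀ i, range (γ i) ⊆ C := fun i => (hγ i).trans (hS _ (hval i)).1
  have hγd : ∀ i j, i ≠ j → Disjoint (range (γ i)) (range (γ j)) := fun i j hij =>
    (hdisj _ (hval i) _ (hval j) fun h => hij (ZMod.val_injective n h)).mono (hγ i) (hγ j)
  have hst : ∀ i : ZMod n, f (o i.val) = e (i + 1).val := by
    intro i
    rcases lt_or_ge (i.val + 1) n with h | h
    · have h1 : (i + 1).val = i.val + 1 := by
        rw [← ZMod.val_natCast_of_lt h]
        simp
      rw [h1, hstep _ h]
    · have h1 : i.val = n - 1 := by have := hval i; omega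
      have h2 : i + 1 = 0 := by
        rw [← ZMod.natCast_zmod_val i, h1, ← Nat.cast_add_one, Nat.sub_add_cancel hn]
        simp
      rw [h2, h1, ZMod.val_zero, hlast]
  rcases hn2.lt_or_eq with h3 | rfl
  · obtain ⟨F, hF, hl⟩ := exists_linked_family hD.f_cont (hD.injOn.mono hD.sub_X) hD.fix hmin h3
      hpath γ hγC hγf hγd hst
    exact hD.false_of_goodFamily hF hmin hn2 fun _ => hl
  · have hg : ∀ i, IsGoodSet f (range (γ i)) (e i.val) (o i.val) := fun i => by
      have := isGoodSet_of_isForward (f := f) (γ i) (t₀ := 1) fun u v h _ => hγf i u v h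
      have huniv : {u : I | u ≤ 1} = univ := eq_univ_of_forall fun u => u.2.2
      rwa [huniv, image_univ, (γ i).target] at this
    exact hD.false_of_goodFamily (F := fun i => range (γ i))
      ⟨hγC, fun i => (hg i).entrance_mem, fun i => (hg i).from_entrance,
        fun i => (hg i).to_exit, hγd, hst⟩ hmin hn2 fun h => absurd h (by decide)

end DisplacementData

end NoCycle

section Recurrence

lemma iterate_sub_eq {α : Type*} {f : α → α} {C : Set α} (hinj : InjOn f C) {x : α}
    (horb : ∀ n, f^[n] x ∈ C) {i j : ℕ} (hij : i ≤ j) (h : f^[i] x = f^[j] x) :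
    f^[j - i] x = x := by
  induction i generalizing j with
  | zero => exact h.symm
  | succ i ih =>
    obtain ⟨j, rfl⟩ : ∃ k, j = k + 1 := ⟨j - 1, by omega⟩
    rw [Function.iterate_succ_apply', Function.iterate_succ_apply'] at h
    simpa using ih (by omega) (hinj (horb i) (horb j) h)

/-- Near a recurrent point there is a cycle of forward paths. -/
lemma exists_hasCycle {f : ℂ → ℂ} {C : Set ℂ} (hf : Continuous f) (hinj : InjOn f C)
    (hfix : ∀ x ∈ C, f x ≠ x) {x : ℂ} (horb : ∀ n, f^[n] x ∈ C)
    (hpath : ∀ ε > 0, ∃ δ > 0, ∀ y ∈ C, dist x y < δ → JoinedIn (C ∩ Metric.ball x ε) x y)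
    (hrec : ∀ δ > 0, ∃ n, 1 ≤ n ∧ dist x (f^[n] x) < δ) : ∃ n, HasCycle f C n := by
  classical
  obtain ⟨ε, hε, hdisj⟩ : ∃ ε > 0, ∀ y ∈ Metric.ball x ε, f y ∉ Metric.ball x ε := by
    have hr : 0 < dist (f x) x / 2 := half_pos (dist_pos.2 (hfix x (horb 0)))
    obtain ⟨ε, hε, h⟩ := Metric.continuousAt_iff.1 hf.continuousAt _ hr
    refine ⟨min ε (dist (f x) x / 2), lt_min hε hr, fun y hy hfy => ?_⟩
    have h1 := h (lt_of_lt_of_le hy (min_le_left _ _))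
    have h2 : dist (f y) x < dist (f x) x / 2 := lt_of_lt_of_le hfy (min_le_right _ _)
    have h3 := dist_triangle_left (f x) x (f y)
    linarith
  obtain ⟨δ, hδ, hδ'⟩ := hpath ε hε
  set D := pathComponentIn (C ∩ Metric.ball x ε) x
  have hxD : x ∈ D := mem_pathComponentIn_self ⟨horb 0, Metric.mem_ball_self hε⟩
  have hDsub : D ⊆ C ∩ Metric.ball x ε := pathComponentIn_subset
  have hex : ∃ n, 1 ≤ n ∧ f^[n] x ∈ D := by
    obtain ⟨n, hn, h⟩ := hrec δ hδ
    exact ⟨n, hn, hδ' _ (horb n) h⟩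
  set N := Nat.find hex
  obtain ⟨hN1, hND⟩ : 1 ≤ N ∧ f^[N] x ∈ D := Nat.find_spec hex
  have hmin : ∀ i, 1 ≤ i → i < N → f^[i] x ∉ D := fun i h1 h2 h =>
    Nat.find_min hex h2 ⟨h1, h⟩
  have hDjoin : ForwardJoined f D (f^[N] x) x := by
    obtain ⟨γ, hγ⟩ := (isPathConnected_pathComponentIn (hDsub hxD)).joinedIn _ hND _ hxD
    refine ⟨γ, range_subset_iff.2 hγ, fun s t _ h => ?_⟩
    exact hdisj _ (hDsub (hγ t)).2 (h ▸ (hDsub (hγ s)).2)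
  refine ⟨N, hN1, fun i => if i = 0 then f^[N] x else f^[i] x, fun i => f^[i] x,
    fun i => if i = 0 then D else {f^[i] x}, ?_, ?_, ?_, ?_⟩
  · intro i _
    dsimp only
    split_ifs with h
    · subst h
      exact ⟨hDsub.trans inter_subset_left, hDjoin⟩
    · exact ⟨singleton_subset_iff.2 (horb i), ForwardJoined.refl (hfix _ (horb i))⟩
  · have key : ∀ i j, 1 ≤ i → i < j → j < N → f^[i] x ≠ f^[j] x := fun i j h1 h2 h3 h =>
      hmin (j - i) (by omega) (by omega)
        ((iterate_sub_eq hinj horb h2.le h).symm ▸ hxD)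
    intro i hi j hj hij
    dsimp only
    split_ifs with h1 h2 h2
    · omega
    · simpa using hmin j (by omega) hj
    · simpa using hmin i (by omega) hi
    · rw [disjoint_singleton]
      rcases lt_or_gt_of_ne hij with h | h
      · exact key i j (by omega) h hj
      · exact (key j i (by omega) h hi).symm
  · intro i _
    dsimp only
    rw [if_neg (by omega), Function.iterate_succ_apply']
  · dsimp only
    rw [if_pos rfl, ← Function.iterate_succ_apply' f, Nat.succ_eq_add_one, Nat.sub_add_cancel hN1]

end Recurrence

section LocalConnectedness

variable {M : Type*} [MetricSpace M]

/-- Close points lie in small preconnected sets, uniformly. -/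
def UniformlyLocallyConnected (M : Type*) [MetricSpace M] : Prop :=
  ∀ ε > 0, ∃ δ > 0, ∀ x y : M, dist x y < δ →
    ∃ S : Set M, IsPreconnected S ∧ x ∈ S ∧ y ∈ S ∧ S ⊆ Metric.ball x ε

lemma IsPreconnected.exists_chain {S : Set M} (hS : IsPreconnected S) {δ : ℝ} (hδ : 0 < δ)
    {x y : M} (hx : x ∈ S) (hy : y ∈ S) :
    ∃ (n : ℕ) (c : ℕ → M), c 0 = x ∧ (∀ i ≥ n, c i = y) ∧ (∀ i, c i ∈ S) ∧
      ∀ i, dist (c i) (c (i + 1)) < δ := by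
  refine hS.induction₂' (fun x y => ∃ (n : ℕ) (c : ℕ → M), c 0 = x ∧ (∀ i ≥ n, c i = y) ∧
    (∀ i, c i ∈ S) ∧ ∀ i, dist (c i) (c (i + 1)) < δ) ?_ ?_ hx hy
  · intro x hx
    have key : ∀ x ∈ S, ∀ y ∈ S, dist x y < δ → ∃ (n : ℕ) (c : ℕ → M), c 0 = x ∧
        (∀ i ≥ n, c i = y) ∧ (∀ i, c i ∈ S) ∧ ∀ i, dist (c i) (c (i + 1)) < δ := by
      intro x hx y hy hxy
      refine ⟨1, fun i => if i = 0 then x else y, by simp, fun i hi => if_neg (by omega),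
        fun i => by dsimp only; split_ifs <;> assumption, fun i => ?_⟩
      rcases i with _ | i <;> simp [hxy, hδ]
    filter_upwards [self_mem_nhdsWithin, mem_nhdsWithin_of_mem_nhds (Metric.ball_mem_nhds x hδ)]
      with y hy hy'
    exact ⟨key x hx y hy (by rwa [dist_comm]), key y hy x hx hy'⟩
  · rintro x y z - - - ⟨n, c, h1, h2, h3, h4⟩ ⟨m, d, k1, k2, k3, k4⟩
    refine ⟨n + m, fun i => if i ≤ n then c i else d (i - n), by simp [h1], fun i hi => ?_,
      fun i => ?_, fun i => ?_⟩
    · dsimp only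
      split_ifs with h
      · obtain rfl : m = 0 := by omega
        rw [h2 i (by omega), ← k1, k2 0 le_rfl]
      · exact k2 _ (by omega)
    · dsimp only
      split_ifs
      exacts [h3 _, k3 _]
    · dsimp only
      rcases lt_trichotomy i n with h | rfl | h
      · rw [if_pos h.le, if_pos (show i + 1 ≤ n from h)]; exact h4 i
      · rw [if_pos le_rfl, if_neg (by omega), h2 i le_rfl, ← k1]
        simpa using k4 0
      · rw [if_neg (by omega), if_neg (by omega), show i + 1 - n = i - n + 1 by omega]
        exact k4 _

/-- Refinement of a chain. -/
lemma exists_chain_refinement {δ δ' ε : ℝ} (hδ' : 0 < δ')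
    (h : ∀ x y : M, dist x y < δ →
      ∃ S : Set M, IsPreconnected S ∧ x ∈ S ∧ y ∈ S ∧ S ⊆ Metric.ball x ε)
    {x y : M} {N : ℕ} {p : ℕ → M} (h0 : p 0 = x) (hN : ∀ i ≥ N, p i = y)
    (hp : ∀ i, dist (p i) (p (i + 1)) < δ) :
    ∃ (n : ℕ) (q : ℕ → M), 0 < n ∧ q 0 = x ∧ (∀ i ≥ N * n, q i = y) ∧
      (∀ i, dist (q i) (q (i + 1)) < δ') ∧ ∀ i, dist (q i) (p (i / n)) < ε := by
  choose S hS hxS hyS hSε using fun i => h _ _ (hp i)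
  choose m c hc0 hcm hcS hcd using fun i => (hS i).exists_chain hδ' (hxS i) (hyS i)
  set n := ∑ i ∈ Finset.range N, m i + 1
  have hmn : ∀ i < N, m i ≤ n := fun i hi =>
    (Finset.single_le_sum (f := m) (fun _ _ => Nat.zero_le _) (Finset.mem_range.2 hi)).trans
      (Nat.le_succ _)
  have hn : 0 < n := Nat.succ_pos _
  have hdiv : ∀ i, i / n < N ↔ i < N * n := fun i => Nat.div_lt_iff_lt_mul hn
  refine ⟨n, fun i => if i < N * n then c (i / n) (i % n) else y, hn, ?_, ?_, ?_, ?_⟩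
  · dsimp only
    split_ifs with h
    · simp [hc0, h0]
    · rw [← h0, hN 0 (by by_contra hN0; exact h (Nat.mul_pos (by omega) hn))]
  · exact fun i hi => if_neg (by omega)
  · intro i
    rcases lt_or_ge i (N * n) with h | h
    · have hlast : c (i / n) n = p (i / n + 1) := hcm _ _ (hmn _ ((hdiv i).2 h))
      have hnext : (if i + 1 < N * n then c ((i + 1) / n) ((i + 1) % n) else y) =
          c (i / n) (i % n + 1) := by
        have hlt := Nat.mod_lt i hn
        rcases Nat.lt_or_ge (i % n + 1) n with h1 | h1
        · have e1 : (i + 1) / n = i / n := by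
            refine Nat.div_eq_of_lt_le ((Nat.div_mul_le_self i n).trans i.le_succ) ?_
            have := Nat.div_add_mod i n
            rw [Nat.mul_comm n] at this
            rw [Nat.add_mul]
            omega
          have e2 : (i + 1) % n = i % n + 1 := by
            have := Nat.div_add_mod (i + 1) n
            rw [e1] at this
            have := Nat.div_add_mod i n
            omega
          rw [if_pos ((hdiv _).1 (e1 ▸ (hdiv _).2 h)), e1, e2]
        · have e0 : i % n + 1 = n := by omega
          have e3 : i + 1 = (i / n + 1) * n := by nlinarith [Nat.div_add_mod i n]
          rw [e0, hlast]
          split_ifs with h2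
          · rw [e3, Nat.mul_div_cancel _ hn, Nat.mul_mod_left, hc0]
          · rw [hN]
            by_contra h3
            exact h2 ((hdiv _).1 (by rw [e3, Nat.mul_div_cancel _ hn]; omega))
      dsimp only
      rw [hnext, if_pos h]
      exact hcd _ _
    · dsimp only
      rw [if_neg (by omega), if_neg (by omega), dist_self]
      exact hδ'
  · intro i
    dsimp only
    split_ifs with h
    · exact hSε _ (hcS _ _)
    · have h1 : N ≤ i / n := not_lt.1 fun h' => h ((hdiv i).1 h')
      have := hSε N (hxS N)
      rw [hN _ h1, ← hN N le_rfl]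
      exact this

/-- A complete uniformly locally connected metric space is uniformly locally path connected. -/
theorem UniformlyLocallyConnected.exists_path [CompleteSpace M]
    (h : UniformlyLocallyConnected M) {ε : ℝ} (hε : 0 < ε) :
    ∃ δ > 0, ∀ x y : M, dist x y < δ → ∃ γ : Path x y, ∀ t, γ t ∈ Metric.ball x ε := by
  set e : ℕ → ℝ := fun k => ε / 2 / 2 / 2 ^ k with he_def
  have he : ∀ k, 0 < e k := fun k => by positivity
  choose δ₀ hδ₀ hS₀ using fun k => h (e k) (he k)
  set δ : ℕ → ℝ := fun k => min (δ₀ k) (e k)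
  have hδ : ∀ k, 0 < δ k := fun k => lt_min (hδ₀ k) (he k)
  refine ⟨δ 0, hδ 0, fun x y hxy => ?_⟩
  let P : ℕ → ℕ × (ℕ → M) → Prop := fun k d =>
    0 < d.1 ∧ d.2 0 = x ∧ (∀ i ≥ d.1, d.2 i = y) ∧ ∀ i, dist (d.2 i) (d.2 (i + 1)) < δ k
  have href : ∀ k (d : {d // P k d}), ∃ d' : {d // P (k + 1) d}, ∃ n, 0 < n ∧
      d'.1.1 = d.1.1 * n ∧ ∀ i, dist (d'.1.2 i) (d.1.2 (i / n)) < e k := by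
    rintro k ⟨⟨N, p⟩, hN, h0, h1, hd⟩
    obtain ⟨n, q, hn, hq⟩ := exists_chain_refinement (hδ (k + 1))
      (fun x y hxy => hS₀ k x y (hxy.trans_le (min_le_left _ _))) h0 h1 hd
    exact ⟨⟨(N * n, q), Nat.mul_pos hN hn, hq.1, hq.2.1, hq.2.2.1⟩, n, hn, rfl, hq.2.2.2⟩
  choose step n hn hstepN hstep using href
  let D : ∀ k, {d // P k d} := fun k => Nat.rec (motive := fun k => {d // P k d})
    ⟨(1, fun i => if i = 0 then x else y), one_pos, by simp,
      fun i hi => if_neg (by dsimp only at hi; omega), fun i => by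
        rcases i with _ | i <;> simp [hxy, hδ]⟩ step k
  let N : ℕ → ℕ := fun k => (D k).1.1
  let F : ℕ → ℝ → M := fun k t => (D k).1.2 ⌊t * N k⌋₊
  have hN : ∀ k, 0 < N k := fun k => (D k).2.1
  have hF : ∀ t k, dist (F k t) (F (k + 1) t) ≤ ε / 2 / 2 / 2 ^ k := by
    intro t k
    have h1 := hstep k (D k) ⌊t * N (k + 1)⌋₊
    have h2 : N (k + 1) = N k * n k (D k) := hstepN k (D k)
    rw [← Nat.floor_div_natCast, h2, Nat.cast_mul, ← mul_assoc,
      mul_div_cancel_right₀ _ (Nat.cast_ne_zero.2 (hn k (D k)).ne'), dist_comm] at h1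
    refine le_trans (le_of_eq ?_) h1.le
    change dist _ _ = dist _ ((D (k + 1)).1.2 _)
    rw [mul_assoc, ← Nat.cast_mul, ← h2]
  have hlim := fun t => cauchySeq_tendsto_of_complete (cauchySeq_of_le_geometric_two (hF t))
  choose f hf using hlim
  have hfF : ∀ t k, dist (F k t) (f t) ≤ ε / 2 / 2 ^ k := fun t k =>
    dist_le_of_le_geometric_two_of_tendsto (hF t) (hf t) k
  have hF0 : ∀ k, F k 0 = x := fun k => by simpa [F] using (D k).2.2.1
  have hF1 : ∀ k, F k 1 = y := fun k => by
    simpa [F] using (D k).2.2.2.1 _ le_rfl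
  have hf0 : f 0 = x := tendsto_nhds_unique (hf 0) (by simp [hF0])
  have hf1 : f 1 = y := tendsto_nhds_unique (hf 1) (by simp [hF1])
  have hclose : ∀ k (a b : ℝ), a ≤ b → b - a < 1 / N k → dist (F k a) (F k b) < e k := by
    intro k a b hab hba
    have hNk : (0 : ℝ) < N k := Nat.cast_pos.2 (hN k)
    have h1 : ⌊a * N k⌋₊ ≤ ⌊b * N k⌋₊ := Nat.floor_le_floor (by gcongr)
    have h2 : ⌊b * N k⌋₊ < ⌊a * N k⌋₊ + 2 := by
      rw [Nat.floor_lt' (by omega)]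
      rw [lt_div_iff₀ hNk] at hba
      have := Nat.lt_floor_add_one (a * N k)
      push_cast
      linarith
    rcases h1.eq_or_lt with h3 | h3
    · simp only [F, h3, dist_self, he]
    · have h4 : ⌊b * N k⌋₊ = ⌊a * N k⌋₊ + 1 := by omega
      simp only [F, h4]
      exact ((D k).2.2.2.2 _).trans_le (min_le_right _ _)
  have hcont : Continuous f := by
    rw [Metric.continuous_iff]
    intro a η hη
    obtain ⟨k, hk⟩ : ∃ k, ε / 2 / 2 ^ k < η / 3 := by
      have := tendsto_const_nhds.div_atTop (a := ε / 2)
        (tendsto_pow_atTop_atTop_of_one_lt (one_lt_two (α := ℝ)))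
      exact (this.eventually (gt_mem_nhds (by positivity : 0 < η / 3))).exists
    have hek : e k ≤ ε / 2 / 2 ^ k := by
      have : 0 < ε / 2 / 2 ^ k := by positivity
      rw [he_def]
      dsimp only
      rw [div_right_comm]
      linarith
    refine ⟨1 / N k, by have := hN k; positivity, fun b hb => ?_⟩
    rw [Real.dist_eq, abs_lt] at hb
    have h1 : dist (F k b) (F k a) < e k := by
      rcases le_total a b with h | h
      · rw [dist_comm]; exact hclose k a b h (by linarith)
      · exact hclose k b a h (by linarith)
    have h2 := dist_triangle4 (f b) (F k b) (F k a) (f a)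
    have h3 := hfF a k
    have h4 := hfF b k
    rw [dist_comm] at h4
    linarith
  refine ⟨⟨⟨fun t : unitInterval => f t, by fun_prop⟩, by simp [hf0], by simp [hf1]⟩, fun t => ?_⟩
  change dist (f t) x < ε
  have h0 := hfF t 0
  rw [dist_comm] at h0
  rcases eq_or_ne t 1 with rfl | ht
  · rw [Set.Icc.coe_one, hf1, dist_comm]
    refine (hxy.trans_le (min_le_right _ _)).trans ?_
    simp only [he_def]
    norm_num
    linarith
  · have : F 0 t = x := by
      have ht1 : (t : ℝ) < 1 := lt_of_le_of_ne t.2.2 fun h => ht (Subtype.ext h)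
      have h3 : ⌊(t : ℝ) * N 0⌋₊ = 0 := by
        rw [Nat.floor_eq_zero]
        simpa [N, D] using ht1
      simp only [F, h3]
      exact (D 0).2.2.1
    rw [← this]
    refine h0.trans_lt ?_
    norm_num
    linarith

end LocalConnectedness

section LocalPathConnectedness

variable {M : Type*} [MetricSpace M]

lemma uniformlyLocallyConnected_of_compact [CompactSpace M] [LocallyConnectedSpace M] :
    UniformlyLocallyConnected M := by
  intro ε hε
  have key : ∀ x : M, ∃ U ⊆ Metric.ball x (ε / 2), IsOpen U ∧ x ∈ U ∧ IsConnected U := fun x =>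
    locallyConnectedSpace_iff_subsets_isOpen_isConnected.1 inferInstance x _
      (Metric.ball_mem_nhds x (half_pos hε))
  choose U hUb hUo hxU hUc using key
  obtain ⟨δ, hδ, h⟩ := lebesgue_number_lemma_of_metric (isCompact_univ (X := M)) hUo
    fun x _ => mem_iUnion.2 ⟨x, hxU x⟩
  refine ⟨δ, hδ, fun x y hxy => ?_⟩
  obtain ⟨i, hi⟩ := h x (mem_univ x)
  have hx : x ∈ U i := hi (Metric.mem_ball_self hδ)
  refine ⟨U i, (hUc i).isPreconnected, hx, hi (by rwa [Metric.mem_ball, dist_comm]), fun z hz => ?_⟩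
  have h1 := Metric.mem_ball.1 (hUb i hz)
  have h2 := Metric.mem_ball.1 (hUb i hx)
  have := dist_triangle_right z x i
  rw [Metric.mem_ball]
  linarith

lemma UniformlyLocallyConnected.locallyPathConnectedSpace [CompleteSpace M]
    (h : UniformlyLocallyConnected M) : LocallyPathConnectedSpace M := by
  refine ⟨fun x => ⟨fun t => ⟨fun ht => ?_, fun ⟨s, ⟨hs, _⟩, hst⟩ => mem_of_superset hs hst⟩⟩⟩
  obtain ⟨ε, hε, hεt⟩ := Metric.mem_nhds_iff.1 ht
  obtain ⟨δ, hδ, hp⟩ := h.exists_path hε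
  refine ⟨pathComponentIn (Metric.ball x ε) x, ⟨?_, isPathConnected_pathComponentIn
    (Metric.mem_ball_self hε)⟩, pathComponentIn_subset.trans hεt⟩
  refine mem_of_superset (Metric.ball_mem_nhds x hδ) fun y hy => ?_
  obtain ⟨γ, hγ⟩ := hp x y (by rwa [dist_comm])
  exact ⟨γ, hγ⟩

/-- Uniform local path connectedness of a subset. -/
lemma UniformlyLocallyConnected.exists_joinedIn {S : Set M} (hS : IsCompact S)
    (h : UniformlyLocallyConnected S) {ε : ℝ} (hε : 0 < ε) :
    ∃ δ > 0, ∀ x ∈ S, ∀ y ∈ S, dist x y < δ → JoinedIn (S ∩ Metric.ball x ε) x y := by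
  have : CompactSpace S := isCompact_iff_compactSpace.1 hS
  obtain ⟨δ, hδ, hp⟩ := h.exists_path hε
  refine ⟨δ, hδ, fun x hx y hy hxy => ?_⟩
  obtain ⟨γ, hγ⟩ := hp ⟨x, hx⟩ ⟨y, hy⟩ hxy
  exact ⟨γ.map continuous_subtype_val, fun t => ⟨(γ t).2, hγ t⟩⟩

end LocalPathConnectedness

section ParametricLogarithm

open Complex

lemma exists_continuous_plog {P Q : Type*} [TopologicalSpace P] [TopologicalSpace Q]
    [CompactSpace Q] [PreconnectedSpace Q] {q₀ : Q} {u : P × Q → ℂ} (hu : Continuous u)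
    (h0 : ∀ x, u x ≠ 0) (h1 : ∀ p, u (p, q₀) = 1)
    (hl : ∀ p, ∃ l : Q → ℂ, Continuous l ∧ ∀ q, exp (l q) = u (p, q)) :
    ∃ l : P × Q → ℂ, Continuous l ∧ (∀ x, exp (l x) = u x) ∧ ∀ p, l (p, q₀) = 0 := by
  choose l hlc hle using hl
  have hle' : ∀ p q, exp (l p q - l p q₀) = u (p, q) := fun p q => by
    rw [exp_sub, hle, hle, h1, div_one]
  refine ⟨fun x => l x.1 x.2 - l x.1 q₀, ?_, fun x => hle' _ _, fun p => sub_self _⟩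
  rw [continuous_iff_continuousAt]
  rintro ⟨p₀, q⟩
  have hv : Continuous fun x : P × Q => u x / u (p₀, x.2) :=
    hu.div (by fun_prop) fun x => h0 _
  have hev : ∀ᶠ p in 𝓝 p₀, ∀ q ∈ (univ : Set Q), u (p, q) / u (p₀, q) ∈ slitPlane := by
    refine isCompact_univ.eventually_forall_of_forall_eventually fun q _ => ?_
    refine hv.continuousAt.eventually_mem (isOpen_slitPlane.mem_nhds ?_)
    simp [div_self (h0 _), one_mem_slitPlane]
  set m : P × Q → ℂ := fun x => l p₀ x.2 - l p₀ q₀ + log (u x / u (p₀, x.2)) with hm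
  have hmc : ∀ p, (∀ q ∈ (univ : Set Q), u (p, q) / u (p₀, q) ∈ slitPlane) → ∀ q,
      ContinuousAt m (p, q) := by
    intro p hp q
    have := hv.continuousAt.clog (hp q (mem_univ _))
    exact (by fun_prop : Continuous fun x : P × Q => l p₀ x.2 - l p₀ q₀).continuousAt.add this
  have heq : ∀ p, (∀ q ∈ (univ : Set Q), u (p, q) / u (p₀, q) ∈ slitPlane) → ∀ q,
      l p q - l p q₀ = m (p, q) := by
    intro p hp q
    have h2 : Continuous fun q => m (p, q) := continuous_iff_continuousAt.2 fun q =>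
      (hmc p hp q).comp (by fun_prop : Continuous fun q => (p, q)).continuousAt
    have h3 := log_sub_const isPreconnected_univ (hlc p).continuousOn
      (h2.add_const (l p q₀)).continuousOn (a := q) (b := q₀) (fun q _ => by
        rw [exp_add, hm]
        dsimp only
        rw [exp_add, hle', hle, hle, h1, exp_log (div_ne_zero (h0 _) (h0 _)), mul_one,
          mul_div_cancel₀ _ (h0 _)]) (mem_univ _) (mem_univ _)
    have h4 : m (p, q₀) = 0 := by simp [hm, h1]
    rw [h4] at h3
    linear_combination h3
  refine (hmc p₀ hev.self_of_nhds q).congr ?_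
  rw [nhds_prod_eq]
  filter_upwards [hev.prod_inl (𝓝 q)] with x hx using (heq x.1 hx x.2).symm

/-- Logarithms of the slices of a function on a product fit together continuously when they are
normalized at one point. -/
theorem exists_plog {α β : Type*} [TopologicalSpace α] [TopologicalSpace β] {P : Set α} {Q : Set β}
    (hQ : IsCompact Q) (hQ' : IsPreconnected Q) {q₀ : β} (hq₀ : q₀ ∈ Q) {u : α × β → ℂ}
    (hu : ContinuousOn u (P ×ˢ Q)) (h0 : ∀ x ∈ P ×ˢ Q, u x ≠ 0) (h1 : ∀ p ∈ P, u (p, q₀) = 1)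
    (hl : ∀ p ∈ P, ∃ l : β → ℂ, ContinuousOn l Q ∧ ∀ q ∈ Q, exp (l q) = u (p, q)) :
    ∃ l : α × β → ℂ, ContinuousOn l (P ×ˢ Q) ∧ (∀ x ∈ P ×ˢ Q, exp (l x) = u x) ∧
      ∀ p ∈ P, l (p, q₀) = 0 := by
  classical
  have : CompactSpace Q := isCompact_iff_compactSpace.1 hQ
  have : PreconnectedSpace Q := isPreconnected_iff_preconnectedSpace.1 hQ'
  obtain ⟨l, hlc, hle, hl0⟩ := exists_continuous_plog (P := P) (Q := Q) (q₀ := ⟨q₀, hq₀⟩)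
    (u := fun x => u (x.1, x.2))
    (hu.comp_continuous (by fun_prop) fun x => ⟨x.1.2, x.2.2⟩)
    (fun x => h0 _ ⟨x.1.2, x.2.2⟩) (fun p => h1 p p.2) (fun p => by
      obtain ⟨l, hl, hl'⟩ := hl p p.2
      exact ⟨fun q => l q, hl.comp_continuous continuous_subtype_val fun q => q.2,
        fun q => hl' q q.2⟩)
  refine ⟨fun x => if h : x.1 ∈ P ∧ x.2 ∈ Q then l (⟨x.1, h.1⟩, ⟨x.2, h.2⟩) else 0, ?_, ?_, ?_⟩
  · rw [continuousOn_iff_continuous_domRestrict]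
    have : Continuous fun x : ↥(P ×ˢ Q) => l (⟨x.1.1, x.2.1⟩, ⟨x.1.2, x.2.2⟩) := by fun_prop
    refine this.congr fun x => ?_
    rw [Set.domRestrict_apply]
    rw [dif_pos (⟨x.2.1, x.2.2⟩ : x.1.1 ∈ P ∧ x.1.2 ∈ Q)]
  · intro x hx
    dsimp only
    rw [dif_pos (⟨hx.1, hx.2⟩ : x.1 ∈ P ∧ x.2 ∈ Q), hle]
  · intro p hp
    dsimp only
    rw [dif_pos (⟨hp, hq₀⟩ : p ∈ P ∧ q₀ ∈ Q), hl0 ⟨p, hp⟩]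

end ParametricLogarithm

section Separation

open Complex

/-- Every zero-free continuous function on `A` has a continuous logarithm. -/
def HasLogarithms (A : Set ℂ) : Prop :=
  ∀ u : ℂ → ℂ, ContinuousOn u A → (∀ z ∈ A, u z ≠ 0) →
    ∃ l : ℂ → ℂ, ContinuousOn l A ∧ ∀ z ∈ A, exp (l z) = u z

lemma HasLogarithms.image {A : Set ℂ} (hA : HasLogarithms A) {f g : ℂ → ℂ} (hf : ContinuousOn f A)
    (hg : ContinuousOn g (f '' A)) (h : ∀ z ∈ A, g (f z) = z) : HasLogarithms (f '' A) := by
  intro u hu h0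
  obtain ⟨l, hl, hl'⟩ := hA (u ∘ f) (hu.comp hf (mapsTo_image f A))
    fun z hz => h0 _ (mem_image_of_mem f hz)
  refine ⟨l ∘ g, hl.comp hg ?_, ?_⟩
  · rintro _ ⟨z, hz, rfl⟩
    rwa [h z hz]
  · rintro _ ⟨z, hz, rfl⟩
    simp only [Function.comp_apply, h z hz, hl' z hz]

lemma hasLogarithms_of_subtype {A : Set ℂ} [SimplyConnectedSpace A] [LocallyPathConnectedSpace A] :
    HasLogarithms A := by
  intro u hu h0
  obtain ⟨l, hl, hl'⟩ := exists_log (A := A) (u := fun z => u z)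
    (hu.comp_continuous continuous_subtype_val fun z => z.2) fun z => h0 z z.2
  classical
  refine ⟨fun z => if h : z ∈ A then l ⟨z, h⟩ else 0, ?_, fun z hz => ?_⟩
  · rw [continuousOn_iff_continuous_domRestrict]
    refine hl.congr fun x => ?_
    rw [Set.domRestrict_apply, dif_pos x.2]
  · dsimp only
    rw [dif_pos hz, hl']

lemma not_continuousOn_log_sphere {c : ℂ} {R : ℝ} (hR : 0 < R) {l : ℂ → ℂ}
    (hl : ContinuousOn l (Metric.sphere c R)) : ¬ ∀ z ∈ Metric.sphere c R, exp (l z) = z - c := by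
  intro h
  have hmem : ∀ t : ℝ, c + exp (Real.log R + t * I) ∈ Metric.sphere c R := fun t => by
    simp [norm_exp, Real.exp_log hR]
  have h1 := log_sub_const (A := ℝ) isPreconnected_univ
    (l := fun t => l (c + exp (Real.log R + t * I)))
    (l' := fun t => Real.log R + t * I)
    (hl.comp_continuous (by fun_prop) hmem).continuousOn (by fun_prop)
    (fun t _ => by rw [h _ (hmem t)]; ring) (mem_univ 0) (mem_univ (2 * Real.pi))
  have h2 : exp (Real.log R + (2 * Real.pi : ℝ) * I) = exp (Real.log R + (0 : ℝ) * I) := by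
    push_cast
    rw [exp_add, exp_two_pi_mul_I]
    simp
  rw [h2] at h1
  have h3 : (0 : ℂ) = 2 * Real.pi * I := by
    push_cast at h1
    linear_combination -h1
  simp [Real.pi_ne_zero] at h3

/-- A cutoff function that is locally constant near two disjoint closed sets. -/
lemma exists_cutoff {M N : Set ℂ} (hM : IsClosed M) (hN : IsClosed N) (hMN : Disjoint M N) :
    ∃ χ : ℂ → ℝ, Continuous χ ∧ (∀ z ∈ M, χ =ᶠ[𝓝 z] 1) ∧ ∀ z ∈ N, χ =ᶠ[𝓝 z] 0 := by
  obtain ⟨ζ, h0, h1, -⟩ := exists_continuous_zero_one_of_isClosed hN hM hMN.symm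
  refine ⟨fun z => max 0 (min 1 (3 * ζ z - 1)), by fun_prop, fun z hz => ?_, fun z hz => ?_⟩
  · have : ∀ᶠ w in 𝓝 z, 2 / 3 < ζ w := by
      refine ζ.continuous.continuousAt.eventually_const_lt ?_
      rw [h1 hz]; norm_num
    filter_upwards [this] with w hw
    rw [min_eq_left (by linarith)]
    simp
  · have : ∀ᶠ w in 𝓝 z, ζ w < 1 / 3 := by
      refine ζ.continuous.continuousAt.eventually_lt_const ?_
      rw [h0 hz]; norm_num
    filter_upwards [this] with w hw
    exact max_eq_left ((min_le_right _ _).trans (by linarith))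

/-- A compact set whose complement carries a logarithm of `(w - c') / (w - c)` does not separate
its points `c` and `c'` by a clopen partition. -/
lemma false_of_log_compl {M N : Set ℂ} (hM : IsCompact M) (hN : IsClosed N) (hMN : Disjoint M N)
    {c c' : ℂ} (hc : c ∈ M) (hc' : c' ∈ N) {W : ℂ → ℂ} (hW : ContinuousOn W (M ∪ N)ᶜ)
    (hexp : ∀ w ∈ (M ∪ N)ᶜ, exp (W w) = (w - c') / (w - c)) : False := by
  obtain ⟨R, hR0, hR⟩ := hM.isBounded.subset_ball_lt 0 c
  have hN' : IsClosed (N ∪ (Metric.ball c R)ᶜ) := hN.union Metric.isOpen_ball.isClosed_compl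
  obtain ⟨χ, hχ, h1, h0⟩ := exists_cutoff hM.isClosed hN'
    (hMN.union_right (disjoint_compl_right_iff_subset.2 hR))
  have hopen : IsOpen (M ∪ N)ᶜ := (hM.isClosed.union hN).isOpen_compl
  set F : ℂ → ℂ := fun w => if χ w = 0 then w - c else
    if χ w = 1 then w - c' else (w - c') * exp (-(1 - χ w) * W w) with hF
  have hF' : ∀ w ∈ (M ∪ N)ᶜ, F w = (w - c') * exp (-(1 - χ w) * W w) := by
    intro w hw
    have hwc : w - c ≠ 0 := sub_ne_zero.2 fun h => hw (Or.inl (h ▸ hc))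
    have hwc' : w - c' ≠ 0 := sub_ne_zero.2 fun h => hw (Or.inr (h ▸ hc'))
    simp only [hF]
    split_ifs with h h'
    · rw [h]
      push_cast
      rw [sub_zero, neg_one_mul, exp_neg, hexp w hw]
      field_simp
    · simp [h']
    · rfl
  have hF1 : ∀ w, χ w = 1 → F w = w - c' := fun w hw => by simp [hF, hw]
  have hF0 : ∀ w, χ w = 0 → F w = w - c := fun w hw => by simp [hF, hw]
  have hcont : Continuous F := by
    rw [continuous_iff_continuousAt]
    intro w
    by_cases hwM : w ∈ M
    · refine (by fun_prop : Continuous fun w => w - c').continuousAt.congr ?_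
      filter_upwards [h1 w hwM] with z hz using (hF1 z hz).symm
    by_cases hwN : w ∈ N
    · refine (by fun_prop : Continuous fun w => w - c).continuousAt.congr ?_
      filter_upwards [h0 w (Or.inl hwN)] with z hz using (hF0 z hz).symm
    have hw : w ∈ (M ∪ N)ᶜ := by simp [hwM, hwN]
    have hWw : ContinuousAt W w := hW.continuousAt (hopen.mem_nhds hw)
    have : ContinuousAt (fun w => (w - c') * exp (-(1 - χ w) * W w)) w := by fun_prop
    refine this.congr ?_
    filter_upwards [hopen.mem_nhds hw] with z hz using (hF' z hz).symm
  have hne : ∀ w, F w ≠ 0 := by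
    intro w
    by_cases hwM : w ∈ M
    · rw [hF1 w (h1 w hwM).self_of_nhds, sub_ne_zero]
      rintro rfl
      exact hMN.le_bot ⟨hwM, hc'⟩
    by_cases hwN : w ∈ N
    · rw [hF0 w (h0 w (Or.inl hwN)).self_of_nhds, sub_ne_zero]
      rintro rfl
      exact hMN.le_bot ⟨hc, hwN⟩
    rw [hF' w (by simp [hwM, hwN])]
    refine mul_ne_zero (sub_ne_zero.2 ?_) (exp_ne_zero _)
    rintro rfl
    exact hwN hc'
  obtain ⟨l, hl, hl'⟩ := exists_log hcont hne
  refine not_continuousOn_log_sphere (c := c) hR0 hl.continuousOn fun z hz => ?_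
  rw [hl', hF0 z (h0 z (Or.inr fun h => ?_)).self_of_nhds]
  rw [Metric.mem_ball, Metric.mem_sphere.1 hz] at h
  exact lt_irrefl _ h

lemma continuousOn_wind {a b : ℂ} (γ : Path a b) : ContinuousOn (wind γ) (range γ)ᶜ := by
  have hsub : ∀ p ∈ (range γ)ᶜ, ∀ t, γ t - p ≠ 0 := fun p hp t =>
    sub_ne_zero.2 fun h => hp ⟨t, h⟩
  obtain ⟨l, hl, hl', hl0⟩ := exists_plog (P := (range γ)ᶜ) (Q := (univ : Set unitInterval))
    (q₀ := 0) (u := fun x => (γ x.2 - x.1) / (a - x.1)) isCompact_univ isPreconnected_univ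
    (mem_univ _) (by
      refine ContinuousOn.div (by fun_prop) (by fun_prop) fun x hx => ?_
      simpa using hsub x.1 hx.1 0)
    (fun x hx => div_ne_zero (hsub _ hx.1 _) (by simpa using hsub x.1 hx.1 0))
    (fun p hp => by simpa using div_self (hsub p hp 0))
    (fun p hp => by
      obtain ⟨l, hl, hl'⟩ := exists_log_interval (u := fun t => γ t - p) (by fun_prop) (hsub p hp)
      refine ⟨fun t => l t - l 0, by fun_prop, fun t _ => ?_⟩
      rw [exp_sub, hl', hl']
      simp)
  have h1 : ContinuousOn (fun p => l (p, 1)) (range γ)ᶜ :=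
    hl.comp (by fun_prop) fun p hp => ⟨hp, mem_univ _⟩
  refine h1.congr fun p hp => ?_
  have hap : a - p ≠ 0 := by simpa using hsub p hp 0
  have := dlog_eq (u := fun t => γ t - p) (l := fun t => l (p, t) + log (a - p))
    ((hl.comp_continuous (by fun_prop) fun t => ⟨hp, mem_univ _⟩ :
      Continuous fun t => l (p, t)).add_const _) (fun t => by
      rw [exp_add, hl' (p, t) ⟨hp, mem_univ _⟩, exp_log hap]
      exact div_mul_cancel₀ _ hap)
  rw [wind, this, hl0 p hp]
  ring

/-- Two arcs lying in closed sets `A` and `B` with the same winding around each point off `A ∪ B`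
have endpoints in the same component of `A ∩ B`. -/
theorem mem_connectedComponentIn_of_wind_eq {A B : Set ℂ} (hA : IsCompact A) (hB : IsCompact B)
    {c c' : ℂ} (α β : Path c c') (hα : range α ⊆ A) (hβ : range β ⊆ B)
    (h : ∀ p, p ∉ A → p ∉ B → wind α p = wind β p) :
    c' ∈ connectedComponentIn (A ∩ B) c := by
  classical
  have hc : c ∈ A ∩ B := ⟨hα ⟨0, by simp⟩, hβ ⟨0, by simp⟩⟩
  have hc' : c' ∈ A ∩ B := ⟨hα ⟨1, by simp⟩, hβ ⟨1, by simp⟩⟩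
  have hK : IsCompact (A ∩ B) := hA.inter hB
  have : CompactSpace ↥(A ∩ B) := isCompact_iff_compactSpace.1 hK
  rw [connectedComponentIn_eq_image hc]
  refine ⟨⟨c', hc'⟩, ?_, rfl⟩
  rw [connectedComponent_eq_iInter_isClopen]
  simp only [mem_iInter, Subtype.forall]
  rintro U ⟨hU, hcU⟩
  by_contra hcU'
  have hM : IsCompact (Subtype.val '' U : Set ℂ) := hU.1.isCompact.image continuous_subtype_val
  have hN : IsCompact (Subtype.val '' Uᶜ : Set ℂ) :=
    hU.2.isClosed_compl.isCompact.image continuous_subtype_val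
  have hunion : (Subtype.val '' U ∪ Subtype.val '' Uᶜ : Set ℂ) = A ∩ B := by
    rw [← image_union, union_compl_self, image_univ, Subtype.range_coe]
  refine false_of_log_compl (c := c) (c' := c') hM hN.isClosed
    ((disjoint_image_iff Subtype.val_injective).2 disjoint_compl_right)
    ⟨_, hcU, rfl⟩ ⟨_, hcU', rfl⟩ (W := fun w => if w ∈ A then wind β w else wind α w) ?_ ?_
  · rw [hunion]
    intro w hw
    refine ContinuousAt.continuousWithinAt ?_
    by_cases hwA : w ∈ A
    · have hwB : w ∈ Bᶜ := fun hwB => hw ⟨hwA, hwB⟩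
      have h1 : ContinuousAt (wind β) w := ((continuousOn_wind β).mono
        (compl_subset_compl.2 hβ)).continuousAt (hB.isClosed.isOpen_compl.mem_nhds hwB)
      refine h1.congr ?_
      filter_upwards [hB.isClosed.isOpen_compl.mem_nhds hwB] with z hz
      split_ifs with hzA
      · rfl
      · exact (h z hzA hz).symm
    · have h1 : ContinuousAt (wind α) w := ((continuousOn_wind α).mono
        (compl_subset_compl.2 hα)).continuousAt (hA.isClosed.isOpen_compl.mem_nhds hwA)
      refine h1.congr ?_
      filter_upwards [hA.isClosed.isOpen_compl.mem_nhds hwA] with z hz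
      rw [if_neg hz]
  · rw [hunion]
    intro w hw
    have : (w - c') / (w - c) = (c' - w) / (c - w) := by
      rw [← neg_sub c' w, ← neg_sub c w, neg_div_neg_eq]
    rw [this]
    split_ifs with hwA
    · exact exp_wind β fun hr => hw ⟨hwA, hβ hr⟩
    · exact exp_wind α fun hr => hwA (hα hr)

end Separation

section IntersectionComponent

open Complex

lemma wind_eq_sub {a b p : ℂ} (γ : Path a b) {S : Set ℂ} (hγ : range γ ⊆ S) {l : ℂ → ℂ}
    (hl : ContinuousOn l S) (h : ∀ z ∈ S, exp (l z) = z - p) : wind γ p = l b - l a := by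
  have hm : ∀ t, γ t ∈ S := fun t => hγ ⟨t, rfl⟩
  have := dlog_eq (u := fun t => γ t - p) (l := fun t => l (γ t))
    (hl.comp_continuous γ.continuous hm) fun t => h _ (hm t)
  simpa [wind] using this

lemma exists_log_sub_closedBall {c p : ℂ} {r : ℝ} (hp : p ∉ Metric.closedBall c r) :
    ∃ l : ℂ → ℂ, ContinuousOn l (Metric.closedBall c r) ∧
      ∀ z ∈ Metric.closedBall c r, exp (l z) = z - p := by
  rcases lt_or_ge r 0 with hr | hr
  · rw [Metric.closedBall_eq_empty.2 hr]
    exact ⟨0, continuousOn_empty _, fun z hz => hz.elim⟩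
  have hcp : c - p ≠ 0 := sub_ne_zero.2 fun h => hp (h ▸ Metric.mem_closedBall_self hr)
  have hslit : ∀ z ∈ Metric.closedBall c r, (z - p) / (c - p) ∈ slitPlane := by
    intro z hz
    refine Or.inl ?_
    rw [Metric.mem_closedBall, not_le, dist_comm, dist_eq_norm] at hp
    have h1 : ‖(z - c) / (c - p)‖ < 1 := by
      rw [norm_div, div_lt_one (norm_pos_iff.2 hcp)]
      exact (mem_closedBall_iff_norm.1 hz).trans_lt hp
    have h2 : (z - p) / (c - p) = 1 + (z - c) / (c - p) := by field_simp; ring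
    rw [h2, add_re, one_re]
    have := (abs_le.1 (abs_re_le_norm ((z - c) / (c - p)))).1
    linarith
  refine ⟨fun z => log (c - p) + log ((z - p) / (c - p)),
    continuousOn_const.add (ContinuousOn.clog (by fun_prop) hslit), fun z hz => ?_⟩
  rw [exp_add, exp_log hcp, exp_log (slitPlane_ne_zero (hslit z hz)), mul_div_cancel₀ _ hcp]

/-- Components of the intersection of two plane Peano continua with logarithms are uniformly
locally connected. -/
theorem uniformlyLocallyConnected_component {X Y C : Set ℂ} (hX : IsCompact X) (hY : IsCompact Y)
    (hXl : HasLogarithms X) (hYl : HasLogarithms Y) (hXu : UniformlyLocallyConnected X)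
    (hYu : UniformlyLocallyConnected Y) {x : ℂ} (hC : C = connectedComponentIn (X ∩ Y) x) :
    UniformlyLocallyConnected C := by
  have hCX : C ⊆ X ∩ Y := hC ▸ connectedComponentIn_subset _ _
  have hCp : IsPreconnected C := hC ▸ isPreconnected_connectedComponentIn
  intro ε hε
  obtain ⟨δ₁, hδ₁, h1⟩ := hXu.exists_joinedIn hX (half_pos hε)
  obtain ⟨δ₂, hδ₂, h2⟩ := hYu.exists_joinedIn hY (half_pos hε)
  refine ⟨min δ₁ δ₂, lt_min hδ₁ hδ₂, fun c c' hcc' => ?_⟩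
  have hc := hCX c.2
  have hc' := hCX c'.2
  obtain ⟨α, hα⟩ := h1 c hc.1 c' hc'.1 (hcc'.trans_le (min_le_left _ _))
  obtain ⟨β, hβ⟩ := h2 c hc.2 c' hc'.2 (hcc'.trans_le (min_le_right _ _))
  set D := Metric.closedBall (c : ℂ) (ε / 2)
  have hD : IsCompact D := isCompact_closedBall _ _
  have hαX : range α ⊆ X := by rintro _ ⟨t, rfl⟩; exact (hα t).1
  have hβY : range β ⊆ Y := by rintro _ ⟨t, rfl⟩; exact (hβ t).1
  have hαD : range α ⊆ D := by
    rintro _ ⟨t, rfl⟩; exact Metric.ball_subset_closedBall (hα t).2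
  have hβD : range β ⊆ D := by
    rintro _ ⟨t, rfl⟩; exact Metric.ball_subset_closedBall (hβ t).2
  have hmem := mem_connectedComponentIn_of_wind_eq (hX.inter hD) (hY.inter hD) α β
    (subset_inter hαX hαD) (subset_inter hβY hβD) (fun p hpA hpB => by
      by_cases hpD : p ∈ D
      · obtain ⟨l, hl, hl'⟩ := hXl (fun z => z - p) (by fun_prop) fun z hz h =>
          hpA ⟨sub_eq_zero.1 h ▸ hz, hpD⟩
        obtain ⟨m, hm, hm'⟩ := hYl (fun z => z - p) (by fun_prop) fun z hz h =>
          hpB ⟨sub_eq_zero.1 h ▸ hz, hpD⟩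
        rw [wind_eq_sub α hαX hl hl', wind_eq_sub β hβY hm hm']
        have := log_sub_const hCp (hl.mono fun z hz => (hCX hz).1)
          (hm.mono fun z hz => (hCX hz).2)
          (fun z hz => (hl' z (hCX hz).1).trans (hm' z (hCX hz).2).symm) c.2 c'.2
        linear_combination -this
      · obtain ⟨l, hl, hl'⟩ := exists_log_sub_closedBall hpD
        rw [wind_eq_sub α hαD hl hl', wind_eq_sub β hβD hl hl'])
  set K := connectedComponentIn (X ∩ D ∩ (Y ∩ D)) (c : ℂ)
  have hKsub : K ⊆ X ∩ D ∩ (Y ∩ D) := connectedComponentIn_subset _ _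
  have hcK : (c : ℂ) ∈ K := mem_connectedComponentIn
    ⟨⟨hc.1, Metric.mem_closedBall_self (half_pos hε).le⟩,
      hc.2, Metric.mem_closedBall_self (half_pos hε).le⟩
  have hKp : IsPreconnected K := isPreconnected_connectedComponentIn
  have hKC : K ⊆ C := by
    have hcx : (c : ℂ) ∈ connectedComponentIn (X ∩ Y) x := by rw [← hC]; exact c.2
    rw [hC, connectedComponentIn_eq hcx]
    exact hKp.subset_connectedComponentIn hcK fun z hz => ⟨(hKsub hz).1.1, (hKsub hz).2.1⟩
  refine ⟨Subtype.val ⁻¹' K, ?_, hcK, hmem, fun z hz => ?_⟩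
  · rw [← Topology.IsInducing.subtypeVal.isPreconnected_image, Subtype.image_preimage_coe,
      inter_eq_right.2 hKC]
    exact hKp
  · have := (hKsub hz).1.2
    exact (Metric.mem_closedBall.1 this).trans_lt (half_lt_self hε)

end IntersectionComponent

section ModifiedDifference

open Complex

lemma exists_plog_div {α β : Type*} [TopologicalSpace α] [TopologicalSpace β] {P : Set α}
    {Q : Set β} (hQ : IsCompact Q) (hQ' : IsPreconnected Q) {q₀ : β} (hq₀ : q₀ ∈ Q) {u : α × β → ℂ}
    (hu : ContinuousOn u (P ×ˢ Q)) (h0 : ∀ x ∈ P ×ˢ Q, u x ≠ 0)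
    (hl : ∀ p ∈ P, ∃ l : β → ℂ, ContinuousOn l Q ∧ ∀ q ∈ Q, exp (l q) = u (p, q)) :
    ∃ l : α × β → ℂ, ContinuousOn l (P ×ˢ Q) ∧
      (∀ p ∈ P, ∀ q ∈ Q, exp (l (p, q)) = u (p, q) / u (p, q₀)) ∧ ∀ p ∈ P, l (p, q₀) = 0 := by
  have hb : ContinuousOn (fun x : α × β => u (x.1, q₀)) (P ×ˢ Q) :=
    hu.comp (by fun_prop) fun x hx => ⟨hx.1, hq₀⟩
  obtain ⟨l, h1, h2, h3⟩ := exists_plog (P := P) hQ hQ' hq₀ (u := fun x => u x / u (x.1, q₀))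
    (hu.div hb fun x hx => h0 _ ⟨hx.1, hq₀⟩)
    (fun x hx => div_ne_zero (h0 _ hx) (h0 _ ⟨hx.1, hq₀⟩))
    (fun p hp => div_self (h0 _ ⟨hp, hq₀⟩))
    (fun p hp => by
      obtain ⟨l, hl, hl'⟩ := hl p hp
      exact ⟨fun q => l q - l q₀, hl.sub continuousOn_const, fun q hq => by
        rw [exp_sub, hl' q hq, hl' q₀ hq₀]⟩)
  exact ⟨l, h1, fun p hp q hq => h2 _ ⟨hp, hq⟩, h3⟩

lemma exists_plog_interval {α : Type*} [TopologicalSpace α] {P : Set α} (t₀ : unitInterval)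
    {u : α × unitInterval → ℂ} (hu : ContinuousOn u (P ×ˢ univ))
    (h0 : ∀ p ∈ P, ∀ t, u (p, t) ≠ 0) :
    ∃ l : α × unitInterval → ℂ, ContinuousOn l (P ×ˢ univ) ∧
      (∀ p ∈ P, ∀ t, exp (l (p, t)) = u (p, t) / u (p, t₀)) ∧ ∀ p ∈ P, l (p, t₀) = 0 := by
  obtain ⟨l, h1, h2, h3⟩ := exists_plog_div isCompact_univ isPreconnected_univ (mem_univ t₀) hu
    (fun x hx => h0 x.1 hx.1 x.2) fun p hp => by
      obtain ⟨l, hl, hl'⟩ := exists_log_interval (u := fun t => u (p, t))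
        (hu.comp_continuous (by fun_prop) fun t => ⟨hp, mem_univ _⟩) (h0 p hp)
      exact ⟨l, hl.continuousOn, fun t _ => hl' t⟩
  exact ⟨l, h1, fun p hp t => h2 p hp t (mem_univ t), h3⟩

variable {X Y C : Set ℂ} {q₀ : ℂ}

lemma exists_log_sub_component (hXp : ∀ a ∈ X, ∀ b ∈ X, JoinedIn X a b) (hYl : HasLogarithms Y)
    (hCc : IsClosed C) (hC : C = connectedComponentIn (X ∩ Y) q₀) (hq₀ : q₀ ∈ C) {p : ℂ}
    (hp : p ∈ X \ C) : ∃ l : ℂ → ℂ, ContinuousOn l C ∧ ∀ z ∈ C, exp (l z) = z - p := by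
  have hCX : C ⊆ X ∩ Y := hC ▸ connectedComponentIn_subset _ _
  obtain ⟨γ, hγ⟩ := hXp p hp.1 q₀ (hCX hq₀).1
  have hT : IsCompact (γ ⁻¹' C) := (hCc.preimage γ.continuous).isCompact
  obtain ⟨τ, hτ, hmin⟩ := hT.exists_isLeast ⟨1, by simpa using hq₀⟩
  obtain ⟨s, hs, hsY⟩ : ∃ s < τ, γ s ∉ Y := by
    by_contra! hcon
    have hsub : γ '' Icc 0 τ ⊆ X ∩ Y := by
      rintro _ ⟨t, ht, rfl⟩
      refine ⟨hγ t, ?_⟩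
      rcases ht.2.lt_or_eq with h | rfl
      · exact hcon t h
      · exact (hCX hτ).2
    have hτ' : γ τ ∈ connectedComponentIn (X ∩ Y) q₀ := hC ▸ hτ
    have := (isPreconnected_Icc.image γ γ.continuous.continuousOn).subset_connectedComponentIn
      (mem_image_of_mem γ (right_mem_Icc.2 τ.2.1)) hsub
    rw [← connectedComponentIn_eq hτ', ← hC] at this
    exact hp.2 (by simpa using this (mem_image_of_mem γ (left_mem_Icc.2 τ.2.1)))
  have hne : ∀ z ∈ C, ∀ t : unitInterval, γ (s * t) - z ≠ 0 := fun z hz t h => by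
    rw [sub_eq_zero] at h
    have h1 : τ ≤ s * t := hmin (show γ (s * t) ∈ C from h ▸ hz)
    exact absurd (h1.trans unitInterval.mul_le_left) (not_le.2 hs)
  obtain ⟨l, hl, hl', -⟩ := exists_plog_interval (P := C) 1
    (u := fun x => γ (s * x.2) - x.1) (by fun_prop) hne
  obtain ⟨m, hm, hm'⟩ := hYl (fun z => z - γ s) (by fun_prop) fun z hz h =>
    hsY (sub_eq_zero.1 h ▸ hz)
  refine ⟨fun z => l (z, 0) + m z, ContinuousOn.add (hl.comp (by fun_prop) fun z hz =>
    ⟨hz, mem_univ _⟩) (hm.mono fun z hz => (hCX hz).2), fun z hz => ?_⟩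
  have h1 := hne z hz 1
  rw [exp_add, hl' z hz, hm' z (hCX hz).2]
  simp only [mul_one, mul_zero, Path.source] at h1 ⊢
  field_simp
  ring

/-- A compact set disjoint from a component is separated from it by a clopen partition. -/
lemma exists_closed_partition {K B : Set ℂ} (hK : IsCompact K) (hB : IsClosed B)
    (hC : C = connectedComponentIn K q₀) (hq₀ : q₀ ∈ C) (hBC : Disjoint B C) :
    ∃ U V : Set ℂ, IsClosed U ∧ IsClosed V ∧ Disjoint U V ∧ U ∪ V = K ∧ C ⊆ U ∧ Disjoint B U := by
  have hqK : q₀ ∈ K := connectedComponentIn_subset _ _ (hC ▸ hq₀)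
  have : CompactSpace K := isCompact_iff_compactSpace.1 hK
  rw [connectedComponentIn_eq_image hqK, connectedComponent_eq_iInter_isClopen] at hC
  have hemp : (Subtype.val ⁻¹' B : Set K) ∩ ⋂ s : { s : Set K // IsClopen s ∧ ⟨q₀, hqK⟩ ∈ s }, s.1
      = ∅ := by
    rw [eq_empty_iff_forall_notMem]
    rintro z ⟨hzB, hz⟩
    exact hBC.le_bot ⟨hzB, hC ▸ ⟨z, hz, rfl⟩⟩
  obtain ⟨F, hF⟩ := (hB.preimage continuous_subtype_val).isCompact.elim_finite_subfamily_closed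
    (fun s : { s : Set K // IsClopen s ∧ ⟨q₀, hqK⟩ ∈ s } => s.1) (fun s => s.2.1.isClosed) hemp
  set U : Set K := ⋂ s ∈ F, s.1
  have hU : IsClopen U := isClopen_biInter_finset fun s _ => s.2.1
  refine ⟨Subtype.val '' U, Subtype.val '' Uᶜ,
    (hU.isClosed.isCompact.image continuous_subtype_val).isClosed,
    (hU.compl.isClosed.isCompact.image continuous_subtype_val).isClosed,
    (disjoint_image_iff Subtype.val_injective).2 disjoint_compl_right, ?_, ?_, ?_⟩
  · rw [← image_union, union_compl_self, image_univ, Subtype.range_coe]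
  · rw [hC]
    exact image_mono (subset_iInter₂ fun s _ => iInter_subset _ s)
  · rw [Set.disjoint_left]
    rintro _ hzB ⟨z, hz, rfl⟩
    exact (eq_empty_iff_forall_notMem.1 hF) z ⟨hzB, hz⟩

/-- The difference `q - p` on `X × Y` can be modified away from the component `C` of `X ∩ Y` so that
its only zeros are the points `(p, p)` with `p` close to `C`. -/
theorem exists_modified_difference (hX : IsCompact X) (hY : IsCompact Y)
    (hXp : ∀ a ∈ X, ∀ b ∈ X, JoinedIn X a b) (hYp : IsPreconnected Y) (hYl : HasLogarithms Y)
    (hC : C = connectedComponentIn (X ∩ Y) q₀) (hCc : IsCompact C) (hq₀ : q₀ ∈ C) {B : Set ℂ}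
    (hB : IsClosed B) (hBC : Disjoint B C) :
    ∃ G m : ℂ × ℂ → ℂ, ContinuousOn G (X ×ˢ Y) ∧ ContinuousOn m (X ×ˢ C) ∧
      (∀ p ∈ X, ∀ q ∈ Y, (p = q → p ∈ B) → G (p, q) ≠ 0) ∧
      (∀ p ∈ C, ∀ q ∈ Y, G (p, q) = q - p) ∧
      (∀ p ∈ X, ∀ q ∈ C, G (p, q) = (q - p) * exp (m (p, q))) ∧
      ∀ p ∈ C, ∀ q ∈ C, m (p, q) = 0 := by
  have hCX : C ⊆ X ∩ Y := hC ▸ connectedComponentIn_subset _ _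
  have hCp : IsPreconnected C := hC ▸ isPreconnected_connectedComponentIn
  obtain ⟨U, V, hU, hV, hUV, hUVK, hCU, hBU⟩ :=
    exists_closed_partition (hX.inter hY) hB hC hq₀ hBC
  obtain ⟨χ, hχ, hχ1, hχ0⟩ := exists_cutoff hU hV hUV
  have hsub : ∀ {A : Set ℂ} {p q : ℂ}, p ∉ A → q ∈ A → q - p ≠ 0 := fun hp hq h =>
    hp (sub_eq_zero.1 h ▸ hq)
  obtain ⟨l, hl, hle, hl0⟩ := exists_plog_div (P := X \ Y) hY hYp (hCX hq₀).2
    (u := fun x => x.2 - x.1) (by fun_prop) (fun x hx => hsub hx.1.2 hx.2)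
    (fun p hp => hYl _ (by fun_prop) fun z hz => hsub hp.2 hz)
  obtain ⟨k, hk, hke, hk0⟩ := exists_plog_div (P := X \ C) hCc hCp hq₀
    (u := fun x => x.2 - x.1) (by fun_prop) (fun x hx => hsub hx.1.2 hx.2)
    (fun p hp => exists_log_sub_component hXp hYl hCc.isClosed hC hq₀ hp)
  have hlk : ∀ p ∈ X \ Y, ∀ q ∈ C, l (p, q) = k (p, q) := by
    intro p hp q hq
    have hp' : p ∈ X \ C := ⟨hp.1, fun h => hp.2 (hCX h).2⟩
    have h1 : ContinuousOn (fun q => l (p, q)) C := hl.comp (by fun_prop)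
      fun q hq => ⟨hp, (hCX hq).2⟩
    have h2 : ContinuousOn (fun q => k (p, q)) C := hk.comp (by fun_prop) fun q hq => ⟨hp', hq⟩
    have := log_sub_const hCp h1 h2 (fun q hq => by
      rw [hle p hp q (hCX hq).2, hke p hp' q hq]) hq hq₀
    rw [hl0 p hp, hk0 p hp'] at this
    linear_combination this
  set G : ℂ × ℂ → ℂ := fun x => if χ x.1 = 1 then x.2 - x.1 else
    if χ x.1 = 0 then q₀ - x.1 else (q₀ - x.1) * exp (χ x.1 * l x) with hG
  have hG1 : ∀ p q, χ p = 1 → G (p, q) = q - p := fun p q h => by simp [hG, h]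
  have hG0 : ∀ p q, χ p = 0 → G (p, q) = q₀ - p := fun p q h => by simp [hG, h]
  have hGl : ∀ p ∈ X \ Y, ∀ q ∈ Y, G (p, q) = (q₀ - p) * exp (χ p * l (p, q)) := by
    intro p hp q hq
    have hne : q₀ - p ≠ 0 := hsub hp.2 (hCX hq₀).2
    simp only [hG]
    split_ifs with h h'
    · rw [h, ofReal_one, one_mul, hle p hp q hq, mul_div_cancel₀ _ hne]
    · simp [h']
    · rfl
  have hcase : ∀ p ∈ X, p ∈ U ∨ p ∈ V ∨ p ∈ X \ Y := by
    intro p hp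
    by_cases hpY : p ∈ Y
    · have : p ∈ U ∪ V := hUVK ▸ ⟨hp, hpY⟩
      exact this.imp id Or.inl
    · exact Or.inr (Or.inr ⟨hp, hpY⟩)
  have hfst : ∀ {x : ℂ × ℂ} {c : ℝ}, χ =ᶠ[𝓝 x.1] (fun _ => c) →
      ∀ᶠ y in 𝓝 x, χ y.1 = c := fun h => continuous_fst.continuousAt.eventually h
  refine ⟨G, fun x => -((1 - χ x.1) * k x), ?_, ?_, ?_, ?_, ?_, ?_⟩
  · intro x hx
    rcases hcase x.1 hx.1 with h | h | h
    · refine ContinuousAt.continuousWithinAt ?_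
      refine (by fun_prop : Continuous fun x : ℂ × ℂ => x.2 - x.1).continuousAt.congr ?_
      filter_upwards [hfst (c := 1) (hχ1 _ h)] with y hy using (hG1 _ _ hy).symm
    · refine ContinuousAt.continuousWithinAt ?_
      refine (by fun_prop : Continuous fun x : ℂ × ℂ => q₀ - x.1).continuousAt.congr ?_
      filter_upwards [hfst (c := 0) (hχ0 _ h)] with y hy using (hG0 _ _ hy).symm
    · have h1 : ContinuousOn (fun x : ℂ × ℂ => (q₀ - x.1) * exp (χ x.1 * l x)) ((X \ Y) ×ˢ Y) := by
        fun_prop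
      have h2 : ContinuousWithinAt G ((X \ Y) ×ˢ Y) x :=
        (h1.congr fun y hy => hGl y.1 hy.1 y.2 hy.2) x ⟨h, hx.2⟩
      refine h2.mono_of_mem_nhdsWithin ?_
      rw [mem_nhdsWithin]
      exact ⟨Yᶜ ×ˢ univ, hY.isClosed.isOpen_compl.prod isOpen_univ, ⟨h.2, mem_univ _⟩,
        fun y hy => ⟨⟨hy.2.1, hy.1.1⟩, hy.2.2⟩⟩
  · intro x hx
    by_cases h : x.1 ∈ C
    · refine ContinuousAt.continuousWithinAt ?_
      refine (continuousAt_const (y := (0 : ℂ))).congr ?_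
      filter_upwards [hfst (c := 1) (hχ1 _ (hCU h))] with y hy
      simp [hy]
    · have h1 : ContinuousOn (fun x : ℂ × ℂ => -((1 - χ x.1) * k x)) ((X \ C) ×ˢ C) := by
        fun_prop
      refine (h1 x ⟨⟨hx.1, h⟩, hx.2⟩).mono_of_mem_nhdsWithin ?_
      rw [mem_nhdsWithin]
      exact ⟨Cᶜ ×ˢ univ, hCc.isClosed.isOpen_compl.prod isOpen_univ, ⟨h, mem_univ _⟩,
        fun y hy => ⟨⟨hy.2.1, hy.1.1⟩, hy.2.2⟩⟩
  · intro p hp q hq hpq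
    rcases hcase p hp with h | h | h
    · rw [hG1 _ _ (hχ1 p h).self_of_nhds, sub_ne_zero]
      exact fun h' => hBU.le_bot ⟨hpq h'.symm, h⟩
    · rw [hG0 _ _ (hχ0 p h).self_of_nhds]
      exact hsub (fun hpU => hUV.le_bot ⟨hpU, h⟩) (hCU hq₀)
    · rw [hGl p h q hq]
      exact mul_ne_zero (hsub h.2 (hCX hq₀).2) (exp_ne_zero _)
  · exact fun p hp q _ => hG1 _ _ (hχ1 p (hCU hp)).self_of_nhds
  · intro p hp q hq
    have hk' : p ∉ C → (q - p) * exp (-k (p, q)) = q₀ - p := fun h => by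
      have := hsub h hq
      rw [exp_neg, hke p ⟨hp, h⟩ q hq]
      field_simp [hsub h hq₀]
    rcases hcase p hp with h | h | h
    · have h1 : χ p = 1 := (hχ1 p h).self_of_nhds
      simp [hG1 _ _ h1, h1]
    · have h1 : χ p = 0 := (hχ0 p h).self_of_nhds
      simp [hG0 _ _ h1, h1, hk' fun hpC => hUV.le_bot ⟨hCU hpC, h⟩]
    · rw [hGl p h q (hCX hq).2, ← hk' fun hpC => h.2 (hCX hpC).2, mul_assoc, ← exp_add,
        hlk p h q hq]
      ring_nf
  · intro p hp q _
    simp [show χ p = 1 from (hχ1 p (hCU hp)).self_of_nhds]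

end ModifiedDifference

section Construction

open Complex

lemma exists_isotopy_log {X : Set ℂ} {f : ℂ → ℂ} {H : ℝ → ℂ → ℂ}
    (hH : ContinuousOn (fun x : ℝ × ℂ => H x.1 x.2) (Icc 0 1 ×ˢ X)) (hH0 : ∀ p ∈ X, H 0 p = p)
    (hH1 : ∀ p ∈ X, H 1 p = f p) (hinj : ∀ t ∈ Icc (0 : ℝ) 1, InjOn (H t) X) :
    ∃ L : ℂ → ℂ → ℂ, ContinuousOn (fun x : ℂ × ℂ => L x.1 x.2) ((X ×ˢ X) ∩ {x | x.1 ≠ x.2}) ∧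
      (∀ p ∈ X, ∀ q ∈ X, p ≠ q → L p q = L q p) ∧
      ∀ p ∈ X, ∀ q ∈ X, p ≠ q → (q - p) * exp (L p q) = f q - f p := by
  set P : Set (ℂ × ℂ) := (X ×ˢ X) ∩ {x | x.1 ≠ x.2}
  set u : (ℂ × ℂ) × unitInterval → ℂ := fun x => H x.2 x.1.2 - H x.2 x.1.1 with hu
  have huc : ContinuousOn u (P ×ˢ univ) := by
    refine ContinuousOn.sub (hH.comp (f := fun x : (ℂ × ℂ) × unitInterval => ((x.2 : ℝ), x.1.2))
      (by fun_prop) fun x hx => ?_) (hH.comp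
      (f := fun x : (ℂ × ℂ) × unitInterval => ((x.2 : ℝ), x.1.1)) (by fun_prop) fun x hx => ?_)
    · exact ⟨x.2.2, hx.1.1.2⟩
    · exact ⟨x.2.2, hx.1.1.1⟩
  have hu0 : ∀ p ∈ P, ∀ t, u (p, t) ≠ 0 := fun p hp t h =>
    hp.2 (hinj t t.2 hp.1.1 hp.1.2 (sub_eq_zero.1 h).symm)
  obtain ⟨l, hl, hle, hl0⟩ := exists_plog_interval 0 huc hu0
  refine ⟨fun p q => l ((p, q), 1), hl.comp (by fun_prop) fun x hx => ⟨hx, mem_univ _⟩, ?_, ?_⟩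
  · intro p hp q hq hpq
    have h1 : ((p, q) : ℂ × ℂ) ∈ P := ⟨⟨hp, hq⟩, hpq⟩
    have h2 : ((q, p) : ℂ × ℂ) ∈ P := ⟨⟨hq, hp⟩, hpq.symm⟩
    have := log_sub_const (A := unitInterval) isPreconnected_univ (l := fun t => l ((p, q), t))
      (l' := fun t => l ((q, p), t)) (hl.comp (by fun_prop) fun t _ => ⟨h1, mem_univ _⟩)
      (hl.comp (by fun_prop) fun t _ => ⟨h2, mem_univ _⟩) (fun t _ => by
        rw [hle _ h1, hle _ h2, ← neg_div_neg_eq]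
        simp [hu]) (mem_univ 0) (mem_univ 1)
    rw [hl0 _ h1, hl0 _ h2] at this
    linear_combination -this
  · intro p hp q hq hpq
    have h1 : ((p, q) : ℂ × ℂ) ∈ P := ⟨⟨hp, hq⟩, hpq⟩
    have hne : q - p ≠ 0 := sub_ne_zero.2 hpq.symm
    rw [hle _ h1]
    simp only [hu, Icc.coe_one, Icc.coe_zero, hH0 p hp, hH0 q hq, hH1 p hp, hH1 q hq]
    rw [mul_div_cancel₀ _ hne]

variable {X C : Set ℂ} {f g : ℂ → ℂ} {q₀ : ℂ}

lemma wind_add_eq_of_component (hX : IsCompact X) (hf : Continuous f)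
    (hXp : ∀ a ∈ X, ∀ b ∈ X, JoinedIn X a b) (hYl : HasLogarithms (f '' X))
    (hC : C = connectedComponentIn (X ∩ f '' X) q₀) (hCc : IsCompact C) (hq₀ : q₀ ∈ C)
    {a b c d : ℂ} (r : Path a b) (w : Path c d) (hr : range r ⊆ X) (hw : range w ⊆ f '' X)
    (ha : a ∈ C) (hb : b ∈ C) (hc : c ∈ C) (hd : d ∈ C) (hrw : ∀ z ∈ range r, z ∈ range w → z ∉ C) :
    wind r c + wind w b = wind w a + wind r d := by
  have hXc : IsPreconnected X := IsPathConnected.isConnected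
    ⟨a, hr ⟨0, by simp⟩, fun {y} hy => hXp _ (hr ⟨0, by simp⟩) y hy⟩ |>.isPreconnected
  obtain ⟨G, m, hG, hm, hG0, hG1, hG2, hm0⟩ := exists_modified_difference hX (hX.image hf) hXp
    (hXc.image f hf.continuousOn) hYl hC hCc hq₀ (B := range r ∩ range w)
    ((isCompact_range r.continuous).inter (isCompact_range w.continuous)).isClosed
    (Set.disjoint_left.2 fun z hz => hrw z hz.1 hz.2)
  have hr' : ∀ t, r t ∈ X := fun t => hr ⟨t, rfl⟩
  have hw' : ∀ t, w t ∈ f '' X := fun t => hw ⟨t, rfl⟩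
  have hsq := (dlog_square (u := fun x => G (r x.1, w x.2))
    (hG.comp_continuous (by fun_prop) fun x => ⟨hr' _, hw' _⟩)
    fun x => hG0 _ (hr' _) _ (hw' _) fun h => ⟨⟨_, rfl⟩, h ▸ ⟨_, rfl⟩⟩).1
  have hside : ∀ z ∈ C, z ∈ range w → dlog (fun t => G (r t, z)) = wind r z := by
    intro z hz hzw
    have hne : ∀ t, r t ≠ z := fun t h => hrw z ⟨t, h⟩ hzw hz
    have h1 : (fun t => G (r t, z)) = fun t => (z - r t) * exp (m (r t, z)) :=
      funext fun t => hG2 _ (hr' t) z hz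
    rw [h1, dlog_mul_exp (u := fun t => z - r t) (l := fun t => m (r t, z)) (by fun_prop)
      (fun t => sub_ne_zero.2 (hne t).symm)
      (hm.comp_continuous (by fun_prop) fun t => ⟨hr' t, hz⟩), wind_swap r.continuous hne]
    simp [hm0 a ha z hz, hm0 b hb z hz]
  have hside' : ∀ z ∈ C, dlog (fun t => G (z, w t)) = wind w z := fun z hz => by
    rw [wind]
    exact congrArg dlog (funext fun t => hG1 z hz _ (hw' t))
  simp only [Path.source, Path.target] at hsq
  rw [hside' a ha, hside' b hb, hside c hc ⟨0, by simp⟩, hside d hd ⟨1, by simp⟩] at hsq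
  exact hsq.symm

theorem exists_displacementData (hX : IsCompact X) (hXp : ∀ a ∈ X, ∀ b ∈ X, JoinedIn X a b)
    (hXl : HasLogarithms X) (hf : Continuous f) (hg : Continuous g) (hgf : ∀ x ∈ X, g (f x) = x)
    {L : ℂ → ℂ → ℂ}
    (hLc : ContinuousOn (fun x : ℂ × ℂ => L x.1 x.2) ((X ×ˢ X) ∩ {x | x.1 ≠ x.2}))
    (hLs : ∀ p ∈ X, ∀ q ∈ X, p ≠ q → L p q = L q p)
    (hLe : ∀ p ∈ X, ∀ q ∈ X, p ≠ q → (q - p) * exp (L p q) = f q - f p)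
    (hC : C = connectedComponentIn (X ∩ f '' X) q₀) (hCc : IsCompact C) (hq₀ : q₀ ∈ C)
    (hfix : ∀ x ∈ C, f x ≠ x) :
    ∃ (Θ : ℂ → ℂ) (κ : ℂ), DisplacementData X C f g L Θ κ := by
  have hCX : C ⊆ X ∩ f '' X := hC ▸ connectedComponentIn_subset _ _
  have hCp : IsPreconnected C := hC ▸ isPreconnected_connectedComponentIn
  have hYl : HasLogarithms (f '' X) := hXl.image hf.continuousOn hg.continuousOn hgf
  have hXc : IsPreconnected X := IsPathConnected.isConnected
    ⟨q₀, (hCX hq₀).1, fun {y} hy => hXp _ (hCX hq₀).1 y hy⟩ |>.isPreconnected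
  have hfX : ∀ z ∈ X, f z ∈ f '' X := fun z => mem_image_of_mem f
  obtain ⟨G, m, hG, hm, hG0, hG1, hG2, hm0⟩ := exists_modified_difference hX (hX.image hf) hXp
    (hXc.image f hf.continuousOn) hYl hC hCc hq₀ (B := {z | f z = z})
    (isClosed_eq hf continuous_id) (Set.disjoint_left.2 fun z hz hzC => hfix z hzC hz)
  obtain ⟨Θ, hΘ, hΘe⟩ := hXl (fun z => G (z, f z)) (hG.comp (by fun_prop) fun z hz =>
    ⟨hz, hfX z hz⟩) fun z hz => hG0 z hz _ (hfX z hz) fun h => h.symm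
  have hΘC : ∀ z ∈ C, exp (Θ z) = f z - z := fun z hz => by
    rw [hΘe z (hCX hz).1, hG1 z hz _ (hfX z (hCX hz).1)]
  have hgX : ∀ z ∈ C, g z ∈ X ∧ f (g z) = z := by
    intro z hz
    obtain ⟨x, hx, rfl⟩ := (hCX hz).2
    rw [hgf x hx]
    exact ⟨hx, rfl⟩
  have hgne : ∀ z ∈ C, g z ≠ z := fun z hz h => hfix z hz (by
    have := (hgX z hz).2
    rwa [h] at this)
  set D : ℂ → ℂ := fun z => L (g z) z - Θ z + Θ (g z) - m (g z, z) with hD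
  have hDc : ContinuousOn D C := by
    refine ((ContinuousOn.sub ?_ (hΘ.mono fun z hz => (hCX hz).1)).add
      (hΘ.comp hg.continuousOn fun z hz => (hgX z hz).1)).sub
      (hm.comp (by fun_prop) fun z hz => ⟨(hgX z hz).1, hz⟩)
    exact hLc.comp (f := fun z => (g z, z)) (by fun_prop)
      fun z hz => ⟨⟨(hgX z hz).1, (hCX hz).1⟩, hgne z hz⟩
  have hDe : ∀ z ∈ C, exp (D z) = 1 := by
    intro z hz
    have hne : z - g z ≠ 0 := sub_ne_zero.2 (hgne z hz).symm
    have hne' : f z - z ≠ 0 := sub_ne_zero.2 (hfix z hz)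
    have h1 := hLe (g z) (hgX z hz).1 z (hCX hz).1 (hgne z hz)
    have h2 : exp (Θ (g z)) = (z - g z) * exp (m (g z, z)) := by
      rw [hΘe _ (hgX z hz).1, (hgX z hz).2, hG2 _ (hgX z hz).1 z hz]
    have h3 := exp_ne_zero (m (g z, z))
    rw [(hgX z hz).2] at h1
    simp only [hD]
    rw [exp_sub, exp_add, exp_sub, h2, hΘC z hz, ← h1]
    have h4 := exp_ne_zero (L (g z) z)
    field_simp
  have hDconst : ∀ z ∈ C, D z = D q₀ := fun z hz => by
    have := log_sub_const hCp hDc (l' := fun _ => 0) continuousOn_const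
      (fun z hz => by rw [hDe z hz, exp_zero]) hz hq₀
    simpa using this
  refine ⟨Θ, D q₀, hf, hg, hgf, fun z hz => (hCX hz).1, fun z hz => (hCX hz).2, hfix, hLs, ?_, hLe,
    hΘ.mono fun z hz => (hCX hz).1, hΘC, ?_, hDe q₀ hq₀,
    fun r w => wind_add_eq_of_component hX hf hXp hYl hC hCc hq₀ r w⟩
  · intro p hp
    exact hLc.comp (f := fun q => (p, q)) (by fun_prop) fun q hq => ⟨⟨hp, hq.1⟩, fun h => hq.2 h.symm⟩
  · intro p hp hfp
    rw [← hDconst _ hfp]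
    simp only [hD, hgf p (hCX hp).1, hm0 p hp _ hfp]
    ring

end Construction

section Recurrence

lemma exists_continuous_extension {X : Set ℂ} (hX : IsCompact X) {f : ℂ → ℂ}
    (hf : ContinuousOn f X) (hinj : InjOn f X) :
    ∃ F G : ℂ → ℂ, Continuous F ∧ Continuous G ∧ EqOn F f X ∧ ∀ x ∈ X, G (F x) = x := by
  have : CompactSpace X := isCompact_iff_compactSpace.1 hX
  obtain ⟨F, hF⟩ := ContinuousMap.exists_restrict_eq hX.isClosed ⟨X.domRestrict f, hf.domRestrict⟩
  have hF' : EqOn F f X := fun x hx => congrArg (fun φ : C(X, ℂ) => φ ⟨x, hx⟩) hF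
  have hemb : IsClosedEmbedding fun x : X => F x :=
    (F.continuous.comp continuous_subtype_val).isClosedEmbedding fun x y hxy =>
      Subtype.ext (hinj x.2 y.2 (by rw [← hF' x.2, ← hF' y.2]; exact hxy))
  obtain ⟨G, hG⟩ := ContinuousMap.exists_extension hemb
    (⟨Subtype.val, continuous_subtype_val⟩ : C(X, ℂ))
  exact ⟨F, G, F.continuous, G.continuous, hF',
    fun x hx => congrArg (fun φ : C(X, ℂ) => φ ⟨x, hx⟩) hG⟩

/-- The homeomorphism from a set to its image induced by a map with a continuous left inverse. -/
def homeomorphImage {X : Set ℂ} {f g : ℂ → ℂ} (hf : Continuous f) (hg : Continuous g)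
    (h : ∀ x ∈ X, g (f x) = x) : X ≃ₜ f '' X where
  toFun x := ⟨f x, mem_image_of_mem f x.2⟩
  invFun y := ⟨g y, by obtain ⟨_, x, hx, rfl⟩ := y; rwa [h x hx]⟩
  left_inv x := Subtype.ext (h x x.2)
  right_inv := by rintro ⟨_, x, hx, rfl⟩; exact Subtype.ext (congrArg f (h x hx))
  continuous_toFun := by fun_prop
  continuous_invFun := by fun_prop

/-- The absence of recurrent points, for subsets of the complex plane. -/
theorem not_recurrent_complex {X C : Set ℂ} {f : ℂ → ℂ} (hX : IsCompact X) [SimplyConnectedSpace X]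
    [LocallyConnectedSpace X] (hfc : ContinuousOn f X) (hinj : InjOn f X) {H : ℝ → ℂ → ℂ}
    (hH : ContinuousOn (fun x : ℝ × ℂ => H x.1 x.2) (Icc 0 1 ×ˢ X)) (hH0 : ∀ p ∈ X, H 0 p = p)
    (hH1 : ∀ p ∈ X, H 1 p = f p) (hHinj : ∀ t ∈ Icc (0 : ℝ) 1, InjOn (H t) X) {q₀ : ℂ}
    (hC : C = connectedComponentIn (X ∩ f '' X) q₀) (hfix : ∀ x ∈ C, f x ≠ x) {x : ℂ}
    (horb : ∀ n, f^[n] x ∈ C) : ¬ ∀ δ > 0, ∃ n, 1 ≤ n ∧ dist x (f^[n] x) < δ := by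
  intro hrec
  obtain ⟨F, G, hF, hG, hFf, hGF⟩ := exists_continuous_extension hX hfc hinj
  have himg : F '' X = f '' X := hFf.image_eq
  have hxC : x ∈ C := horb 0
  have hC' : C = connectedComponentIn (X ∩ F '' X) x := by
    rw [himg, hC]
    exact connectedComponentIn_eq (hC ▸ hxC)
  have hCX : C ⊆ X ∩ F '' X := hC' ▸ connectedComponentIn_subset _ _
  have hCp : IsPreconnected C := hC' ▸ isPreconnected_connectedComponentIn
  have hY : IsCompact (F '' X) := hX.image hF
  have hCc : IsCompact C := by
    have hK : IsCompact (X ∩ F '' X) := hX.inter hY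
    have : CompactSpace ↥(X ∩ F '' X) := isCompact_iff_compactSpace.1 hK
    rw [hC', connectedComponentIn_eq_image (hCX hxC)]
    exact isClosed_connectedComponent.isCompact.image continuous_subtype_val
  have : CompactSpace X := isCompact_iff_compactSpace.1 hX
  have : CompactSpace (F '' X) := isCompact_iff_compactSpace.1 hY
  have : CompactSpace C := isCompact_iff_compactSpace.1 hCc
  have : LocallyConnectedSpace (F '' X) :=
    (homeomorphImage hF hG hGF).symm.isOpenEmbedding.locallyConnectedSpace
  have hXu : UniformlyLocallyConnected X := uniformlyLocallyConnected_of_compact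
  have hYu : UniformlyLocallyConnected (F '' X) := uniformlyLocallyConnected_of_compact
  have := hXu.locallyPathConnectedSpace
  have hXl : HasLogarithms X := hasLogarithms_of_subtype
  have hXp : ∀ a ∈ X, ∀ b ∈ X, JoinedIn X a b := (isPathConnected_iff.1
    (isPathConnected_iff_pathConnectedSpace.2 inferInstance)).2
  have hCu : UniformlyLocallyConnected C := uniformlyLocallyConnected_component hX hY hXl
    (hXl.image hF.continuousOn hG.continuousOn hGF) hXu hYu hC'
  have hFfix : ∀ z ∈ C, F z ≠ z := fun z hz => by
    rw [hFf (hCX hz).1]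
    exact hfix z hz
  have hiter : ∀ n, F^[n] x = f^[n] x := by
    intro n
    induction n with
    | zero => rfl
    | succ n ih => rw [Function.iterate_succ_apply', ih, hFf (hCX (horb n)).1,
        Function.iterate_succ_apply']
  obtain ⟨L, hLc, hLs, hLe⟩ := exists_isotopy_log (f := F) hH hH0
    (fun p hp => (hH1 p hp).trans (hFf hp).symm) hHinj
  obtain ⟨Θ, κ, hD⟩ := exists_displacementData hX hXp hXl hF hG hGF hLc hLs hLe hC' hCc hxC hFfix
  have hpath : ∀ a ∈ C, ∀ b ∈ C, ∃ γ : Path a b, range γ ⊆ C := by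
    have := hCu.locallyPathConnectedSpace
    have : ConnectedSpace C := isConnected_iff_connectedSpace.1 ⟨⟨x, hxC⟩, hCp⟩
    have : PathConnectedSpace C := pathConnectedSpace_iff_connectedSpace.2 inferInstance
    intro a ha b hb
    obtain ⟨γ, hγ⟩ := (isPathConnected_iff_pathConnectedSpace.2 this).joinedIn a ha b hb
    exact ⟨γ, by rintro _ ⟨t, rfl⟩; exact hγ t⟩
  obtain ⟨n, hn⟩ := exists_hasCycle (C := C) hF
    (fun a ha b hb h => hD.injOn (hCX ha).1 (hCX hb).1 h) hFfix (x := x)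
    (fun n => hiter n ▸ horb n) (fun ε hε => by
      obtain ⟨δ, hδ, h⟩ := hCu.exists_joinedIn hCc hε
      exact ⟨δ, hδ, h x hxC⟩) (fun δ hδ => by
      obtain ⟨n, hn, h⟩ := hrec δ hδ
      exact ⟨n, hn, by rwa [hiter]⟩)
  exact hD.not_hasCycle hpath n hn

end Recurrence

/-- If `f` has no fixed point in a connected component `C` of `X ∩ Y`,
then `f` has no recurrent point in `C`: there is no `x ∈ C` whose full forward orbit
stays in `C` and which is an accumulation point of its own forward orbit. -/
theorem no_recurrent_point (X Y C : Set Plane) (f : Plane → Plane)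
    (hXcomp : IsCompact X)
    (hXsc : SimplyConnectedSpace ↥X)
    (hXlc : LocallyConnectedSpace ↥X)
    (hf : IsHomeoOnto f X Y)
    (hiso : IsotopicToIdOn f X)
    (hC : ∃ x ∈ X ∩ Y, C = connectedComponentIn (X ∩ Y) x)
    (hfix : ∀ p ∈ C, f p ≠ p) :
    ¬ ∃ x ∈ C, (∀ n : ℕ, f^[n] x ∈ C) ∧
      ∃ nk : ℕ → ℕ, StrictMono nk ∧
        Filter.Tendsto (fun k => f^[nk k] x) Filter.atTop (nhds x) := by
  rintro ⟨x, -, horb, nk, hnk, hlim⟩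
  obtain ⟨q, hq, rfl⟩ := hC
  obtain ⟨hfc, hinj, rfl⟩ := hf
  obtain ⟨H, hH, hH0, hH1, hHinj⟩ := hiso
  set e : Plane ≃ₜ ℂ := Complex.orthonormalBasisOneI.repr.symm.toHomeomorph with he
  have : SimplyConnectedSpace (e '' X) :=
    (e.image X).symm.toHomotopyEquiv.simplyConnectedSpace
  have : LocallyConnectedSpace (e '' X) := (e.image X).symm.isOpenEmbedding.locallyConnectedSpace
  have hmaps : ∀ z ∈ e '' X, e.symm z ∈ X := by
    rintro _ ⟨y, hy, rfl⟩
    simpa using hy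
  have hconj : ∀ n, (e ∘ f ∘ e.symm)^[n] (e x) = e (f^[n] x) := by
    intro n
    induction n with
    | zero => rfl
    | succ n ih => rw [Function.iterate_succ_apply', ih, Function.iterate_succ_apply']; simp
  have himg : (e ∘ f ∘ e.symm) '' (e '' X) = e '' (f '' X) := by
    simp only [image_image, Function.comp_apply, e.symm_apply_apply]
  refine not_recurrent_complex (X := e '' X) (C := e '' connectedComponentIn (X ∩ f '' X) q)
    (f := e ∘ f ∘ e.symm) (H := fun t z => e (H t (e.symm z))) (q₀ := e q) (x := e x)
    (hXcomp.image e.continuous) ?_ ?_ ?_ ?_ ?_ ?_ ?_ ?_ ?_ ?_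
  · exact e.continuous.comp_continuousOn (hfc.comp e.symm.continuous.continuousOn hmaps)
  · exact fun a ha b hb h => e.symm.injective (hinj (hmaps a ha) (hmaps b hb) (e.injective h))
  · exact e.continuous.comp_continuousOn (hH.comp (f := fun p : ℝ × ℂ => (p.1, e.symm p.2))
      (by fun_prop) fun p hp => ⟨hp.1, hmaps _ hp.2⟩)
  · intro p hp
    simp [hH0 _ (hmaps p hp)]
  · intro p hp
    simp [hH1 _ (hmaps p hp)]
  · exact fun t ht a ha b hb h => e.symm.injective (hHinj t ht (hmaps a ha) (hmaps b hb)
      (e.injective h))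
  · rw [himg, ← image_inter e.injective, e.image_connectedComponentIn hq]
  · rintro _ ⟨p, hp, rfl⟩ h
    exact hfix p hp (e.injective (by simpa using h))
  · intro n
    rw [hconj]
    exact mem_image_of_mem e (horb n)
  · intro δ hδ
    have hlim' : Tendsto (fun k => e (f^[nk k] x)) atTop (𝓝 (e x)) :=
      (e.continuous.tendsto x).comp hlim
    obtain ⟨k, hk, hk1⟩ := ((hlim'.eventually (Metric.ball_mem_nhds (e x) hδ)).and
      (eventually_ge_atTop 1)).exists
    refine ⟨nk k, hk1.trans (hnk.id_le k), ?_⟩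
    rw [hconj, dist_comm]
    exact hk
end
end

section
/- Let D ⊂ ℝ² be a Jordan domain and let f : D → E ⊂ ℝ² be an orientation-preserving homeomorphism onto its image E = f(D). Assume D ∩ E is connected. If f has a periodic point, then f has a fixed point. -/
open Set Filter Topology

noncomputable section

open scoped unitInterval

/-! ### Continuous logarithms -/

/-- A homotopy of nonvanishing functions lifts along the exponential, starting from any given
logarithm of the initial function. -/
lemma exists_continuousOn_log_homotopy {X : Type*} [TopologicalSpace X] {S : Set X}
    {Φ : I × X → ℂ} {a : X → ℂ} (hΦ : ContinuousOn Φ (univ ×ˢ S))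
    (hne : ∀ t, ∀ x ∈ S, Φ (t, x) ≠ 0) (ha : ContinuousOn a S)
    (hexp : ∀ x ∈ S, Complex.exp (a x) = Φ (0, x)) :
    ∃ Λ : I × X → ℂ, ContinuousOn Λ (univ ×ˢ S) ∧
      (∀ t, ∀ x ∈ S, Complex.exp (Λ (t, x)) = Φ (t, x)) ∧ ∀ x ∈ S, Λ (0, x) = a x := by
  classical
  let H : C(I × S, {z : ℂ // z ≠ 0}) :=
    ⟨fun p => ⟨Φ (p.1, p.2), hne p.1 p.2 p.2.2⟩, by
      refine Continuous.subtype_mk ?_ _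
      exact hΦ.comp_continuous (f := fun p : I × S => (p.1, (p.2 : X))) (by fun_prop)
        fun p => ⟨mem_univ _, p.2.2⟩⟩
  let f : C(S, ℂ) := ⟨fun x => a x, continuousOn_iff_continuous_domRestrict.1 ha⟩
  have H0 : ∀ x : S, H (0, x) = ⟨Complex.exp (f x), Complex.exp_ne_zero _⟩ := fun x =>
    Subtype.ext (hexp x x.2).symm
  let G := Complex.isCoveringMap_exp.liftHomotopy H f H0
  have hG : ∀ p, Complex.exp (G p) = (H p : ℂ) := fun p =>
    congrArg Subtype.val (congrFun (Complex.isCoveringMap_exp.liftHomotopy_lifts H f H0) p)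
  have hG0 : ∀ x, G (0, x) = f x := Complex.isCoveringMap_exp.liftHomotopy_zero H f H0
  refine ⟨fun p => if h : p.2 ∈ S then G (p.1, ⟨p.2, h⟩) else 0, ?_, fun t x hx => ?_,
    fun x hx => ?_⟩
  · rw [continuousOn_iff_continuous_domRestrict]
    have : (univ ×ˢ S : Set (I × X)).domRestrict
        (fun p => if h : p.2 ∈ S then G (p.1, ⟨p.2, h⟩) else 0) =
        fun p => G (p.1.1, ⟨p.1.2, p.2.2⟩) := by
      funext p
      exact dif_pos p.2.2
    rw [this]
    fun_prop
  · simp only [hx, dif_pos]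
    exact hG _
  · simp only [hx, dif_pos]
    exact hG0 ⟨x, hx⟩

/-- A continuous function on a preconnected set with exponential one is constant. -/
lemma eq_of_exp_eq_one {X : Type*} [TopologicalSpace X] {S : Set X} (hS : IsPreconnected S)
    {f : X → ℂ} (hf : ContinuousOn f S) (h1 : ∀ x ∈ S, Complex.exp (f x) = 1) {x y : X}
    (hx : x ∈ S) (hy : y ∈ S) : f x = f y :=
  (Complex.isCoveringMap_exp.eqOn_of_comp_eqOn hS hf continuousOn_const
    (fun z hz => Subtype.ext ((h1 z hz).trans (h1 y hy).symm)) hy rfl) hx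

lemma eq_of_exp_eq_one_path {g : I → ℂ} (hg : Continuous g)
    (h1 : ∀ t, Complex.exp (g t) = 1) (s t : I) : g s = g t :=
  eq_of_exp_eq_one isPreconnected_univ hg.continuousOn (fun x _ => h1 x) (mem_univ s) (mem_univ t)

/-! ### Isotopies supported in an open set -/

/-- `h` is an isotopy of the plane starting at the identity, supported in `U`, with
inverse isotopy `k`. -/
structure IsIsotopyIn (U : Set ℂ) (h k : I × ℂ → ℂ) : Prop where
  continuous : Continuous h
  continuous_inv : Continuous k
  zero : ∀ x, h (0, x) = x
  left_inv : ∀ t x, k (t, h (t, x)) = x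
  right_inv : ∀ t x, h (t, k (t, x)) = x
  fixed : ∀ t, ∀ x ∉ U, h (t, x) = x

namespace IsIsotopyIn

variable {U : Set ℂ} {h k h' k' : I × ℂ → ℂ}

lemma inv_fixed (hh : IsIsotopyIn U h k) (t : I) {x : ℂ} (hx : x ∉ U) : k (t, x) = x := by
  conv_lhs => rw [← hh.fixed t x hx]
  exact hh.left_inv t x

lemma symm (hh : IsIsotopyIn U h k) : IsIsotopyIn U k h where
  continuous := hh.continuous_inv
  continuous_inv := hh.continuous
  zero x := by
    conv_lhs => rw [← hh.zero x]
    exact hh.left_inv 0 x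
  left_inv := hh.right_inv
  right_inv := hh.left_inv
  fixed t _ hx := hh.inv_fixed t hx

lemma comp (hh : IsIsotopyIn U h k) (hh' : IsIsotopyIn U h' k') :
    IsIsotopyIn U (fun p => h (p.1, h' p)) (fun p => k' (p.1, k p)) where
  continuous := hh.continuous.comp (continuous_fst.prodMk hh'.continuous)
  continuous_inv := hh'.continuous_inv.comp (continuous_fst.prodMk hh.continuous_inv)
  zero x := by simp [hh.zero, hh'.zero]
  left_inv t x := by simp [hh.left_inv, hh'.left_inv]
  right_inv t x := by simp [hh.right_inv, hh'.right_inv]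
  fixed t x hx := by simp [hh.fixed t x hx, hh'.fixed t x hx]

lemma mono (hh : IsIsotopyIn U h k) {V : Set ℂ} (hUV : U ⊆ V) : IsIsotopyIn V h k :=
  { hh with fixed := fun t x hx => hh.fixed t x fun hxU => hx (hUV hxU) }

lemma injective (hh : IsIsotopyIn U h k) (t : I) : Function.Injective fun x => h (t, x) :=
  Function.LeftInverse.injective (g := fun x => k (t, x)) (hh.left_inv t)

lemma mem (hh : IsIsotopyIn U h k) (t : I) {x : ℂ} (hx : x ∈ U) : h (t, x) ∈ U := by
  by_contra hn
  have h1 := hh.left_inv t x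
  rw [hh.inv_fixed t hn] at h1
  exact hn (h1.symm ▸ hx)

end IsIsotopyIn

/-- Within a ball, the centre can be pushed to any other point. -/
lemma exists_isIsotopyIn_ball {p q : ℂ} {ρ : ℝ} (hq : q ∈ Metric.ball p ρ) :
    ∃ h k, IsIsotopyIn (Metric.ball p ρ) h k ∧ h (1, p) = q := by
  have hd : ‖q - p‖ < ρ := by rwa [Metric.mem_ball, dist_eq_norm] at hq
  have hρ : 0 < ρ := (norm_nonneg _).trans_lt hd
  set c : ℝ := ‖q - p‖ / ρ with hc
  have hc0 : 0 ≤ c := by positivity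
  have hc1 : c < 1 := (div_lt_one hρ).2 hd
  let b : ℂ → ℝ := fun x => max 0 (1 - ‖x - p‖ / ρ)
  let h : I × ℂ → ℂ := fun a => a.2 + ((a.1 : ℝ) * b a.2 : ℝ) * (q - p)
  have hb : ∀ x y, |b x - b y| ≤ ‖x - y‖ / ρ := fun x y => by
    refine (abs_max_sub_max_le_max 0 _ 0 _).trans (max_le (by simp; positivity) ?_)
    rw [show (1 - ‖x - p‖ / ρ) - (1 - ‖y - p‖ / ρ) = (‖y - p‖ - ‖x - p‖) / ρ by ring, abs_div,
      abs_of_pos hρ]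
    gcongr
    have := abs_norm_sub_norm_le (y - p) (x - p)
    rwa [show (y - p) - (x - p) = -(x - y) by ring, norm_neg] at this
  have hL : ∀ (t : I) x y, ‖h (t, x) - h (t, y) - (x - y)‖ ≤ c * ‖x - y‖ := fun t x y => by
    have : h (t, x) - h (t, y) - (x - y) = ((t : ℝ) * (b x - b y) : ℝ) * (q - p) := by
      simp only [h]; push_cast; ring
    rw [this, norm_mul, Complex.norm_real, Real.norm_eq_abs, abs_mul, abs_of_nonneg t.2.1]
    calc (t : ℝ) * |b x - b y| * ‖q - p‖ ≤ 1 * (‖x - y‖ / ρ) * ‖q - p‖ := by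
          gcongr
          · exact t.2.2
          · exact hb x y
      _ = c * ‖x - y‖ := by rw [hc]; ring
  have hcont : Continuous h := by
    have : Continuous b := by fun_prop
    fun_prop
  have happ : ∀ t : I, ApproximatesLinearOn (fun x => h (t, x))
      (ContinuousLinearEquiv.refl ℝ ℂ : ℂ →L[ℝ] ℂ) univ ⟨c, hc0⟩ := fun t => by
    intro x _ y _
    exact hL t x y
  have hsurj : ∀ t : I, Function.Surjective fun x => h (t, x) := fun t => by
    refine (happ t).surjective (Or.inr ?_)
    have h1 : ‖((ContinuousLinearEquiv.refl ℝ ℂ).symm : ℂ →L[ℝ] ℂ)‖₊ = 1 := by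
      apply NNReal.eq
      exact ContinuousLinearMap.norm_id
    rw [h1, inv_one]
    exact hc1
  have hexp : ∀ (t : I) x y, (1 - c) * ‖x - y‖ ≤ ‖h (t, x) - h (t, y)‖ := fun t x y => by
    have h1 := hL t x y
    have h2 := norm_sub_norm_le (x - y) (h (t, x) - h (t, y))
    rw [norm_sub_rev (x - y)] at h2
    linarith
  choose k hk using hsurj
  have hinj : ∀ (t : I) x y, h (t, x) = h (t, y) → x = y := fun t x y hxy => by
    have := hexp t x y
    rw [hxy, sub_self, norm_zero] at this
    have h3 : ‖x - y‖ ≤ 0 := by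
      by_contra! hpos
      nlinarith
    exact sub_eq_zero.1 (norm_le_zero_iff.1 h3)
  refine ⟨h, fun a => k a.1 a.2, ⟨hcont, ?_, fun x => by simp [h], fun t x => hinj t _ _ (hk t _),
    fun t x => hk t x, fun t x hx => ?_⟩, by simp [h, b]⟩
  · rw [continuous_iff_continuousAt]
    rintro ⟨t, x⟩
    rw [ContinuousAt, tendsto_iff_norm_sub_tendsto_zero]
    have hlim : Tendsto (fun a : I × ℂ => (1 - c)⁻¹ * ‖a.2 - h (a.1, k t x)‖) (𝓝 (t, x)) (𝓝 0) := by
      have hc' : Continuous fun a : I × ℂ => (1 - c)⁻¹ * ‖a.2 - h (a.1, k t x)‖ := by fun_prop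
      have := hc'.tendsto (t, x)
      simpa [hk t x] using this
    refine squeeze_zero (fun _ => norm_nonneg _) (fun a => ?_) hlim
    have := hexp a.1 (k a.1 a.2) (k t x)
    simp only at hk
    rw [hk] at this
    rw [inv_mul_eq_div, le_div_iff₀ (by linarith)]
    linarith
  · have : b x = 0 := by
      rw [Metric.mem_ball, dist_eq_norm, not_lt] at hx
      refine max_eq_left ?_
      rw [sub_nonpos, one_le_div hρ]
      exact hx
    simp [h, this]

/-- In a connected open set any point can be pushed to any other one. -/
lemma exists_isIsotopyIn {U : Set ℂ} (hU : IsOpen U) (hc : IsPreconnected U) {p q : ℂ}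
    (hp : p ∈ U) (hq : q ∈ U) : ∃ h k, IsIsotopyIn U h k ∧ h (1, p) = q := by
  refine hc.induction₂ (fun p q => ∃ h k, IsIsotopyIn U h k ∧ h (1, p) = q) (fun p hp => ?_)
    ?_ ?_ hp hq
  · obtain ⟨ρ, hρ, hb⟩ := Metric.isOpen_iff.1 hU p hp
    filter_upwards [mem_nhdsWithin_of_mem_nhds (Metric.ball_mem_nhds p hρ)] with q hq
    obtain ⟨h, k, hh, he⟩ := exists_isIsotopyIn_ball hq
    exact ⟨h, k, hh.mono hb, he⟩
  · rintro x y z - - - ⟨h, k, hh, rfl⟩ ⟨h', k', hh', rfl⟩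
    exact ⟨_, _, hh'.comp hh, rfl⟩
  · rintro x y - - ⟨h, k, hh, rfl⟩
    exact ⟨_, _, hh.symm, hh.left_inv _ _⟩

/-! ### Maps with compatible logarithms -/

/-- A continuous lift of the logarithm of a difference quotient along a homotopy of injective
maps; symmetry in the two variables is preserved along the homotopy. -/
lemma exists_log_quotient_homotopy {G : I × ℂ → ℂ} (hG : Continuous G)
    (hinj : ∀ t, Function.Injective fun x => G (t, x)) {θ : ℂ × ℂ → ℂ}
    (hθ : ContinuousOn θ {p | p.1 ≠ p.2}) (hs : ∀ x y, x ≠ y → θ (x, y) = θ (y, x))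
    (he : ∀ x y, x ≠ y → Complex.exp (θ (x, y)) * (x - y) = G (0, x) - G (0, y)) :
    ∃ Θ : I × ℂ × ℂ → ℂ, ContinuousOn Θ (univ ×ˢ {p | p.1 ≠ p.2}) ∧
      (∀ t x y, x ≠ y → Θ (t, x, y) = Θ (t, y, x)) ∧
      (∀ t x y, x ≠ y → Complex.exp (Θ (t, x, y)) * (x - y) = G (t, x) - G (t, y)) ∧
      ∀ x y, x ≠ y → Θ (0, x, y) = θ (x, y) := by
  obtain ⟨Θ, hΘ, hexp, h0⟩ := exists_continuousOn_log_homotopy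
    (S := {p : ℂ × ℂ | p.1 ≠ p.2}) (a := θ)
    (Φ := fun p : I × ℂ × ℂ => (G (p.1, p.2.1) - G (p.1, p.2.2)) / (p.2.1 - p.2.2))
    (by
      refine ContinuousOn.div (by fun_prop) (by fun_prop) ?_
      rintro ⟨t, x, y⟩ ⟨-, hp⟩
      exact sub_ne_zero.2 hp)
    (by
      rintro t ⟨x, y⟩ hp
      exact div_ne_zero (sub_ne_zero.2 fun h => hp (hinj t h)) (sub_ne_zero.2 hp))
    hθ
    (by
      rintro ⟨x, y⟩ hp
      rw [eq_div_iff (sub_ne_zero.2 hp)]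
      exact he x y hp)
  refine ⟨Θ, hΘ, fun t x y hxy => ?_, fun t x y hxy => ?_, fun x y hxy => h0 (x, y) hxy⟩
  · have hc : ∀ x y : ℂ, x ≠ y → Continuous fun t : I => Θ (t, x, y) := fun x y h =>
      hΘ.comp_continuous (f := fun t : I => (t, x, y)) (by fun_prop) fun t => ⟨mem_univ _, h⟩
    have key := eq_of_exp_eq_one_path (g := fun t => Θ (t, x, y) - Θ (t, y, x))
      ((hc x y hxy).sub (hc y x hxy.symm)) (fun t => by
        have h1 := hexp t (x, y) hxy
        have h2 := hexp t (y, x) hxy.symm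
        have e : (G (t, y) - G (t, x)) / (y - x) = (G (t, x) - G (t, y)) / (x - y) := by
          rw [← neg_sub, ← neg_sub x y, neg_div_neg_eq]
        simp only at h1 h2
        rw [Complex.exp_sub, h1, h2, e, div_self]
        rw [← h1]
        exact Complex.exp_ne_zero _) t 0
    rw [h0 (x, y) hxy, h0 (y, x) hxy.symm, hs x y hxy, sub_self] at key
    exact sub_eq_zero.1 key
  · have := hexp t (x, y) hxy
    rw [this]
    exact div_mul_cancel₀ _ (sub_ne_zero.2 hxy)

/-- `F` is a continuous injection of the plane whose difference quotient has a symmetric continuous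
logarithm `θ` and whose displacement has a continuous logarithm `α` on `N`, compatibly with
the cocycle relation `F (F z) - F z = exp (θ (F z, z)) * (F z - z)`. -/
structure IsGood (N : Set ℂ) (F : ℂ → ℂ) : Prop where
  continuous : Continuous F
  injective : Function.Injective F
  exists_logs : ∃ θ : ℂ × ℂ → ℂ, ∃ α : ℂ → ℂ, ContinuousOn θ {p | p.1 ≠ p.2} ∧
    (∀ x y, x ≠ y → θ (x, y) = θ (y, x)) ∧
    (∀ x y, x ≠ y → Complex.exp (θ (x, y)) * (x - y) = F x - F y) ∧
    ContinuousOn α N ∧ (∀ z ∈ N, Complex.exp (α z) = F z - z) ∧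
    ∀ z ∈ N, F z ∈ N → α (F z) = α z + θ (F z, z)

namespace IsGood

variable {N U V : Set ℂ} {F : ℂ → ℂ}

lemma ne_self (hF : IsGood N F) {z : ℂ} (hz : z ∈ N) : F z ≠ z := by
  obtain ⟨θ, α, -, -, -, -, h, -⟩ := hF.exists_logs
  intro he
  have := h z hz
  rw [he, sub_self] at this
  exact Complex.exp_ne_zero _ this

/-- Compatible logarithms exclude orbits of period two. -/
lemma not_two_cycle (hF : IsGood N F) {z : ℂ} (hz : z ∈ N) (hz' : F z ∈ N) :
    F (F z) ≠ z := by
  intro he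
  have hne := hF.ne_self hz
  obtain ⟨θ, α, -, hs, hθ, -, -, hr⟩ := hF.exists_logs
  have h1 := hr z hz hz'
  have h2 := hr (F z) hz' (he.symm ▸ hz)
  rw [he, hs z (F z) hne.symm] at h2
  have h0 : θ (F z, z) = 0 := by linear_combination (-h1 - h2) / 2
  have h3 := hθ (F z) z hne
  rw [h0, he, Complex.exp_zero] at h3
  exact hne (by linear_combination h3 / 2)

/-- Precomposing with an isotopy supported in a free open set preserves compatible logarithms. -/
lemma comp_isotopy (hF : IsGood N F) (hUN : U ⊆ N) (hfree : ∀ x ∈ U, F x ∉ U)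
    {h k : I × ℂ → ℂ} (hh : IsIsotopyIn U h k) : IsGood N fun x => F (h (1, x)) := by
  have hmaps : ∀ t, ∀ x ∈ N, k (t, x) ∈ N := fun t x hx => by
    by_cases hxU : x ∈ U
    · exact hUN (hh.symm.mem t hxU)
    · rwa [hh.inv_fixed t hxU]
  have hmaps' : ∀ t, ∀ x ∈ N, h (t, x) ∈ N := fun t x hx => by
    by_cases hxU : x ∈ U
    · exact hUN (hh.mem t hxU)
    · rwa [hh.fixed t x hxU]
  have hdisp : ∀ t, ∀ x ∈ N, F (h (t, x)) - x ≠ 0 := fun t x hx => by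
    rw [sub_ne_zero]
    by_cases hxU : x ∈ U
    · intro he
      exact hfree _ (hh.mem t hxU) (he.symm ▸ hxU)
    · rw [hh.fixed t x hxU]
      exact hF.ne_self hx
  have hFc := hF.continuous
  have hhc := hh.continuous
  have hkc := hh.continuous_inv
  obtain ⟨θ, α, hθc, hθs, hθ, hαc, hα, hr⟩ := hF.exists_logs
  obtain ⟨Θ, hΘc, hΘs, hΘ, hΘ0⟩ := exists_log_quotient_homotopy
    (G := fun p => F (h p)) (by fun_prop) (fun t => hF.injective.comp (hh.injective t)) hθc hθs
    (by simpa only [hh.zero] using hθ)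
  obtain ⟨A, hAc, hA, hA0⟩ := exists_continuousOn_log_homotopy (S := N) (a := α)
    (Φ := fun p => F (h p) - p.2) (by fun_prop) hdisp hαc
    (by simpa only [hh.zero] using hα)
  refine ⟨by fun_prop, hF.injective.comp (hh.injective 1), fun p => Θ (1, p), fun x => A (1, x),
    hΘc.comp (by fun_prop) fun p hp => ⟨mem_univ _, hp⟩, fun x y => hΘs 1 x y,
    fun x y => hΘ 1 x y, hAc.comp (by fun_prop) fun p hp => ⟨mem_univ _, hp⟩, hA 1,
    fun y hy hFy => ?_⟩
  set w := h (1, y) with hw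
  have hwN : w ∈ N := hmaps' 1 y hy
  set z : I → ℂ := fun t => k (t, w) with hz
  have hzN : ∀ t, z t ∈ N := fun t => hmaps t w hwN
  have hz1 : z 1 = y := hh.left_inv 1 y
  have hz0 : z 0 = w := hh.symm.zero w
  have hhz : ∀ t, h (t, z t) = w := fun t => hh.right_inv t w
  have hzc : Continuous z := by fun_prop
  have hne : ∀ t, F w ≠ z t := fun t => by
    have := hdisp t (z t) (hzN t)
    rwa [hhz, sub_ne_zero] at this
  have c1 : Continuous fun t : I => A (t, F w) :=
    hAc.comp_continuous (f := fun t : I => (t, F w)) (by fun_prop) fun t => ⟨mem_univ _, hFy⟩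
  have c2 : Continuous fun t : I => A (t, z t) :=
    hAc.comp_continuous (f := fun t : I => (t, z t)) (by fun_prop) fun t => ⟨mem_univ _, hzN t⟩
  have c3 : Continuous fun t : I => Θ (t, F w, z t) :=
    hΘc.comp_continuous (f := fun t : I => (t, F w, z t)) (by fun_prop)
      fun t => ⟨mem_univ _, hne t⟩
  have key := eq_of_exp_eq_one_path (g := fun t => A (t, F w) - A (t, z t) - Θ (t, F w, z t))
    ((c1.sub c2).sub c3) (fun t => by
      have h1 := hA t (F w) hFy
      have h2 := hA t (z t) (hzN t)
      have h3 := hΘ t (F w) (z t) (hne t)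
      rw [hhz] at h2 h3
      rw [Complex.exp_sub, Complex.exp_sub, div_div, div_eq_one_iff_eq
        (mul_ne_zero (Complex.exp_ne_zero _) (Complex.exp_ne_zero _)), h1, ← h3, h2]
      ring) 1 0
  rw [hz1, hz0, hA0 _ hFy, hA0 _ hwN, hΘ0 _ _ (hz0 ▸ hne 0), hr w hwN hFy] at key
  linear_combination key

end IsGood

/-! ### Shortest periodic orbits -/

/-- Some map with compatible logarithms on `N` has an orbit of period `n` inside a path connected
set `W ⊆ N` that it maps into `N`. -/
def HasOrbit (N : Set ℂ) (n : ℕ) : Prop :=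
  1 ≤ n ∧ ∃ F W x, IsGood N F ∧ IsPathConnected W ∧ W ⊆ N ∧ MapsTo F W N ∧
    (∀ i < n, F^[i] x ∈ W) ∧ F^[n] x = x

/-- An orbit as in `HasOrbit`, whose period is the smallest possible. -/
structure IsMinOrbit (N : Set ℂ) (n : ℕ) (F : ℂ → ℂ) (W : Set ℂ) (x : ℂ) : Prop where
  good : IsGood N F
  pathConnected : IsPathConnected W
  subset : W ⊆ N
  mapsTo : MapsTo F W N
  mem : ∀ i < n, F^[i] x ∈ W
  periodic : F^[n] x = x
  min : ∀ m < n, ¬ HasOrbit N m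

namespace IsMinOrbit

variable {N U V W : Set ℂ} {F : ℂ → ℂ} {n : ℕ} {x : ℂ}

/-- No precomposition with a homeomorphism can produce a shorter orbit. -/
lemma not_shorter (hF : IsMinOrbit N n F W x) {φ ψ : ℂ → ℂ} (hg : IsGood N fun z => F (φ z))
    (hψ : Continuous ψ) (hφψ : ∀ z, φ (ψ z) = z) (hψφ : ∀ z, ψ (φ z) = z)
    (hψN : MapsTo ψ N N) {m : ℕ} (hm : 1 ≤ m) (hmn : m < n) {y : ℂ}
    (hy : ∀ i < m, φ ((fun z => F (φ z))^[i] y) ∈ W) (hper : (fun z => F (φ z))^[m] y = y) :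
    False := by
  refine hF.min m hmn ⟨hm, _, ψ '' W, y, hg, hF.pathConnected.image hψ, ?_, ?_,
    fun i hi => ⟨_, hy i hi, hψφ _⟩, hper⟩
  · rintro _ ⟨z, hz, rfl⟩
    exact hψN (hF.subset hz)
  · rintro _ ⟨z, hz, rfl⟩
    simp only [hφψ]
    exact hF.mapsTo hz

/-- A free connected open set contains at most one point of a shortest orbit. -/
lemma not_mem_of_mem (hF : IsMinOrbit N n F W x) (hU : IsOpen U) (hUc : IsPreconnected U)
    (hUN : U ⊆ N) (hfree : ∀ z ∈ U, F z ∉ U) {i j : ℕ} (hij : i < j) (hj : j < n)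
    (hi : F^[i] x ∈ U) : F^[j] x ∉ U := by
  induction j using Nat.strong_induction_on generalizing i with
  | _ j ih =>
  intro hjU
  obtain ⟨h, k, hh, he⟩ := exists_isIsotopyIn hU hUc hjU hi
  have hφ : ∀ m < j - i, h (1, (fun z => F (h (1, z)))^[m] (F^[j] x)) = F^[i + m] x := by
    intro m hm
    induction m with
    | zero => simpa using he
    | succ m ihm =>
      rw [Function.iterate_succ_apply', ihm (by omega), ← Function.iterate_succ_apply' F]
      exact hh.fixed 1 _ (ih (i + m + 1) (by omega) (by omega) (by omega) hi)
  refine hF.not_shorter (φ := fun z => h (1, z)) (ψ := fun z => k (1, z)) (m := j - i)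
    (y := F^[j] x) (hF.good.comp_isotopy hUN hfree hh) ?_ (hh.right_inv 1) (hh.left_inv 1) ?_
    (by omega) (by omega) (fun m hm => ?_) ?_
  · exact hh.continuous_inv.comp (by fun_prop)
  · intro z hz
    by_cases hzU : z ∈ U
    · exact hUN (hh.symm.mem 1 hzU)
    · simpa only [hh.inv_fixed 1 hzU] using hz
  · rw [hφ m hm]
    exact hF.mem _ (by omega)
  · obtain ⟨m, hm⟩ : ∃ m, j - i = m + 1 := ⟨j - i - 1, by omega⟩
    rw [hm, Function.iterate_succ_apply', hφ m (by omega), ← Function.iterate_succ_apply' F]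
    congr 2
    omega

/-- Two overlapping free sets that contain the first two points of a shortest orbit, the image of
the second avoiding the first, would allow one to shorten the orbit. -/
lemma not_overlap (hF : IsMinOrbit N n F W x) (hn : 2 ≤ n)
    (hU : IsOpen U) (hUc : IsPreconnected U) (hUN : U ⊆ N) (hUf : ∀ z ∈ U, F z ∉ U)
    (hV : IsOpen V) (hVc : IsPreconnected V) (hVN : V ⊆ N) (hVf : ∀ z ∈ V, F z ∉ V)
    (hVU : ∀ z ∈ V, F z ∉ U) (hx : x ∈ U) (hFx : F x ∈ V) {y : ℂ} (hyU : y ∈ U) (hyV : y ∈ V) :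
    False := by
  obtain ⟨h', k', hh', he'⟩ := exists_isIsotopyIn hV hVc hyV hFx
  obtain ⟨h, k, hh, he⟩ := exists_isIsotopyIn hU hUc hx hyU
  have hg' := hF.good.comp_isotopy hVN hVf hh'
  have hg := hg'.comp_isotopy hUN (fun z hz => by
    by_cases hzV : z ∈ V
    · exact hVU _ (hh'.mem 1 hzV)
    · rw [hh'.fixed 1 z hzV]
      exact hUf z hz) hh
  set φ : ℂ → ℂ := fun z => h' (1, h (1, z)) with hφdef
  have hφ : ∀ m < n - 1, φ ((fun z => F (φ z))^[m] x) = F^[m + 1] x := by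
    intro m hm
    induction m with
    | zero => simp [hφdef, he, he']
    | succ m ihm =>
      rw [Function.iterate_succ_apply', ihm (by omega), ← Function.iterate_succ_apply' F]
      have h1 : F^[m + 2] x ∉ U := hF.not_mem_of_mem hU hUc hUN hUf (i := 0) (by omega)
        (by omega) hx
      have h2 : F^[m + 2] x ∉ V := hF.not_mem_of_mem hV hVc hVN hVf (i := 1) (by omega)
        (by omega) hFx
      simp only [hφdef]
      rw [hh.fixed 1 _ h1, hh'.fixed 1 _ h2]
  refine hF.not_shorter (φ := φ) (ψ := fun z => k (1, k' (1, z))) (m := n - 1) (y := x) hg ?_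
    (fun z => ?_) (fun z => ?_) ?_ (by omega) (by omega) (fun m hm => ?_) ?_
  · exact hh.continuous_inv.comp (continuous_const.prodMk
      (hh'.continuous_inv.comp (continuous_const.prodMk continuous_id)))
  · simp only [hφdef, hh.right_inv, hh'.right_inv]
  · simp only [hφdef, hh.left_inv, hh'.left_inv]
  · intro z hz
    have hz' : k' (1, z) ∈ N := by
      by_cases hzV : z ∈ V
      · exact hVN (hh'.symm.mem 1 hzV)
      · simpa only [hh'.inv_fixed 1 hzV] using hz
    by_cases hzU : k' (1, z) ∈ U
    · exact hUN (hh.symm.mem 1 hzU)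
    · simpa only [hh.inv_fixed 1 hzU] using hz'
  · rw [hφ m hm]
    exact hF.mem _ (by omega)
  · obtain ⟨m, hm⟩ : ∃ m, n - 1 = m + 1 := ⟨n - 2, by omega⟩
    rw [hm, Function.iterate_succ_apply', hφ m (by omega), ← Function.iterate_succ_apply' F,
      show (m + 1).succ = n by omega]
    exact hF.periodic

end IsMinOrbit

/-- A compact connected set disjoint from its image has a free connected neighbourhood. -/
lemma exists_free_neighborhood {K O : Set ℂ} (hK : IsCompact K) (hKc : IsPreconnected K)
    (hO : IsOpen O) (hKO : K ⊆ O) {F : ℂ → ℂ} (hF : Continuous F) (hd : Disjoint K (F '' K)) :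
    ∃ U, IsOpen U ∧ IsPreconnected U ∧ K ⊆ U ∧ IsCompact (closure U) ∧ closure U ⊆ O ∧
      ∀ z ∈ U, F z ∉ U := by
  obtain ⟨A, B, hA, hB, hKA, hKB, hAB⟩ := SeparatedNhds.of_isCompact_isCompact hK (hK.image hF) hd
  obtain ⟨δ, hδ, hsub⟩ := hK.exists_cthickening_subset_open
    ((hO.inter hA).inter (hB.preimage hF))
    (fun z hz => ⟨⟨hKO hz, hKA hz⟩, hKB (mem_image_of_mem F hz)⟩)
  have hU := Metric.thickening_subset_cthickening δ K
  have hcl := Metric.closure_thickening_subset_cthickening δ K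
  refine ⟨Metric.thickening δ K, Metric.isOpen_thickening, ?_, Metric.self_subset_thickening hδ K,
    hK.cthickening.of_isClosed_subset isClosed_closure hcl,
    fun z hz => (hsub (hcl hz)).1.1, fun z hz hz' => ?_⟩
  · rw [Metric.thickening_eq_biUnion_ball]
    rcases K.eq_empty_or_nonempty with rfl | ⟨z₀, hz₀⟩
    · simpa using isPreconnected_empty
    · refine isPreconnected_of_forall z₀ fun y hy => ?_
      obtain ⟨z, hz, hyz⟩ := mem_iUnion₂.1 hy
      refine ⟨K ∪ Metric.ball z δ, union_subset ?_ ?_, Or.inl hz₀, Or.inr hyz,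
        hKc.union z hz (Metric.mem_ball_self hδ) (convex_ball z δ).isPreconnected⟩
      · exact fun w hw => mem_iUnion₂.2 ⟨w, hw, Metric.mem_ball_self hδ⟩
      · exact fun w hw => mem_iUnion₂.2 ⟨z, hz, hw⟩
  · exact hAB.le_bot ⟨(hsub (hU hz')).1.2, (hsub (hU hz)).2⟩

/-- A continuous curve that meets its own image only from time `r` on does not meet its second
image before time `r`. -/
lemma IsGood.iterate_two_ne {N : Set ℂ} {F : ℂ → ℂ} (hF : IsGood N F) (hN : IsOpen N)
    {γ : I → ℂ} (hγ : Continuous γ) (hγN : ∀ t, γ t ∈ N) (hFγN : ∀ t, F (γ t) ∈ N) {r : I}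
    (hr : ∀ a < r, ∀ b < r, γ b ≠ F (γ a)) {a b : I} (ha : a < r) (hb : b < r) :
    F (F (γ a)) ≠ γ b := by
  intro he
  have hc : max a b < r := max_lt ha hb
  obtain ⟨U, hU, hUc, hKU, -, hUN, hUf⟩ := exists_free_neighborhood
    (K := γ '' Icc 0 (max a b)) (isCompact_Icc.image hγ)
    (isPreconnected_Icc.image γ hγ.continuousOn) hN
    (by rintro _ ⟨t, -, rfl⟩; exact hγN t) hF.continuous
    (by
      rw [Set.disjoint_left]
      rintro _ ⟨t, ht, rfl⟩ ⟨_, ⟨s, hs, rfl⟩, hst⟩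
      exact hr s (hs.2.trans_lt hc) t (ht.2.trans_lt hc) hst.symm)
  have haU : γ a ∈ U := hKU ⟨a, ⟨unitInterval.nonneg', le_max_left _ _⟩, rfl⟩
  have hbU : γ b ∈ U := hKU ⟨b, ⟨unitInterval.nonneg', le_max_right _ _⟩, rfl⟩
  obtain ⟨h, k, hh, hhb⟩ := exists_isIsotopyIn hU hUc hbU haU
  refine (hF.comp_isotopy (subset_closure.trans hUN) hUf hh).not_two_cycle (z := γ b) (hγN b) ?_ ?_
  · rw [hhb]
    exact hFγN a
  · rw [hhb, hh.fixed 1 _ (hUf _ haU), he]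

/-- Minimal orbits of period at least two do not exist. -/
lemma IsMinOrbit.false_of_two_le {N W : Set ℂ} {F : ℂ → ℂ} {n : ℕ} {x : ℂ}
    (hF : IsMinOrbit N n F W x) (hN : IsOpen N) (hn : 2 ≤ n) : False := by
  obtain ⟨p, hp⟩ := hF.pathConnected.joinedIn x (hF.mem 0 (by omega)) (F x) (hF.mem 1 (by omega))
  obtain ⟨γ, hγ, hγW, h0, h1⟩ : ∃ γ : I → ℂ, Continuous γ ∧ (∀ t, γ t ∈ W) ∧ γ 0 = x ∧
      γ 1 = F x := ⟨p, p.continuous, hp, p.source, p.target⟩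
  have hFc := hF.good.continuous
  have hγN : ∀ t, γ t ∈ N := fun t => hF.subset (hγW t)
  have hFγN : ∀ t, F (γ t) ∈ N := fun t => hF.mapsTo (hγW t)
  obtain ⟨⟨s, t⟩, hst, hmin⟩ := IsCompact.exists_isMinOn
    (s := {q : I × I | γ q.2 = F (γ q.1)}) (f := fun q : I × I => max q.1 q.2)
    (isClosed_eq (by fun_prop) (by fun_prop)).isCompact ⟨(0, 1), by simp [h0, h1]⟩
    (by fun_prop)
  simp only [mem_ofPred_eq] at hst
  have hr : ∀ a < max s t, ∀ b < max s t, γ b ≠ F (γ a) := fun a ha b hb he =>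
    (max_lt ha hb).not_ge (hmin (show (a, b) ∈ _ from he))
  have hr2 : ∀ a < max s t, ∀ b < max s t, F (F (γ a)) ≠ γ b := fun a ha b hb =>
    hF.good.iterate_two_ne hN hγ hγN hFγN hr ha hb
  have hKc : ∀ c : I, IsCompact (γ '' Icc 0 c) := fun c => isCompact_Icc.image hγ
  have hKp : ∀ c : I, IsPreconnected (γ '' Icc 0 c) := fun c =>
    isPreconnected_Icc.image γ hγ.continuousOn
  have hKd : ∀ c < max s t, Disjoint (γ '' Icc 0 c) (F '' (γ '' Icc 0 c)) := fun c hc => by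
    rw [Set.disjoint_left]
    rintro _ ⟨b, hb, rfl⟩ ⟨_, ⟨a, ha, rfl⟩, hab⟩
    exact hr a (ha.2.trans_lt hc) b (hb.2.trans_lt hc) hab.symm
  have hKd' : ∀ c < max s t, Disjoint (F '' (γ '' Icc 0 c)) (F '' (F '' (γ '' Icc 0 c))) :=
    fun c hc => (disjoint_image_iff hF.good.injective).2 (hKd c hc)
  have hK0 : ∀ c : I, x ∈ γ '' Icc 0 c := fun c => ⟨0, ⟨le_rfl, unitInterval.nonneg'⟩, h0⟩
  have hbefore : ∀ {A : Set I} (_ : IsOpen A) {a b : I} (_ : a < b) (_ : b ∈ A),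
      ∃ c < b, c ∈ A := fun hA a b hab hb => by
    have : (𝓝[<] b).NeBot := nhdsLT_neBot_of_exists_lt ⟨a, hab⟩
    exact Eventually.exists (Eventually.and (self_mem_nhdsWithin : Iio b ∈ 𝓝[<] b)
      (mem_nhdsWithin_of_mem_nhds (hA.mem_nhds hb)))
  rcases lt_trichotomy s t with hlt | rfl | hlt
  · rw [max_eq_right hlt.le] at *
    obtain ⟨V, hV, hVc, hKV, hVcl, hVO, hVf⟩ := exists_free_neighborhood
      (O := N ∩ F ⁻¹' (γ '' Icc 0 t)ᶜ) ((hKc s).image hFc)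
      ((hKp s).image F hFc.continuousOn)
      (hN.inter ((hKc t).isClosed.isOpen_compl.preimage hFc))
      (by
        rintro _ ⟨_, ⟨a, ha, rfl⟩, rfl⟩
        refine ⟨hFγN a, ?_⟩
        rintro ⟨b, hb, hab⟩
        rcases hb.2.lt_or_eq with hbt | rfl
        · exact hr2 a (ha.2.trans_lt hlt) b hbt hab.symm
        · rw [hst] at hab
          exact hr a (ha.2.trans_lt hlt) s hlt (hF.good.injective hab))
      hFc (hKd' s hlt)
    have htV : γ t ∈ V := hKV ⟨_, ⟨s, ⟨unitInterval.nonneg', le_rfl⟩, rfl⟩, hst.symm⟩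
    obtain ⟨c, hct, hcV⟩ := hbefore (hV.preimage hγ) hlt htV
    obtain ⟨U, hU, hUc, hKU, -, hUO, hUf⟩ := exists_free_neighborhood
      (O := N ∩ (F '' closure V)ᶜ) (hKc c) (hKp c)
      (hN.inter (hVcl.image hFc).isClosed.isOpen_compl)
      (by
        rintro _ ⟨b, hb, rfl⟩
        refine ⟨hγN b, ?_⟩
        rintro ⟨z, hz, hzb⟩
        exact (hVO hz).2 ⟨b, ⟨hb.1, hb.2.trans hct.le⟩, hzb.symm⟩)
      hFc (hKd c hct)
    exact hF.not_overlap hn hU hUc (fun z hz => (hUO (subset_closure hz)).1) hUf hV hVc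
      (fun z hz => (hVO (subset_closure hz)).1) hVf
      (fun z hz hFz => (hUO (subset_closure hFz)).2 ⟨z, subset_closure hz, rfl⟩)
      (hKU (hK0 c)) (hKV (mem_image_of_mem F (hK0 s)))
      (hKU ⟨c, ⟨unitInterval.nonneg', le_rfl⟩, rfl⟩) hcV
  · exact hF.good.ne_self (hγN s) hst.symm
  · rw [max_eq_left hlt.le] at *
    obtain ⟨U, hU, hUc, hKU, hUcl, hUO, hUf⟩ := exists_free_neighborhood
      (O := N ∩ (F '' (F '' (γ '' Icc 0 s)))ᶜ) (hKc t) (hKp t)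
      (hN.inter (((hKc s).image hFc).image hFc).isClosed.isOpen_compl)
      (by
        rintro _ ⟨b, hb, rfl⟩
        refine ⟨hγN b, ?_⟩
        rintro ⟨_, ⟨_, ⟨a, ha, rfl⟩, rfl⟩, hab⟩
        rcases ha.2.lt_or_eq with has | rfl
        · exact hr2 a has b (hb.2.trans_lt hlt) hab
        · rw [← hst] at hab
          exact hr t hlt b (hb.2.trans_lt hlt) hab.symm)
      hFc (hKd t hlt)
    have hsU : F (γ s) ∈ U := hKU ⟨t, ⟨unitInterval.nonneg', le_rfl⟩, hst⟩
    obtain ⟨c, hcs, hcU⟩ := hbefore (hU.preimage (hFc.comp hγ)) hlt hsU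
    obtain ⟨V, hV, hVc, hKV, -, hVO, hVf⟩ := exists_free_neighborhood
      (O := N ∩ F ⁻¹' (closure U)ᶜ) ((hKc c).image hFc)
      ((hKp c).image F hFc.continuousOn)
      (hN.inter (isClosed_closure.isOpen_compl.preimage hFc))
      (by
        rintro _ ⟨_, ⟨a, ha, rfl⟩, rfl⟩
        exact ⟨hFγN a, fun hcl => (hUO hcl).2
          ⟨_, ⟨_, ⟨a, ⟨ha.1, ha.2.trans hcs.le⟩, rfl⟩, rfl⟩, rfl⟩⟩)
      hFc (hKd' c hcs)
    exact hF.not_overlap hn hU hUc (fun z hz => (hUO (subset_closure hz)).1) hUf hV hVc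
      (fun z hz => (hVO (subset_closure hz)).1) hVf
      (fun z hz hFz => (hVO (subset_closure hz)).2 (subset_closure hFz))
      (hKU (hK0 t)) (hKV (mem_image_of_mem F (hK0 c)))
      hcU (hKV ⟨_, ⟨c, ⟨unitInterval.nonneg', le_rfl⟩, rfl⟩, rfl⟩)

/-- Maps with compatible logarithms have no periodic orbits. -/
lemma not_hasOrbit {N : Set ℂ} (hN : IsOpen N) (n : ℕ) : ¬ HasOrbit N n := by
  induction n using Nat.strong_induction_on with
  | _ n ih =>
  rintro ⟨hn, F, W, x, hF, hW, hWN, hm, hx, hper⟩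
  rcases hn.eq_or_lt with rfl | hn2
  · exact hF.ne_self (hWN (hx 0 (by omega))) hper
  · exact IsMinOrbit.false_of_two_le ⟨hF, hW, hWN, hm, hx, hper, ih⟩ hN hn2

/-! ### Constructing compatible logarithms near a contractible compact set -/

lemma eq_zero_of_exp_eq_one {w : ℂ} (h : Complex.exp w = 1) (hw : ‖w‖ < 1) : w = 0 := by
  have him := abs_lt.1 ((Complex.abs_im_le_norm w).trans_lt hw)
  have := Real.pi_gt_three
  rw [← Complex.log_exp (x := w) (by linarith) (by linarith), h, Complex.log_one]

/-- A nowhere vanishing continuous function on the plane has a continuous logarithm on a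
contractible closed set, which extends to a neighbourhood. -/
lemma exists_log_nhds {D : Set ℂ} (hD : IsClosed D) [ContractibleSpace D] {g : ℂ → ℂ}
    (hg : Continuous g) (h0 : ∀ z ∈ D, g z ≠ 0) :
    ∃ N : Set ℂ, IsOpen N ∧ D ⊆ N ∧ ∃ α : ℂ → ℂ, ContinuousOn α N ∧
      ∀ z ∈ N, Complex.exp (α z) = g z := by
  obtain ⟨p, ⟨c⟩⟩ := id_nullhomotopic D
  have hc0 : ∀ z, c.symm (0, z) = p := fun z => c.symm.map_zero_left z
  have hc1 : ∀ z, c.symm (1, z) = z := fun z => c.symm.map_one_left z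
  obtain ⟨Λ, hΛc, hΛ, -⟩ := exists_continuousOn_log_homotopy (S := (univ : Set D))
    (Φ := fun q => g (c.symm q)) (a := fun _ => Complex.log (g p)) (by fun_prop)
    (fun t x _ => h0 _ (c.symm (t, x)).2) continuousOn_const
    (fun x _ => by rw [hc0, Complex.exp_log (h0 p p.2)])
  rw [univ_prod_univ, continuousOn_univ] at hΛc
  obtain ⟨α, hα⟩ := ContinuousMap.exists_restrict_eq hD
    (⟨fun z => Λ (1, z), by fun_prop⟩ : C(D, ℂ))
  have hαD : ∀ z ∈ D, Complex.exp (α z) = g z := fun z hz => by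
    have h1 : α z = Λ (1, ⟨z, hz⟩) := congrArg (fun f : C(D, ℂ) => f ⟨z, hz⟩) hα
    have h2 := hΛ 1 ⟨z, hz⟩ (mem_univ _)
    rw [hc1] at h2
    rw [h1, h2]
  let q : ℂ → ℂ := fun z => g z * Complex.exp (-α z)
  have hq : Continuous q := by fun_prop
  have hslit : ∀ z, ‖q z - 1‖ < 1 → q z ∈ Complex.slitPlane := fun z hz => by
    simpa using Complex.mem_slitPlane_of_norm_lt_one hz
  refine ⟨{z | ‖q z - 1‖ < 1}, isOpen_lt (by fun_prop) (by fun_prop), fun z hz => ?_,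
    fun z => α z + Complex.log (q z), ?_, fun z hz => ?_⟩
  · simp [q, ← hαD z hz, ← Complex.exp_add]
  · exact α.continuous.continuousOn.add (hq.continuousOn.clog hslit)
  · rw [Complex.exp_add, Complex.exp_log (Complex.slitPlane_ne_zero (hslit z hz))]
    simp only [q]
    rw [mul_left_comm, ← Complex.exp_add, add_neg_cancel, Complex.exp_zero, mul_one]

/-- A fixed point free map isotopic to the identity has compatible logarithms near a contractible
compact set `D`, provided that `D` meets its preimage in a connected set. -/
lemma exists_isGood_nhds {D : Set ℂ} (hD : IsCompact D) [ContractibleSpace D] {F : ℂ → ℂ}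
    {H : I × ℂ → ℂ} (hH : Continuous H) (hinj : ∀ t, Function.Injective fun x => H (t, x))
    (hH0 : ∀ x, H (0, x) = x) (hH1 : ∀ x, H (1, x) = F x) (hC : IsConnected (D ∩ F ⁻¹' D))
    (hfix : ∀ z ∈ D, F z ≠ z) : ∃ N, IsOpen N ∧ D ⊆ N ∧ IsGood N F := by
  have hF : Continuous F := by
    have : F = fun x => H (1, x) := funext fun x => (hH1 x).symm
    rw [this]
    fun_prop
  have hFinj : Function.Injective F := by
    have : F = fun x => H (1, x) := funext fun x => (hH1 x).symm
    exact this ▸ hinj 1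
  obtain ⟨Θ, hΘc, hΘs, hΘ, -⟩ := exists_log_quotient_homotopy hH hinj (θ := fun _ => 0)
    continuousOn_const (fun _ _ _ => rfl) (fun x y _ => by simp [hH0])
  obtain ⟨N₁, hN₁, hDN₁, α, hαc, hα⟩ := exists_log_nhds hD.isClosed (g := fun z => F z - z)
    (by fun_prop) (fun z hz => sub_ne_zero.2 (hfix z hz))
  have hne : ∀ z ∈ N₁, F z ≠ z := fun z hz he => by
    have := hα z hz
    rw [he, sub_self] at this
    exact Complex.exp_ne_zero _ this
  set M : Set ℂ := N₁ ∩ F ⁻¹' N₁ with hM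
  have hMo : IsOpen M := hN₁.inter (hN₁.preimage hF)
  have hCM : D ∩ F ⁻¹' D ⊆ M := fun z hz => ⟨hDN₁ hz.1, hDN₁ hz.2⟩
  let β : ℂ → ℂ := fun z => α (F z) - α z - Θ (1, F z, z)
  have hβc : ContinuousOn β M := by
    refine ((hαc.comp hF.continuousOn fun z hz => hz.2).sub (hαc.mono inter_subset_left)).sub ?_
    exact hΘc.comp (f := fun z => ((1 : I), F z, z)) (by fun_prop)
      fun z hz => ⟨mem_univ _, hne z hz.1⟩
  have hβ : ∀ z ∈ M, Complex.exp (β z) = 1 := fun z hz => by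
    have h1 := hΘ 1 (F z) z (hne z hz.1)
    rw [hH1, hH1] at h1
    simp only [β]
    rw [Complex.exp_sub, Complex.exp_sub, div_div, div_eq_one_iff_eq
      (mul_ne_zero (Complex.exp_ne_zero _) (Complex.exp_ne_zero _)), hα _ hz.1, hα _ hz.2, ← h1]
    ring
  obtain ⟨z₀, hz₀⟩ := hC.nonempty
  have hβC : ∀ z ∈ D ∩ F ⁻¹' D, β z = β z₀ := fun z hz =>
    eq_of_exp_eq_one hC.isPreconnected (hβc.mono hCM) (fun w hw => hβ w (hCM hw)) hz hz₀
  set κ := β z₀ with hκ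
  have hκ1 : Complex.exp κ = 1 := hβ z₀ (hCM hz₀)
  have hG : IsOpen (M ∩ β ⁻¹' Metric.ball κ 1) := hβc.isOpen_inter_preimage hMo Metric.isOpen_ball
  set G := M ∩ β ⁻¹' Metric.ball κ 1 with hGdef
  have hβG : ∀ z ∈ G, β z = κ := fun z hz => by
    refine sub_eq_zero.1 (eq_zero_of_exp_eq_one ?_ ?_)
    · rw [Complex.exp_sub, hβ z hz.1, hκ1, div_one]
    · simpa [dist_eq_norm] using hz.2
  obtain ⟨O₁, O₂, hO₁, hO₂, hAO₁, hDO₂, hdisj⟩ := SeparatedNhds.of_isCompact_isCompact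
    ((hD.diff hG).image hF) hD (by
      rw [Set.disjoint_left]
      rintro _ ⟨z, hz, rfl⟩ hFz
      refine hz.2 ⟨hCM ⟨hz.1, hFz⟩, ?_⟩
      rw [mem_preimage, hβC z ⟨hz.1, hFz⟩]
      exact Metric.mem_ball_self one_pos)
  refine ⟨N₁ ∩ O₂ ∩ (G ∪ F ⁻¹' O₁), (hN₁.inter hO₂).inter (hG.union (hO₁.preimage hF)),
    fun z hz => ⟨⟨hDN₁ hz, hDO₂ hz⟩, ?_⟩, hF, hFinj, fun p => Θ (1, p) + κ, α, ?_,
    fun x y hxy => ?_, fun x y hxy => ?_, hαc.mono fun z hz => hz.1.1, fun z hz => hα z hz.1.1,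
    fun z hz hFz => ?_⟩
  · by_cases hzG : z ∈ G
    · exact Or.inl hzG
    · exact Or.inr (hAO₁ ⟨z, ⟨hz, hzG⟩, rfl⟩)
  · exact (hΘc.comp (f := fun p => ((1 : I), p)) (by fun_prop)
      fun p hp => ⟨mem_univ _, hp⟩).add continuousOn_const
  · simp only [hΘs 1 x y hxy]
  · rw [Complex.exp_add, hκ1, mul_one, hΘ 1 x y hxy, hH1, hH1]
  · have hzG : z ∈ G := hz.2.resolve_right fun h => hdisj.le_bot ⟨h, hFz.1.2⟩
    have := hβG z hzG
    simp only [β] at this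
    linear_combination this

/-- A map isotopic to the identity with a periodic orbit in a contractible compact set `D` that
meets its preimage in a connected set has a fixed point in `D`. -/
theorem exists_fixed_point_of_periodic {D : Set ℂ} (hD : IsCompact D) [ContractibleSpace D]
    {F : ℂ → ℂ} {H : I × ℂ → ℂ} (hH : Continuous H)
    (hinj : ∀ t, Function.Injective fun x => H (t, x)) (hH0 : ∀ x, H (0, x) = x)
    (hH1 : ∀ x, H (1, x) = F x) (hC : IsConnected (D ∩ F ⁻¹' D)) {n : ℕ} (hn : 1 ≤ n) {x : ℂ}
    (hx : ∀ i < n, F^[i] x ∈ D) (hper : F^[n] x = x) : ∃ p ∈ D, F p = p := by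
  by_contra! hfix
  obtain ⟨N, hN, hDN, hF⟩ := exists_isGood_nhds hD hH hinj hH0 hH1 hC hfix
  have hmem : ∀ i < n, F^[i] x ∈ D ∩ F ⁻¹' D := fun i hi => by
    refine ⟨hx i hi, ?_⟩
    rw [mem_preimage, ← Function.iterate_succ_apply' F]
    rcases (Nat.succ_le_of_lt hi).lt_or_eq with h | h
    · exact hx _ h
    · rw [h, hper]
      exact hx 0 hn
  have hsub : D ∩ F ⁻¹' D ⊆ N ∩ F ⁻¹' N := fun z hz => ⟨hDN hz.1, hDN hz.2⟩
  have hx0 := hmem 0 hn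
  have hWsub := connectedComponentIn_subset (N ∩ F ⁻¹' N) x
  refine not_hasOrbit hN n ⟨hn, F, connectedComponentIn (N ∩ F ⁻¹' N) x, x, hF, ?_,
    fun z hz => (hWsub hz).1, fun z hz => (hWsub hz).2, fun i hi => ?_, hper⟩
  · have hopen := (hN.inter (hN.preimage hF.continuous)).connectedComponentIn (x := x)
    exact hopen.isConnected_iff_isPathConnected.1
      (isConnected_connectedComponentIn_iff.2 (hsub hx0))
  · exact hC.isPreconnected.subset_connectedComponentIn hx0 hsub (hmem i hi)

/-- Let `D` be a Jordan domain and `f : D → E` an orientation-preserving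
homeomorphism onto its image with `D ∩ E` connected. If `f` has a periodic point,
then `f` has a fixed point. -/
theorem jordan_fixed_point_of_periodic (D E : Set Plane) (f : Plane → Plane)
    (hD : IsJordanDomain D)
    (hf : IsHomeoOnto f D E)
    (hor : OrientationPreservingOn f D)
    (hconn : IsConnected (D ∩ E))
    (x : Plane) (n : ℕ) (hn : 1 ≤ n)
    (horb : ∀ i < n, f^[i] x ∈ D)
    (hper : f^[n] x = x) :
    ∃ p ∈ D, f p = p := by
  obtain ⟨φ⟩ := hD
  obtain ⟨F, ⟨H, hH, hH0, hH1, hbij⟩, hfF⟩ := hor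
  obtain ⟨-, -, rfl⟩ := hf
  let e : Plane ≃ₜ ℂ := Complex.orthonormalBasisOneI.repr.symm.toHomeomorph
  have hDc : IsCompact D := by
    have : CompactSpace (Metric.closedBall (0 : Plane) 1) :=
      isCompact_iff_compactSpace.1 (isCompact_closedBall 0 1)
    exact isCompact_iff_compactSpace.2 φ.symm.compactSpace
  have : ContractibleSpace (Metric.closedBall (0 : Plane) 1) :=
    (convex_closedBall _ _).contractibleSpace ⟨0, Metric.mem_closedBall_self zero_le_one⟩
  have : ContractibleSpace (e '' D) := ((e.image D).symm.trans φ).contractibleSpace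
  have hiter : ∀ i ≤ n, F^[i] x = f^[i] x := fun i hi => by
    induction i with
    | zero => rfl
    | succ i ih =>
      rw [Function.iterate_succ_apply', Function.iterate_succ_apply', ih (by omega),
        hfF (horb i (by omega))]
  have hconj : ∀ i, (fun z => e (F (e.symm z)))^[i] (e x) = e (F^[i] x) := fun i =>
    ((Function.Semiconj.iterate_right (f := e) (ga := F)
      (gb := fun z => e (F (e.symm z))) (fun z => by simp) i) x).symm
  have hC : IsConnected (e '' D ∩ (fun z => e (F (e.symm z))) ⁻¹' (e '' D)) := by
    have : e '' D ∩ (fun z => e (F (e.symm z))) ⁻¹' (e '' D) =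
        (fun z => e (F.symm z)) '' (D ∩ f '' D) := by
      rw [hfF.image_eq]
      ext z
      constructor
      · rintro ⟨⟨a, ha, rfl⟩, ⟨b, hb, hab⟩⟩
        have hb' : b = F a := by simpa using e.injective hab
        exact ⟨F a, ⟨hb' ▸ hb, mem_image_of_mem F ha⟩, by simp⟩
      · rintro ⟨_, ⟨hFa, a, ha, rfl⟩, rfl⟩
        exact ⟨⟨a, ha, by simp⟩, ⟨F a, hFa, by simp⟩⟩
    rw [this]
    exact hconn.image _ (by fun_prop)
  obtain ⟨_, ⟨p, hp, rfl⟩, hfix⟩ := exists_fixed_point_of_periodic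
    (hDc.image e.continuous) (F := fun z => e (F (e.symm z)))
    (H := fun q => e (H q.1 (e.symm q.2)))
    (e.continuous.comp (hH.comp (f := fun q : I × ℂ => ((q.1 : ℝ), e.symm q.2)) (by fun_prop)))
    (fun t => e.injective.comp ((hbij t t.2).injective.comp e.symm.injective))
    (fun z => by simp [hH0]) (fun z => by simp [hH1]) hC hn (x := e x)
    (fun i hi => by
      rw [hconj, hiter i hi.le]
      exact mem_image_of_mem e (horb i hi))
    (by rw [hconj, hiter n le_rfl, hper])
  exact ⟨p, hp, (hfF hp).trans (by simpa using e.injective hfix)⟩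
end
end
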